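/- Let F be the 5-vertex graph with vertex set {0,1,2,3,4} and edge set {01, 12, 23, 30} (the 4-cycle plus an isolated vertex). Then the inducibility constant λ_F equals 5/32. Moreover, the problem of maximising λ_F is perfectly stable with respect to the family of graphs that are vertex-disjoint unions of two complete bipartite graphs (with possibly empty parts), i.e., blowups of the pattern 2K_2. -/

import Mathlib

open Finset
open scoped Classical

/-- Number of `κ`-element vertex subsets of `G` inducing a subgraph isomorphic to `F`. -/
noncomputable def numCopies {κ n : ℕ} (F : SimpleGraph (Fin κ)) (G : SimpleGraph (Fin n)) : ℕ :=
  ((Finset.powersetCard κ Finset.univ).filter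
    (fun S : Finset (Fin n) => Nonempty (F ≃g (G.induce (S : Set (Fin n)))))).card

/-- `λ_F(G)`: induced density of `F` in `G`. -/
noncomputable def lamF {κ n : ℕ} (F : SimpleGraph (Fin κ)) (G : SimpleGraph (Fin n)) : ℝ :=
  (numCopies F G : ℝ) / (n.choose κ : ℝ)

/-- `λ_F(n)`: the maximum of `λ_F(G)` over all graphs `G` on `n` vertices. -/
noncomputable def lamFmax {κ : ℕ} (F : SimpleGraph (Fin κ)) (n : ℕ) : ℝ :=
  ⨆ G : SimpleGraph (Fin n), lamF F G

/-- Edit distance between two graphs on `Fin n`: the minimum over bijections of the number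
of vertex pairs whose adjacency must be changed in `G` to obtain a graph isomorphic to `H`. -/
noncomputable def editDist {n : ℕ} (G H : SimpleGraph (Fin n)) : ℕ :=
  ⨅ σ : Equiv.Perm (Fin n),
    (Finset.univ.filter (fun p : Fin n × Fin n =>
      p.1 < p.2 ∧ ¬ (G.Adj p.1 p.2 ↔ H.Adj (σ p.1) (σ p.2)))).card

/-- Edit distance of `G` to the family of `n`-vertex graphs satisfying `P`. -/
noncomputable def distToFam {n : ℕ} (G : SimpleGraph (Fin n))
    (P : SimpleGraph (Fin n) → Prop) : ℕ :=
  ⨅ H : {H : SimpleGraph (Fin n) // P H}, editDist G H.1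

/-- A vertex-disjoint union of two complete bipartite graphs (with possibly empty parts):
a blowup of the pattern `2K₂`. -/
def isBlowup2K2 {n : ℕ} (G : SimpleGraph (Fin n)) : Prop :=
  ∃ c : Fin n → Fin 2 × Fin 2, ∀ u v,
    G.Adj u v ↔ ((c u).1 = (c v).1 ∧ (c u).2 ≠ (c v).2)

/-- The 4-cycle `{01, 12, 23, 30}` plus an isolated vertex, on vertex set `{0,1,2,3,4}`. -/
def fourCyclePlusVertex : SimpleGraph (Fin 5) :=
  SimpleGraph.fromRel (fun a b =>
    (a = 0 ∧ b = 1) ∨ (a = 1 ∧ b = 2) ∨ (a = 2 ∧ b = 3) ∨ (a = 3 ∧ b = 0))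

section
/-- 0/1 indicator -/
def ind (b : Bool) : ℤ := bif b then 1 else 0

/-- induced path with centre `y` -/
def p3 (xy yz xz : Bool) : Bool := xy && (yz && !xz)

/-- type of attachment of a vertex `v` to a path `x, y, z` and an isolated vertex `u` -/
inductive Att where
  | c0 | c1 | c2 | c3 | junk

def att (xv yv zv uv : Bool) : Att :=
  bif yv then (bif xv || (zv || uv) then .junk else .c0)
  else bif xv then (bif zv && !uv then .c1 else .junk)
  else bif zv then .junk else bif uv then .c3 else .c2

def isol (xu yu zu : Bool) : Bool := !xu && (!yu && !zu)

def gg (k : Att) : ℤ := match k with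
  | .c2 => -1
  | .c3 => 1
  | _ => 0

/-- admissible adjacency -/
def okp (k l : Att) (e : Bool) : Bool := match k with
  | .c0 => (match l with
    | .c1 => e
    | .junk => false
    | _ => !e)
  | .c1 => (match l with
    | .c0 => e
    | .junk => false
    | _ => !e)
  | .c2 => (match l with
    | .c3 => e
    | .junk => false
    | _ => !e)
  | .c3 => (match l with
    | .c2 => e
    | .c3 => true
    | .junk => false
    | _ => !e)
  | .junk => false

/-- `C4` on `x,y,z,u` and isolated `v`, given the path -/
def ff (xu yu zu xv yv zv uv : Bool) : Bool :=
  xu && (zu && (!yu && (isol xv yv zv && !uv)))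

def tt0 (k l : Att) (vw : Bool) : ℤ := 288 * (gg k * gg l) + ind (!okp k l vw)

def tt (xu yu zu xv yv zv xw yw zw uv uw vw : Bool) : ℤ :=
  bif isol xu yu zu then tt0 (att xv yv zv uv) (att xw yw zw uw) vw else 0

def q1 (xu yu zu xv yv zv xw yw zw uv uw vw : Bool) : ℤ :=
  288 - 1152 * ind (p3 uv vw uw) - 1728 * ind (ff xu yu zu xv yv zv uv)
    - tt xu yu zu xv yv zv xw yw zw uv uw vw

def phi1 (xc yc xd yd cd : Bool) : ℤ :=
  bif xc then
    bif yc then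
      (bif xd then (bif yd then 0 else (bif cd then 1 else 4))
        else (bif yd then (bif cd then -1 else -4) else 0))
    else
      (bif xd then (bif yd then (bif cd then 1 else 4) else (bif cd then 0 else 6))
        else (bif yd then 0 else (bif cd then 5 else 6)))
  else
    bif yc then
      (bif xd then (bif yd then (bif cd then -1 else -4) else 0)
        else (bif yd then (bif cd then 0 else -6) else (bif cd then -5 else -6)))
    else
      (bif xd then (bif yd then 0 else (bif cd then 5 else 6))
        else (bif yd then (bif cd then -5 else -6) else 0))

def phi2 (xc yc xd yd cd : Bool) : ℤ :=
  bif xc then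
    bif yc then
      (bif xd then (bif yd then 0 else (bif cd then -10 else 15))
        else (bif yd then (bif cd then 10 else -15) else 0))
    else
      (bif xd then (bif yd then (bif cd then -10 else 15) else (bif cd then -6 else 6))
        else (bif yd then 0 else (bif cd then 4 else 0)))
  else
    bif yc then
      (bif xd then (bif yd then (bif cd then 10 else -15) else 0)
        else (bif yd then (bif cd then 6 else -6) else (bif cd then -4 else 0)))
    else
      (bif xd then (bif yd then 0 else (bif cd then 4 else 0))
        else (bif yd then (bif cd then -4 else 0) else 0))

def q2 (xc yc xd yd cd xe ye xf yf ef : Bool) : ℤ :=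
  3 * (phi1 xc yc xd yd cd * phi1 xe ye xf yf ef) + phi2 xc yc xd yd cd * phi2 xe ye xf yf ef

def tri (xy xz xu xv xw yz yu yv yw zu zv zw uv uw vw : Bool) : ℤ :=
  bif p3 xy yz xz then q1 xu yu zu xv yv zv xw yw zw uv uw vw
    + (q1 xu yu zu xw yw zw xv yv zv uw uv vw
    + (q1 xv yv zv xu yu zu xw yw zw uv vw uw
    + (q1 xv yv zv xw yw zw xu yu zu vw uv uw
    + (q1 xw yw zw xu yu zu xv yv zv uw vw uv
    + (q1 xw yw zw xv yv zv xu yu zu vw uw uv))))) else 0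

def edg (xy xz xu xv xw yz yu yv yw zu zv zw uv uw vw : Bool) : ℤ :=
  bif xy then q2 xz yz xu yu zu xv yv xw yw vw
    + (q2 xz yz xv yv zv xu yu xw yw uw
    + (q2 xz yz xw yw zw xu yu xv yv uv)) else 0

def comp1 (b01 b02 b03 b04 b05 b12 b13 b14 b15 b23 b24 b25 b34 b35 b45 : Bool) : ℤ :=
  tri b01 b02 b03 b04 b05 b12 b13 b14 b15 b23 b24 b25 b34 b35 b45
    + (tri b01 b12 b13 b14 b15 b02 b03 b04 b05 b23 b24 b25 b34 b35 b45
    + (tri b02 b01 b03 b04 b05 b12 b23 b24 b25 b13 b14 b15 b34 b35 b45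
    + (tri b01 b03 b02 b04 b05 b13 b12 b14 b15 b23 b34 b35 b24 b25 b45
    + (tri b01 b13 b12 b14 b15 b03 b02 b04 b05 b23 b34 b35 b24 b25 b45
    + (tri b03 b01 b02 b04 b05 b13 b23 b34 b35 b12 b14 b15 b24 b25 b45
    + (tri b01 b04 b02 b03 b05 b14 b12 b13 b15 b24 b34 b45 b23 b25 b35
    + (tri b01 b14 b12 b13 b15 b04 b02 b03 b05 b24 b34 b45 b23 b25 b35
    + (tri b04 b01 b02 b03 b05 b14 b24 b34 b45 b12 b13 b15 b23 b25 b35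
    + (tri b01 b05 b02 b03 b04 b15 b12 b13 b14 b25 b35 b45 b23 b24 b34
    + (tri b01 b15 b12 b13 b14 b05 b02 b03 b04 b25 b35 b45 b23 b24 b34
    + (tri b05 b01 b02 b03 b04 b15 b25 b35 b45 b12 b13 b14 b23 b24 b34
    + (tri b02 b03 b01 b04 b05 b23 b12 b24 b25 b13 b34 b35 b14 b15 b45
    + (tri b02 b23 b12 b24 b25 b03 b01 b04 b05 b13 b34 b35 b14 b15 b45
    + (tri b03 b02 b01 b04 b05 b23 b13 b34 b35 b12 b24 b25 b14 b15 b45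
    + (tri b02 b04 b01 b03 b05 b24 b12 b23 b25 b14 b34 b45 b13 b15 b35
    + (tri b02 b24 b12 b23 b25 b04 b01 b03 b05 b14 b34 b45 b13 b15 b35
    + (tri b04 b02 b01 b03 b05 b24 b14 b34 b45 b12 b23 b25 b13 b15 b35
    + (tri b02 b05 b01 b03 b04 b25 b12 b23 b24 b15 b35 b45 b13 b14 b34
    + (tri b02 b25 b12 b23 b24 b05 b01 b03 b04 b15 b35 b45 b13 b14 b34
    + (tri b05 b02 b01 b03 b04 b25 b15 b35 b45 b12 b23 b24 b13 b14 b34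
    + (tri b03 b04 b01 b02 b05 b34 b13 b23 b35 b14 b24 b45 b12 b15 b25
    + (tri b03 b34 b13 b23 b35 b04 b01 b02 b05 b14 b24 b45 b12 b15 b25
    + (tri b04 b03 b01 b02 b05 b34 b14 b24 b45 b13 b23 b35 b12 b15 b25
    + (tri b03 b05 b01 b02 b04 b35 b13 b23 b34 b15 b25 b45 b12 b14 b24
    + (tri b03 b35 b13 b23 b34 b05 b01 b02 b04 b15 b25 b45 b12 b14 b24
    + (tri b05 b03 b01 b02 b04 b35 b15 b25 b45 b13 b23 b34 b12 b14 b24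
    + (tri b04 b05 b01 b02 b03 b45 b14 b24 b34 b15 b25 b35 b12 b13 b23
    + (tri b04 b45 b14 b24 b34 b05 b01 b02 b03 b15 b25 b35 b12 b13 b23
    + (tri b05 b04 b01 b02 b03 b45 b15 b25 b35 b14 b24 b34 b12 b13 b23
    + (tri b12 b13 b01 b14 b15 b23 b02 b24 b25 b03 b34 b35 b04 b05 b45
    + (tri b12 b23 b02 b24 b25 b13 b01 b14 b15 b03 b34 b35 b04 b05 b45
    + (tri b13 b12 b01 b14 b15 b23 b03 b34 b35 b02 b24 b25 b04 b05 b45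
    + (tri b12 b14 b01 b13 b15 b24 b02 b23 b25 b04 b34 b45 b03 b05 b35
    + (tri b12 b24 b02 b23 b25 b14 b01 b13 b15 b04 b34 b45 b03 b05 b35
    + (tri b14 b12 b01 b13 b15 b24 b04 b34 b45 b02 b23 b25 b03 b05 b35
    + (tri b12 b15 b01 b13 b14 b25 b02 b23 b24 b05 b35 b45 b03 b04 b34
    + (tri b12 b25 b02 b23 b24 b15 b01 b13 b14 b05 b35 b45 b03 b04 b34
    + (tri b15 b12 b01 b13 b14 b25 b05 b35 b45 b02 b23 b24 b03 b04 b34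
    + (tri b13 b14 b01 b12 b15 b34 b03 b23 b35 b04 b24 b45 b02 b05 b25
    + (tri b13 b34 b03 b23 b35 b14 b01 b12 b15 b04 b24 b45 b02 b05 b25
    + (tri b14 b13 b01 b12 b15 b34 b04 b24 b45 b03 b23 b35 b02 b05 b25
    + (tri b13 b15 b01 b12 b14 b35 b03 b23 b34 b05 b25 b45 b02 b04 b24
    + (tri b13 b35 b03 b23 b34 b15 b01 b12 b14 b05 b25 b45 b02 b04 b24
    + (tri b15 b13 b01 b12 b14 b35 b05 b25 b45 b03 b23 b34 b02 b04 b24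
    + (tri b14 b15 b01 b12 b13 b45 b04 b24 b34 b05 b25 b35 b02 b03 b23
    + (tri b14 b45 b04 b24 b34 b15 b01 b12 b13 b05 b25 b35 b02 b03 b23
    + (tri b15 b14 b01 b12 b13 b45 b05 b25 b35 b04 b24 b34 b02 b03 b23
    + (tri b23 b24 b02 b12 b25 b34 b03 b13 b35 b04 b14 b45 b01 b05 b15
    + (tri b23 b34 b03 b13 b35 b24 b02 b12 b25 b04 b14 b45 b01 b05 b15
    + (tri b24 b23 b02 b12 b25 b34 b04 b14 b45 b03 b13 b35 b01 b05 b15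
    + (tri b23 b25 b02 b12 b24 b35 b03 b13 b34 b05 b15 b45 b01 b04 b14
    + (tri b23 b35 b03 b13 b34 b25 b02 b12 b24 b05 b15 b45 b01 b04 b14
    + (tri b25 b23 b02 b12 b24 b35 b05 b15 b45 b03 b13 b34 b01 b04 b14
    + (tri b24 b25 b02 b12 b23 b45 b04 b14 b34 b05 b15 b35 b01 b03 b13
    + (tri b24 b45 b04 b14 b34 b25 b02 b12 b23 b05 b15 b35 b01 b03 b13
    + (tri b25 b24 b02 b12 b23 b45 b05 b15 b35 b04 b14 b34 b01 b03 b13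
    + (tri b34 b35 b03 b13 b23 b45 b04 b14 b24 b05 b15 b25 b01 b02 b12
    + (tri b34 b45 b04 b14 b24 b35 b03 b13 b23 b05 b15 b25 b01 b02 b12
    + (tri b35 b34 b03 b13 b23 b45 b05 b15 b25 b04 b14 b24 b01 b02 b12)))))))))))))))))))))))))))))))))))))))))))))))))))))))))))

def comp2 (b01 b02 b03 b04 b05 b12 b13 b14 b15 b23 b24 b25 b34 b35 b45 : Bool) : ℤ :=
  edg b01 b02 b03 b04 b05 b12 b13 b14 b15 b23 b24 b25 b34 b35 b45
    + (edg b02 b01 b03 b04 b05 b12 b23 b24 b25 b13 b14 b15 b34 b35 b45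
    + (edg b03 b01 b02 b04 b05 b13 b23 b34 b35 b12 b14 b15 b24 b25 b45
    + (edg b04 b01 b02 b03 b05 b14 b24 b34 b45 b12 b13 b15 b23 b25 b35
    + (edg b05 b01 b02 b03 b04 b15 b25 b35 b45 b12 b13 b14 b23 b24 b34
    + (edg b12 b01 b13 b14 b15 b02 b23 b24 b25 b03 b04 b05 b34 b35 b45
    + (edg b13 b01 b12 b14 b15 b03 b23 b34 b35 b02 b04 b05 b24 b25 b45
    + (edg b14 b01 b12 b13 b15 b04 b24 b34 b45 b02 b03 b05 b23 b25 b35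
    + (edg b15 b01 b12 b13 b14 b05 b25 b35 b45 b02 b03 b04 b23 b24 b34
    + (edg b23 b02 b12 b24 b25 b03 b13 b34 b35 b01 b04 b05 b14 b15 b45
    + (edg b24 b02 b12 b23 b25 b04 b14 b34 b45 b01 b03 b05 b13 b15 b35
    + (edg b25 b02 b12 b23 b24 b05 b15 b35 b45 b01 b03 b04 b13 b14 b34
    + (edg b34 b03 b13 b23 b35 b04 b14 b24 b45 b01 b02 b05 b12 b15 b25
    + (edg b35 b03 b13 b23 b34 b05 b15 b25 b45 b01 b02 b04 b12 b14 b24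
    + (edg b45 b04 b14 b24 b34 b05 b15 b25 b35 b01 b02 b03 b12 b13 b23))))))))))))))

def comp (b01 b02 b03 b04 b05 b12 b13 b14 b15 b23 b24 b25 b34 b35 b45 : Bool) : ℤ :=
  comp1 b01 b02 b03 b04 b05 b12 b13 b14 b15 b23 b24 b25 b34 b35 b45 - 8 * comp2 b01 b02 b03 b04 b05 b12 b13 b14 b15 b23 b24 b25 b34 b35 b45

def allB (f : Bool → Bool) : Bool := f true && f false

/-- degree -/
def dg (a b c d e : Bool) : ℕ := a.toNat + (b.toNat + (c.toNat + (d.toNat + e.toNat)))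

def impB (c r : Bool) : Bool := bif c then r else true

def chk : Bool :=
  allB fun b01 => allB fun b02 => allB fun b03 => allB fun b04 => allB fun b05 =>
  allB fun b12 => allB fun b13 => allB fun b14 => allB fun b15 =>
  impB (Nat.ble (dg b01 b02 b03 b04 b05) (dg b01 b12 b13 b14 b15)) <|
  allB fun b23 => allB fun b24 => allB fun b25 =>
  impB (Nat.ble (dg b01 b12 b13 b14 b15) (dg b02 b12 b23 b24 b25)) <|
  allB fun b34 => allB fun b35 =>
  impB (Nat.ble (dg b02 b12 b23 b24 b25) (dg b03 b13 b23 b34 b35)) <|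
  allB fun b45 =>
  impB (Nat.ble (dg b03 b13 b23 b34 b35) (dg b04 b14 b24 b34 b45)) <|
  impB (Nat.ble (dg b04 b14 b24 b34 b45) (dg b05 b15 b25 b35 b45)) <|
    decide (0 ≤ comp b01 b02 b03 b04 b05 b12 b13 b14 b15 b23 b24 b25 b34 b35 b45)

set_option maxHeartbeats 2000000 in
theorem chk_true : chk = true := by decide +kernel

theorem allB_iff (f : Bool → Bool) : allB f = true ↔ ∀ b, f b = true := by
  constructor
  · intro h b
    simp only [allB, Bool.and_eq_true] at h
    cases b
    · exact h.2
    · exact h.1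
  · intro h
    simp [allB, h]

theorem impB_iff (c r : Bool) : impB c r = true ↔ (c = true → r = true) := by
  cases c <;> simp [impB]

theorem comp_nonneg (b01 b02 b03 b04 b05 b12 b13 b14 b15 b23 b24 b25 b34 b35 b45 : Bool)
    (h1 : (dg b01 b02 b03 b04 b05) ≤ (dg b01 b12 b13 b14 b15)) (h2 : (dg b01 b12 b13 b14 b15) ≤ (dg b02 b12 b23 b24 b25)) (h3 : (dg b02 b12 b23 b24 b25) ≤ (dg b03 b13 b23 b34 b35)) (h4 : (dg b03 b13 b23 b34 b35) ≤ (dg b04 b14 b24 b34 b45)) (h5 : (dg b04 b14 b24 b34 b45) ≤ (dg b05 b15 b25 b35 b45)) :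
    0 ≤ comp b01 b02 b03 b04 b05 b12 b13 b14 b15 b23 b24 b25 b34 b35 b45 := by
  have h := chk_true
  simp only [chk, allB_iff, impB_iff, Nat.ble_eq, decide_eq_true_eq] at h
  exact h b01 b02 b03 b04 b05 b12 b13 b14 b15 h1 b23 b24 b25 h2 b34 b35 h3 b45 h4 h5
end

section
/-- permutation of `Fin (n+1)` from its first value and a permutation of the rest -/
noncomputable def consPerm {n : ℕ} (p : Fin (n + 1)) (e : Equiv.Perm (Fin n)) :
    Equiv.Perm (Fin (n + 1)) :=
  Equiv.ofBijective (Fin.cons p (p.succAbove ∘ e) : Fin (n + 1) → Fin (n + 1)) (by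
    rw [← Finite.injective_iff_bijective, Fin.cons_injective_iff]
    refine ⟨?_, (Fin.succAbove_right_injective).comp e.injective⟩
    rintro ⟨i, hi⟩
    exact Fin.succAbove_ne p _ hi)

theorem sum_perm_succ {n : ℕ} (g : (Fin (n + 1) → Fin (n + 1)) → ℤ) :
    ∑ σ : Equiv.Perm (Fin (n + 1)), g σ
      = ∑ p : Fin (n + 1), ∑ e : Equiv.Perm (Fin n), g (Fin.cons p (p.succAbove ∘ e)) := by
  rw [← Finset.sum_product', Finset.univ_product_univ]
  symm
  apply Fintype.sum_bijective (fun q : Fin (n + 1) × Equiv.Perm (Fin n) => consPerm q.1 q.2)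
  · rw [Fintype.bijective_iff_injective_and_card]
    constructor
    · rintro ⟨p, e⟩ ⟨p', e'⟩ h
      have h2 : (Fin.cons p (p.succAbove ∘ e) : Fin (n + 1) → Fin (n + 1))
          = Fin.cons p' (p'.succAbove ∘ e') := by
        funext i
        exact congrArg (fun σ : Equiv.Perm (Fin (n + 1)) => σ i) h
      obtain ⟨h3, h4⟩ := Fin.cons_injective2 h2
      subst h3
      simp only [Prod.mk.injEq, true_and]
      ext i
      have := congrFun h4 i
      simp only [Function.comp] at this
      exact congrArg _ (Fin.succAbove_right_injective this)
    · simp [Fintype.card_perm, Nat.factorial_succ]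
  · rintro ⟨p, e⟩
    rfl

theorem sum_perm_zero (g : (Fin 0 → Fin 0) → ℤ) :
    ∑ σ : Equiv.Perm (Fin 0), g σ = g ![] := by
  rw [Fintype.sum_unique]
  congr 1
  exact Subsingleton.elim _ _

theorem sum_perm_two (g : Fin 2 → Fin 2 → ℤ) :
    ∑ σ : Equiv.Perm (Fin 2), g (σ 0) (σ 1) = g 0 1 + g 1 0 := by
  have h : ∑ σ : Equiv.Perm (Fin 2), g (σ 0) (σ 1)
      = ∑ p : Fin 2, ∑ e : Equiv.Perm (Fin 1), g p (p.succAbove (e 0)) := by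
    rw [sum_perm_succ (fun σ => g (σ 0) (σ 1))]
    rfl
  rw [h]
  simp only [Fin.sum_univ_two, Fintype.sum_unique]
  rfl

theorem sum_perm_three (g : Fin 3 → Fin 3 → Fin 3 → ℤ) :
    ∑ σ : Equiv.Perm (Fin 3), g (σ 0) (σ 1) (σ 2)
      = g 0 1 2 + (g 0 2 1 + (g 1 0 2 + (g 1 2 0 + (g 2 0 1 + g 2 1 0)))) := by
  have h : ∑ σ : Equiv.Perm (Fin 3), g (σ 0) (σ 1) (σ 2)
      = ∑ p : Fin 3, ∑ e : Equiv.Perm (Fin 2), g p (p.succAbove (e 0)) (p.succAbove (e 1)) := by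
    rw [sum_perm_succ (fun σ => g (σ 0) (σ 1) (σ 2))]
    rfl
  rw [h]
  simp only [fun p : Fin 3 => sum_perm_two (fun i j => g p (p.succAbove i) (p.succAbove j)),
    Fin.sum_univ_three]
  change (g 0 1 2 + g 0 2 1) + (g 1 0 2 + g 1 2 0) + (g 2 0 1 + g 2 1 0) = _
  ring

theorem sum_perm_four (g : Fin 4 → Fin 4 → Fin 4 → Fin 4 → ℤ) :
    ∑ σ : Equiv.Perm (Fin 4), g (σ 0) (σ 1) (σ 2) (σ 3)
      = ∑ p : Fin 4, ∑ e : Equiv.Perm (Fin 3), g p (p.succAbove (e 0)) (p.succAbove (e 1))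
          (p.succAbove (e 2)) := by
  rw [sum_perm_succ (fun σ => g (σ 0) (σ 1) (σ 2) (σ 3))]
  rfl

theorem sum_perm_pair (Φ : Fin 4 → Fin 4 → ℤ) (h : ∀ i j, Φ i j = Φ j i) :
    ∑ σ : Equiv.Perm (Fin 4), Φ (σ 0) (σ 1) * Φ (σ 2) (σ 3)
      = 8 * (Φ 0 1 * Φ 2 3 + (Φ 0 2 * Φ 1 3 + Φ 0 3 * Φ 1 2)) := by
  rw [sum_perm_four (fun i j k l => Φ i j * Φ k l)]
  simp only [fun p : Fin 4 => sum_perm_three (fun i j k => Φ p (p.succAbove i) *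
    Φ (p.succAbove j) (p.succAbove k)), Fin.sum_univ_four]
  change (Φ 0 1 * Φ 2 3 + (Φ 0 1 * Φ 3 2 + (Φ 0 2 * Φ 1 3 + (Φ 0 2 * Φ 3 1 + (Φ 0 3 * Φ 1 2
    + Φ 0 3 * Φ 2 1))))) + (Φ 1 0 * Φ 2 3 + (Φ 1 0 * Φ 3 2 + (Φ 1 2 * Φ 0 3 + (Φ 1 2 * Φ 3 0
    + (Φ 1 3 * Φ 0 2 + Φ 1 3 * Φ 2 0))))) + (Φ 2 0 * Φ 1 3 + (Φ 2 0 * Φ 3 1 + (Φ 2 1 * Φ 0 3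
    + (Φ 2 1 * Φ 3 0 + (Φ 2 3 * Φ 0 1 + Φ 2 3 * Φ 1 0))))) + (Φ 3 0 * Φ 1 2 + (Φ 3 0 * Φ 2 1
    + (Φ 3 1 * Φ 0 2 + (Φ 3 1 * Φ 2 0 + (Φ 3 2 * Φ 0 1 + Φ 3 2 * Φ 1 0))))) = _
  rw [h 1 0, h 2 0, h 3 0, h 2 1, h 3 1, h 3 2]
  ring
end

section
open Finset
set_option maxRecDepth 4000

theorem sum_tri (T : Fin 6 → Fin 6 → Fin 6 → Fin 6 → Fin 6 → Fin 6 → ℤ)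
    (h : ∀ x y z u v w, T x y z u v w = T z y x u v w) :
    ∑ p : Fin 6, ∑ q : Fin 5, ∑ s : Fin 4, T p (p.succAbove q) (p.succAbove (q.succAbove s))
      (p.succAbove (q.succAbove (s.succAbove 0))) (p.succAbove (q.succAbove (s.succAbove 1)))
      (p.succAbove (q.succAbove (s.succAbove 2))) =
    2 * (
    T 0 1 2 3 4 5 + (T 1 0 2 3 4 5 + (T 0 2 1 3 4 5 + (T 0 1 3 2 4 5 + (T 1 0 3 2 4 5 + (T 0 3 1
    2 4 5 + (T 0 1 4 2 3 5 + (T 1 0 4 2 3 5 + (T 0 4 1 2 3 5 + (T 0 1 5 2 3 4 + (T 1 0 5 2 3 4 +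
    (T 0 5 1 2 3 4 + (T 0 2 3 1 4 5 + (T 2 0 3 1 4 5 + (T 0 3 2 1 4 5 + (T 0 2 4 1 3 5 + (T 2 0
    4 1 3 5 + (T 0 4 2 1 3 5 + (T 0 2 5 1 3 4 + (T 2 0 5 1 3 4 + (T 0 5 2 1 3 4 + (T 0 3 4 1 2 5
    + (T 3 0 4 1 2 5 + (T 0 4 3 1 2 5 + (T 0 3 5 1 2 4 + (T 3 0 5 1 2 4 + (T 0 5 3 1 2 4 + (T 0
    4 5 1 2 3 + (T 4 0 5 1 2 3 + (T 0 5 4 1 2 3 + (T 1 2 3 0 4 5 + (T 2 1 3 0 4 5 + (T 1 3 2 0 4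
    5 + (T 1 2 4 0 3 5 + (T 2 1 4 0 3 5 + (T 1 4 2 0 3 5 + (T 1 2 5 0 3 4 + (T 2 1 5 0 3 4 + (T
    1 5 2 0 3 4 + (T 1 3 4 0 2 5 + (T 3 1 4 0 2 5 + (T 1 4 3 0 2 5 + (T 1 3 5 0 2 4 + (T 3 1 5 0
    2 4 + (T 1 5 3 0 2 4 + (T 1 4 5 0 2 3 + (T 4 1 5 0 2 3 + (T 1 5 4 0 2 3 + (T 2 3 4 0 1 5 +
    (T 3 2 4 0 1 5 + (T 2 4 3 0 1 5 + (T 2 3 5 0 1 4 + (T 3 2 5 0 1 4 + (T 2 5 3 0 1 4 + (T 2 4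
    5 0 1 3 + (T 4 2 5 0 1 3 + (T 2 5 4 0 1 3 + (T 3 4 5 0 1 2 + (T 4 3 5 0 1 2 + (T 3 5 4 0 1
    2)))))))))))))))))))))))))))))))))))))))))))))))))))))))))))) := by
  simp only [Fin.sum_univ_six, Fin.sum_univ_five, Fin.sum_univ_four]
  change
    ((T 0 1 2 3 4 5 + T 0 1 3 2 4 5 + T 0 1 4 2 3 5 + T 0 1 5 2 3 4) + (T 0 2 1 3 4 5 + T 0 2 3
    1 4 5 + T 0 2 4 1 3 5 + T 0 2 5 1 3 4) + (T 0 3 1 2 4 5 + T 0 3 2 1 4 5 + T 0 3 4 1 2 5 + T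
    0 3 5 1 2 4) + (T 0 4 1 2 3 5 + T 0 4 2 1 3 5 + T 0 4 3 1 2 5 + T 0 4 5 1 2 3) + (T 0 5 1 2
    3 4 + T 0 5 2 1 3 4 + T 0 5 3 1 2 4 + T 0 5 4 1 2 3)) + ((T 1 0 2 3 4 5 + T 1 0 3 2 4 5 + T
    1 0 4 2 3 5 + T 1 0 5 2 3 4) + (T 1 2 0 3 4 5 + T 1 2 3 0 4 5 + T 1 2 4 0 3 5 + T 1 2 5 0 3
    4) + (T 1 3 0 2 4 5 + T 1 3 2 0 4 5 + T 1 3 4 0 2 5 + T 1 3 5 0 2 4) + (T 1 4 0 2 3 5 + T 1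
    4 2 0 3 5 + T 1 4 3 0 2 5 + T 1 4 5 0 2 3) + (T 1 5 0 2 3 4 + T 1 5 2 0 3 4 + T 1 5 3 0 2 4
    + T 1 5 4 0 2 3)) + ((T 2 0 1 3 4 5 + T 2 0 3 1 4 5 + T 2 0 4 1 3 5 + T 2 0 5 1 3 4) + (T 2
    1 0 3 4 5 + T 2 1 3 0 4 5 + T 2 1 4 0 3 5 + T 2 1 5 0 3 4) + (T 2 3 0 1 4 5 + T 2 3 1 0 4 5
    + T 2 3 4 0 1 5 + T 2 3 5 0 1 4) + (T 2 4 0 1 3 5 + T 2 4 1 0 3 5 + T 2 4 3 0 1 5 + T 2 4 5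
    0 1 3) + (T 2 5 0 1 3 4 + T 2 5 1 0 3 4 + T 2 5 3 0 1 4 + T 2 5 4 0 1 3)) + ((T 3 0 1 2 4 5
    + T 3 0 2 1 4 5 + T 3 0 4 1 2 5 + T 3 0 5 1 2 4) + (T 3 1 0 2 4 5 + T 3 1 2 0 4 5 + T 3 1 4
    0 2 5 + T 3 1 5 0 2 4) + (T 3 2 0 1 4 5 + T 3 2 1 0 4 5 + T 3 2 4 0 1 5 + T 3 2 5 0 1 4) +
    (T 3 4 0 1 2 5 + T 3 4 1 0 2 5 + T 3 4 2 0 1 5 + T 3 4 5 0 1 2) + (T 3 5 0 1 2 4 + T 3 5 1 0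
    2 4 + T 3 5 2 0 1 4 + T 3 5 4 0 1 2)) + ((T 4 0 1 2 3 5 + T 4 0 2 1 3 5 + T 4 0 3 1 2 5 + T
    4 0 5 1 2 3) + (T 4 1 0 2 3 5 + T 4 1 2 0 3 5 + T 4 1 3 0 2 5 + T 4 1 5 0 2 3) + (T 4 2 0 1
    3 5 + T 4 2 1 0 3 5 + T 4 2 3 0 1 5 + T 4 2 5 0 1 3) + (T 4 3 0 1 2 5 + T 4 3 1 0 2 5 + T 4
    3 2 0 1 5 + T 4 3 5 0 1 2) + (T 4 5 0 1 2 3 + T 4 5 1 0 2 3 + T 4 5 2 0 1 3 + T 4 5 3 0 1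
    2)) + ((T 5 0 1 2 3 4 + T 5 0 2 1 3 4 + T 5 0 3 1 2 4 + T 5 0 4 1 2 3) + (T 5 1 0 2 3 4 + T
    5 1 2 0 3 4 + T 5 1 3 0 2 4 + T 5 1 4 0 2 3) + (T 5 2 0 1 3 4 + T 5 2 1 0 3 4 + T 5 2 3 0 1
    4 + T 5 2 4 0 1 3) + (T 5 3 0 1 2 4 + T 5 3 1 0 2 4 + T 5 3 2 0 1 4 + T 5 3 4 0 1 2) + (T 5
    4 0 1 2 3 + T 5 4 1 0 2 3 + T 5 4 2 0 1 3 + T 5 4 3 0 1 2)) = _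
  rw [h 1 2 0, h 1 3 0, h 1 4 0, h 1 5 0, h 2 0 1, h 2 1 0, h 2 3 0, h 2 3 1, h 2 4 0, h 2 4 1, h
    2 5 0, h 2 5 1, h 3 0 1, h 3 0 2, h 3 1 0, h 3 1 2, h 3 2 0, h 3 2 1, h 3 4 0, h 3 4 1,
    h 3 4 2, h 3 5 0, h 3 5 1, h 3 5 2, h 4 0 1, h 4 0 2, h 4 0 3, h 4 1 0, h 4 1 2, h 4 1
    3, h 4 2 0, h 4 2 1, h 4 2 3, h 4 3 0, h 4 3 1, h 4 3 2, h 4 5 0, h 4 5 1, h 4 5 2, h 4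
    5 3, h 5 0 1, h 5 0 2, h 5 0 3, h 5 0 4, h 5 1 0, h 5 1 2, h 5 1 3, h 5 1 4, h 5 2 0, h
    5 2 1, h 5 2 3, h 5 2 4, h 5 3 0, h 5 3 1, h 5 3 2, h 5 3 4, h 5 4 0, h 5 4 1, h 5 4 2,
    h 5 4 3]
  ring

theorem sum_edg (T : Fin 6 → Fin 6 → Fin 6 → Fin 6 → Fin 6 → Fin 6 → ℤ)
    (h : ∀ x y z u v w, T x y z u v w = T y x z u v w) :
    ∑ p : Fin 6, ∑ q : Fin 5, T p (p.succAbove q) (p.succAbove (q.succAbove 0))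
      (p.succAbove (q.succAbove 1)) (p.succAbove (q.succAbove 2)) (p.succAbove (q.succAbove 3)) =
    2 * (
    T 0 1 2 3 4 5 + (T 0 2 1 3 4 5 + (T 0 3 1 2 4 5 + (T 0 4 1 2 3 5 + (T 0 5 1 2 3 4 + (T 1 2 0
    3 4 5 + (T 1 3 0 2 4 5 + (T 1 4 0 2 3 5 + (T 1 5 0 2 3 4 + (T 2 3 0 1 4 5 + (T 2 4 0 1 3 5 +
    (T 2 5 0 1 3 4 + (T 3 4 0 1 2 5 + (T 3 5 0 1 2 4 + (T 4 5 0 1 2 3))))))))))))))) := by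
  simp only [Fin.sum_univ_six, Fin.sum_univ_five]
  change
    (T 0 1 2 3 4 5 + T 0 2 1 3 4 5 + T 0 3 1 2 4 5 + T 0 4 1 2 3 5 + T 0 5 1 2 3 4) + (T 1 0 2 3
    4 5 + T 1 2 0 3 4 5 + T 1 3 0 2 4 5 + T 1 4 0 2 3 5 + T 1 5 0 2 3 4) + (T 2 0 1 3 4 5 + T 2
    1 0 3 4 5 + T 2 3 0 1 4 5 + T 2 4 0 1 3 5 + T 2 5 0 1 3 4) + (T 3 0 1 2 4 5 + T 3 1 0 2 4 5
    + T 3 2 0 1 4 5 + T 3 4 0 1 2 5 + T 3 5 0 1 2 4) + (T 4 0 1 2 3 5 + T 4 1 0 2 3 5 + T 4 2 0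
    1 3 5 + T 4 3 0 1 2 5 + T 4 5 0 1 2 3) + (T 5 0 1 2 3 4 + T 5 1 0 2 3 4 + T 5 2 0 1 3 4 + T
    5 3 0 1 2 4 + T 5 4 0 1 2 3) = _
  rw [h 1 0, h 2 0, h 2 1, h 3 0, h 3 1, h 3 2, h 4 0, h 4 1, h 4 2, h 4 3, h 5 0, h 5 1, h 5 2, h
    5 3, h 5 4]
  ring
end

section
section generic
variable {V : Type*}

def qA (a : V → V → Bool) (x y z u v w : V) : ℤ :=
  bif p3 (a x y) (a y z) (a x z) then
    q1 (a x u) (a y u) (a z u) (a x v) (a y v) (a z v) (a x w) (a y w) (a z w) (a u v) (a u w)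
      (a v w)
  else 0

def qB (a : V → V → Bool) (x y z u v w : V) : ℤ :=
  bif a x y then
    q2 (a x z) (a y z) (a x u) (a y u) (a z u) (a x v) (a y v) (a x w) (a y w) (a v w)
  else 0

def qq (a : V → V → Bool) (x : Fin 6 → V) : ℤ :=
  qA a (x 0) (x 1) (x 2) (x 3) (x 4) (x 5) - qB a (x 0) (x 1) (x 2) (x 3) (x 4) (x 5)

def triA (a : V → V → Bool) (x y z u v w : V) : ℤ :=
    tri (a x y) (a x z) (a x u) (a x v) (a x w) (a y z) (a y u) (a y v) (a y w) (a z u) (a z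
      v) (a z w) (a u v) (a u w) (a v w)

def edgA (a : V → V → Bool) (x y z u v w : V) : ℤ :=
    edg (a x y) (a x z) (a x u) (a x v) (a x w) (a y z) (a y u) (a y v) (a y w) (a z u) (a z
      v) (a z w) (a u v) (a u w) (a v w)

end generic

theorem phi1_symm (xc yc xd yd cd : Bool) : phi1 xc yc xd yd cd = phi1 xd yd xc yc cd := by
  revert xc yc xd yd cd; decide

theorem phi2_symm (xc yc xd yd cd : Bool) : phi2 xc yc xd yd cd = phi2 xd yd xc yc cd := by
  revert xc yc xd yd cd; decide

theorem phi1_anti (xc yc xd yd cd : Bool) : phi1 yc xc yd xd cd = - phi1 xc yc xd yd cd := by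
  revert xc yc xd yd cd; decide

theorem phi2_anti (xc yc xd yd cd : Bool) : phi2 yc xc yd xd cd = - phi2 xc yc xd yd cd := by
  revert xc yc xd yd cd; decide

theorem q2_swap (xc yc xd yd cd xe ye xf yf ef : Bool) :
    q2 yc xc yd xd cd ye xe yf xf ef = q2 xc yc xd yd cd xe ye xf yf ef := by
  simp only [q2, phi1_anti xc yc, phi1_anti xe ye, phi2_anti xc yc, phi2_anti xe ye, neg_mul_neg]

theorem att_swap (xv yv zv uv : Bool) : att zv yv xv uv = att xv yv zv uv := by
  cases xv <;> cases yv <;> cases zv <;> cases uv <;> rfl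

theorem isol_swap (xv yv zv : Bool) : isol zv yv xv = isol xv yv zv := by
  cases xv <;> cases yv <;> cases zv <;> rfl

theorem q1_swap (xu yu zu xv yv zv xw yw zw uv uw vw : Bool) :
    q1 zu yu xu zv yv xv zw yw xw uv uw vw = q1 xu yu zu xv yv zv xw yw zw uv uw vw := by
  have h : ff zu yu xu zv yv xv uv = ff xu yu zu xv yv zv uv := by
    simp only [ff, isol_swap xv yv zv]
    cases xu <;> cases zu <;> rfl
  simp only [q1, tt, h, att_swap, isol_swap xu yu zu]

theorem triA_swap {V : Type*} (a : V → V → Bool) (ha : ∀ i j, a i j = a j i) (x y z u v w : V) :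
    triA a x y z u v w = triA a z y x u v w := by
  have h : p3 (a z y) (a y x) (a z x) = p3 (a x y) (a y z) (a x z) := by
    rw [ha z y, ha y x, ha z x]
    simp only [p3]
    cases a x y <;> cases a y z <;> rfl
  simp only [triA, tri, h]
  congr 1
  simp only [q1_swap (a x u), q1_swap (a x v), q1_swap (a x w)]

theorem edgA_swap {V : Type*} (a : V → V → Bool) (ha : ∀ i j, a i j = a j i) (x y z u v w : V) :
    edgA a x y z u v w = edgA a y x z u v w := by
  simp only [edgA, edg, ha y x]
  congr 1
  simp only [q2_swap (a x z)]

/-- adjacency encoded by a relation on `Fin 6` -/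
def compA (a : Fin 6 → Fin 6 → Bool) : ℤ :=
    comp (a 0 1) (a 0 2) (a 0 3) (a 0 4) (a 0 5) (a 1 2) (a 1 3) (a 1 4) (a 1 5) (a 2 3) (a 2
      4) (a 2 5) (a 3 4) (a 3 5) (a 4 5)

def SS (a : Fin 6 → Fin 6 → Bool) : ℤ := ∑ σ : Equiv.Perm (Fin 6), qq a σ

theorem sum_perm_six2 (g : Fin 6 → Fin 6 → Fin 6 → Fin 6 → Fin 6 → Fin 6 → ℤ) :
    ∑ σ : Equiv.Perm (Fin 6), g (σ 0) (σ 1) (σ 2) (σ 3) (σ 4) (σ 5)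
      = ∑ p : Fin 6, ∑ q : Fin 5, ∑ e : Equiv.Perm (Fin 4), g p (p.succAbove q)
        (p.succAbove (q.succAbove (e 0))) (p.succAbove (q.succAbove (e 1)))
        (p.succAbove (q.succAbove (e 2))) (p.succAbove (q.succAbove (e 3))) := by
  have h5 (g : Fin 5 → Fin 5 → Fin 5 → Fin 5 → Fin 5 → ℤ) :
      ∑ σ : Equiv.Perm (Fin 5), g (σ 0) (σ 1) (σ 2) (σ 3) (σ 4)
      = ∑ q : Fin 5, ∑ e : Equiv.Perm (Fin 4), g q
        (q.succAbove (e 0)) (q.succAbove (e 1)) (q.succAbove (e 2)) (q.succAbove (e 3)) := by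
    rw [sum_perm_succ (fun σ => g (σ 0) (σ 1) (σ 2) (σ 3) (σ 4))]
    rfl
  have h6 : ∑ σ : Equiv.Perm (Fin 6), g (σ 0) (σ 1) (σ 2) (σ 3) (σ 4) (σ 5)
      = ∑ p : Fin 6, ∑ e : Equiv.Perm (Fin 5), g p (p.succAbove (e 0)) (p.succAbove (e 1))
        (p.succAbove (e 2)) (p.succAbove (e 3)) (p.succAbove (e 4)) := by
    rw [sum_perm_succ (fun σ => g (σ 0) (σ 1) (σ 2) (σ 3) (σ 4) (σ 5))]
    rfl
  rw [h6]
  refine Finset.sum_congr rfl fun p _ => ?_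
  exact h5 (fun i j k l m => g p (p.succAbove i) (p.succAbove j) (p.succAbove k) (p.succAbove l)
    (p.succAbove m))

theorem sum_qA (a : Fin 6 → Fin 6 → Bool) (ha : ∀ i j, a i j = a j i) (x y z : Fin 6)
    (r : Fin 3 → Fin 6) :
    ∑ e : Equiv.Perm (Fin 3), qA a x y z (r (e 0)) (r (e 1)) (r (e 2))
      = triA a x y z (r 0) (r 1) (r 2) := by
  rw [sum_perm_three (fun i j k => qA a x y z (r i) (r j) (r k))]
  simp only [triA, tri, qA]
  rw [ha (r 1) (r 0), ha (r 2) (r 0), ha (r 2) (r 1)]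
  cases p3 (a x y) (a y z) (a x z) <;> rfl

theorem sum_qB (a : Fin 6 → Fin 6 → Bool) (ha : ∀ i j, a i j = a j i) (x y : Fin 6)
    (r : Fin 4 → Fin 6) :
    ∑ e : Equiv.Perm (Fin 4), qB a x y (r (e 0)) (r (e 1)) (r (e 2)) (r (e 3))
      = 8 * edgA a x y (r 0) (r 1) (r 2) (r 3) := by
  simp only [edgA, edg, qB]
  cases a x y
  · simp
  · simp only [cond_true, q2, Finset.sum_add_distrib, ← Finset.mul_sum]
    rw [sum_perm_pair (fun i j => phi1 (a x (r i)) (a y (r i)) (a x (r j)) (a y (r j)) (a (r i) (r j))),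
      sum_perm_pair (fun i j => phi2 (a x (r i)) (a y (r i)) (a x (r j)) (a y (r j)) (a (r i) (r j)))]
    · ring
    · intro i j
      rw [ha (r i) (r j), phi2_symm]
    · intro i j
      rw [ha (r i) (r j), phi1_symm]

theorem SS_eq (a : Fin 6 → Fin 6 → Bool) (ha : ∀ i j, a i j = a j i) : SS a = 2 * compA a := by
  simp only [SS, qq, Finset.sum_sub_distrib]
  rw [sum_perm_six2 (qA a), sum_perm_six2 (qB a)]
  have h1 (p : Fin 6) (q : Fin 5) :
      ∑ e : Equiv.Perm (Fin 4), qB a p (p.succAbove q)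
        (p.succAbove (q.succAbove (e 0))) (p.succAbove (q.succAbove (e 1)))
        (p.succAbove (q.succAbove (e 2))) (p.succAbove (q.succAbove (e 3)))
      = 8 * edgA a p (p.succAbove q) (p.succAbove (q.succAbove 0)) (p.succAbove (q.succAbove 1))
        (p.succAbove (q.succAbove 2)) (p.succAbove (q.succAbove 3)) :=
    sum_qB a ha p (p.succAbove q) (fun i => p.succAbove (q.succAbove i))
  have h2 (p : Fin 6) (q : Fin 5) :
      ∑ e : Equiv.Perm (Fin 4), qA a p (p.succAbove q)
        (p.succAbove (q.succAbove (e 0))) (p.succAbove (q.succAbove (e 1)))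
        (p.succAbove (q.succAbove (e 2))) (p.succAbove (q.succAbove (e 3)))
      = ∑ s : Fin 4, triA a p (p.succAbove q) (p.succAbove (q.succAbove s))
        (p.succAbove (q.succAbove (s.succAbove 0))) (p.succAbove (q.succAbove (s.succAbove 1)))
        (p.succAbove (q.succAbove (s.succAbove 2))) := by
    rw [sum_perm_four (fun i j k l => qA a p (p.succAbove q)
        (p.succAbove (q.succAbove i)) (p.succAbove (q.succAbove j))
        (p.succAbove (q.succAbove k)) (p.succAbove (q.succAbove l)))]
    refine Finset.sum_congr rfl fun s _ => ?_
    exact sum_qA a ha p (p.succAbove q) (p.succAbove (q.succAbove s))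
      (fun i => p.succAbove (q.succAbove (s.succAbove i)))
  simp only [h1, h2, ← Finset.mul_sum]
  rw [sum_tri (triA a) (triA_swap a ha), sum_edg (edgA a) (edgA_swap a ha)]
  simp only [compA, comp, comp1, comp2, triA, edgA]
  rw [ha 1 0, ha 2 0, ha 2 1, ha 3 0, ha 3 1, ha 3 2, ha 4 0, ha 4 1, ha 4 2, ha 4 3, ha 5 0,
    ha 5 1, ha 5 2, ha 5 3, ha 5 4]
  ring

theorem SS_comp (a : Fin 6 → Fin 6 → Bool) (τ : Equiv.Perm (Fin 6)) :
    SS (fun i j => a (τ i) (τ j)) = SS a := by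
  exact Equiv.sum_comp (Equiv.mulLeft τ) (fun σ : Equiv.Perm (Fin 6) => qq a σ)

theorem SS_nonneg (a : Fin 6 → Fin 6 → Bool) (ha : ∀ i j, a i j = a j i)
    (hr : ∀ i, a i i = false) : 0 ≤ SS a := by
  let f : Fin 6 → ℕ := fun i => ∑ j, (a i j).toNat
  let τ := Tuple.sort f
  have hm : Monotone (f ∘ τ) := Tuple.monotone_sort f
  rw [← SS_comp a τ]
  set b : Fin 6 → Fin 6 → Bool := fun i j => a (τ i) (τ j) with hb
  have hbs : ∀ i j, b i j = b j i := fun i j => ha _ _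
  have hbr : ∀ i, b i i = false := fun i => hr _
  have hf (i : Fin 6) : (f ∘ τ) i = ∑ j, (b i j).toNat := by
    simp only [f, Function.comp, hb]
    exact (Equiv.sum_comp τ (fun j => (a (τ i) j).toNat)).symm
  have hd (i j : Fin 6) (hij : i ≤ j) : ∑ k, (b i k).toNat ≤ ∑ k, (b j k).toNat := by
    rw [← hf, ← hf]
    exact hm hij
  rw [SS_eq b hbs]
  have h1 := hd 0 1 (by decide)
  have h2 := hd 1 2 (by decide)
  have h3 := hd 2 3 (by decide)
  have h4 := hd 3 4 (by decide)
  have h5 := hd 4 5 (by decide)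
  simp only [Fin.sum_univ_six, hbr, hbs 1 0, hbs 2 0, hbs 2 1, hbs 3 0, hbs 3 1, hbs 3 2, hbs 4 0,
    hbs 4 1, hbs 4 2, hbs 4 3, hbs 5 0, hbs 5 1, hbs 5 2, hbs 5 3, hbs 5 4, Bool.toNat_false]
    at h1 h2 h3 h4 h5
  have := comp_nonneg (b 0 1) (b 0 2) (b 0 3) (b 0 4) (b 0 5) (b 1 2) (b 1 3) (b 1 4) (b 1 5) (b 2 3) (b 2 4) (b 2 5) (b 3 4) (b 3 5) (b 4 5)
    (by simp only [dg]; omega) (by simp only [dg]; omega) (by simp only [dg]; omega)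
    (by simp only [dg]; omega) (by simp only [dg]; omega)
  simp only [compA]
  omega
end

section
set_option linter.unusedSectionVars false

section flag
variable {V : Type*} [Fintype V]

theorem card_not_inj_le (k : ℕ) :
    ((univ : Finset (Fin (k + 1) → V)).filter (fun x => ¬ Function.Injective x)).card
      ≤ (k + 1) ^ 2 * Fintype.card V ^ k := by
  have h1 : (univ : Finset (Fin (k + 1) → V)).filter (fun x => ¬ Function.Injective x) ⊆
      (univ : Finset (Fin (k + 1) × Fin (k + 1))).biUnion
        (fun p => univ.filter (fun x => p.1 ≠ p.2 ∧ x p.1 = x p.2)) := by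
    intro x hx
    simp only [mem_filter, mem_univ, true_and, Function.Injective, not_forall] at hx
    obtain ⟨i, j, hij, hne⟩ := hx
    simp only [mem_biUnion, mem_univ, true_and, mem_filter]
    exact ⟨(i, j), hne, hij⟩
  refine (card_le_card h1).trans (card_biUnion_le.trans ?_)
  have h2 : ∀ p ∈ (univ : Finset (Fin (k + 1) × Fin (k + 1))),
      ((univ : Finset (Fin (k + 1) → V)).filter (fun x => p.1 ≠ p.2 ∧ x p.1 = x p.2)).card
        ≤ Fintype.card V ^ k := by
    intro p _
    have h3 : Fintype.card ({m : Fin (k + 1) // m ≠ p.2} → V) = Fintype.card V ^ k := by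
      rw [Fintype.card_fun]
      congr 1
      rw [Fintype.card_subtype_compl]
      simp
    rw [← h3, ← Finset.card_univ]
    refine Finset.card_le_card_of_injOn (fun x m => x m.1) (fun _ _ => by simp) ?_
    intro x hx y hy hxy
    simp only [coe_filter, mem_univ, true_and, Set.mem_ofPred_eq] at hx hy
    funext m
    by_cases hm : m = p.2
    · subst hm
      rw [← hx.2, ← hy.2]
      exact congrFun hxy ⟨p.1, hx.1⟩
    · exact congrFun hxy ⟨m, hm⟩
  refine (Finset.sum_le_sum h2).trans ?_
  simp [sq]

theorem gg_mul_le (k l : Att) : gg k * gg l ≤ 1 := by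
  cases k <;> cases l <;> simp [gg]

theorem ind_nonneg (b : Bool) : 0 ≤ ind b := by cases b <;> simp [ind]
theorem ind_le_one (b : Bool) : ind b ≤ 1 := by cases b <;> simp [ind]

theorem tt_le (xu yu zu xv yv zv xw yw zw uv uw vw : Bool) :
    tt xu yu zu xv yv zv xw yw zw uv uw vw ≤ 289 := by
  unfold tt tt0
  cases isol xu yu zu
  · simp
  · simp only [cond_true]
    have := gg_mul_le (att xv yv zv uv) (att xw yw zw uw)
    have := ind_le_one (!okp (att xv yv zv uv) (att xw yw zw uw) vw)
    linarith

theorem qA_ge (a : V → V → Bool) (x y z u v w : V) : -3000 ≤ qA a x y z u v w := by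
  unfold qA
  cases p3 (a x y) (a y z) (a x z)
  · simp
  · simp only [cond_true, q1]
    have := tt_le (a x u) (a y u) (a z u) (a x v) (a y v) (a z v) (a x w) (a y w) (a z w)
      (a u v) (a u w) (a v w)
    have := ind_le_one (p3 (a u v) (a v w) (a u w))
    have := ind_le_one (ff (a x u) (a y u) (a z u) (a x v) (a y v) (a z v) (a u v))
    linarith

theorem phi1_abs (xc yc xd yd cd : Bool) : |phi1 xc yc xd yd cd| ≤ 6 := by
  revert xc yc xd yd cd; decide

theorem phi2_abs (xc yc xd yd cd : Bool) : |phi2 xc yc xd yd cd| ≤ 15 := by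
  revert xc yc xd yd cd; decide

theorem qB_le (a : V → V → Bool) (x y z u v w : V) : qB a x y z u v w ≤ 1000 := by
  unfold qB
  cases a x y
  · simp
  · simp only [cond_true, q2]
    have h (p q c : ℤ) (hp : |p| ≤ c) (hq : |q| ≤ c) : p * q ≤ c * c := by
      refine (le_abs_self _).trans ?_
      rw [abs_mul]
      exact mul_le_mul hp hq (abs_nonneg _) ((abs_nonneg _).trans hp)
    have h1 := h _ _ _ (phi1_abs (a x z) (a y z) (a x u) (a y u) (a z u))
      (phi1_abs (a x v) (a y v) (a x w) (a y w) (a v w))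
    have h2 := h _ _ _ (phi2_abs (a x z) (a y z) (a x u) (a y u) (a z u))
      (phi2_abs (a x v) (a y v) (a x w) (a y w) (a v w))
    linarith

theorem qq_ge (a : V → V → Bool) (x : Fin 6 → V) : -4000 ≤ qq a x := by
  unfold qq
  have := qA_ge a (x 0) (x 1) (x 2) (x 3) (x 4) (x 5)
  have := qB_le a (x 0) (x 1) (x 2) (x 3) (x 4) (x 5)
  linarith

theorem sum_qq_inj (a : V → V → Bool) (ha : ∀ i j, a i j = a j i) (hr : ∀ i, a i i = false) :
    0 ≤ ∑ x ∈ (univ : Finset (Fin 6 → V)).filter (fun x => Function.Injective x), qq a x := by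
  have h1 (σ : Equiv.Perm (Fin 6)) :
      ∑ x ∈ (univ : Finset (Fin 6 → V)).filter (fun x => Function.Injective x), qq a (x ∘ σ)
      = ∑ x ∈ (univ : Finset (Fin 6 → V)).filter (fun x => Function.Injective x), qq a x := by
    refine Finset.sum_equiv (Equiv.arrowCongr σ.symm (Equiv.refl V)) ?_ ?_
    · intro x
      simp only [mem_filter, mem_univ, true_and]
      constructor
      · intro h
        exact h.comp σ.injective
      · intro h
        have := h.comp σ.symm.injective
        convert this using 1
        funext i
        simp
    · intro x _
      rfl
  have h2 : ∑ x ∈ (univ : Finset (Fin 6 → V)).filter (fun x => Function.Injective x),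
      SS (fun i j => a (x i) (x j)) = 720 *
      ∑ x ∈ (univ : Finset (Fin 6 → V)).filter (fun x => Function.Injective x), qq a x := by
    have : ∀ x : Fin 6 → V, SS (fun i j => a (x i) (x j))
        = ∑ σ : Equiv.Perm (Fin 6), qq a (x ∘ σ) := fun x => rfl
    simp only [this]
    rw [Finset.sum_comm]
    simp only [h1]
    rw [Finset.sum_const, Finset.card_univ, Fintype.card_perm]
    simp [Nat.factorial]
  have h3 : 0 ≤ ∑ x ∈ (univ : Finset (Fin 6 → V)).filter (fun x => Function.Injective x),
      SS (fun i j => a (x i) (x j)) :=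
    Finset.sum_nonneg fun x _ => SS_nonneg _ (fun i j => ha _ _) (fun i => hr _)
  omega

theorem sum_qq (a : V → V → Bool) (ha : ∀ i j, a i j = a j i) (hr : ∀ i, a i i = false) :
    -(144000 * (Fintype.card V : ℤ) ^ 5) ≤ ∑ x : Fin 6 → V, qq a x := by
  rw [← Finset.sum_filter_add_sum_filter_not univ (fun x : Fin 6 → V => Function.Injective x)]
  have h1 := sum_qq_inj a ha hr
  have h2 : ∑ x ∈ (univ : Finset (Fin 6 → V)).filter (fun x => ¬ Function.Injective x), (-4000 : ℤ)
    ≤ ∑ x ∈ (univ : Finset (Fin 6 → V)).filter (fun x => ¬ Function.Injective x), qq a x :=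
    Finset.sum_le_sum fun x _ => qq_ge a x
  rw [Finset.sum_const, nsmul_eq_mul] at h2
  have h3 := card_not_inj_le (V := V) 5
  have h4 : (((univ : Finset (Fin 6 → V)).filter (fun x => ¬ Function.Injective x)).card : ℤ)
    ≤ 36 * (Fintype.card V : ℤ) ^ 5 := by
    exact_mod_cast h3
  linarith

theorem sum_fun_succ {M : Type*} [AddCommMonoid M] (k : ℕ) (f : (Fin (k + 1) → V) → M) :
    ∑ x, f x = ∑ c : V, ∑ y : Fin k → V, f (Matrix.vecCons c y) := by
  rw [← Fintype.sum_prod_type']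
  exact (Equiv.sum_comp (Fin.consEquiv (fun _ : Fin (k + 1) => V)) f).symm

theorem sum_fun_zero {M : Type*} [AddCommMonoid M] (f : (Fin 0 → V) → M) :
    ∑ x, f x = f ![] := by
  rw [Fintype.sum_unique]
  congr 1

theorem sum_fun_five {M : Type*} [AddCommMonoid M] (f : V → V → V → V → V → M) :
    ∑ x : Fin 5 → V, f (x 0) (x 1) (x 2) (x 3) (x 4)
      = ∑ x, ∑ y, ∑ z, ∑ u, ∑ v, f x y z u v := by
  simp only [sum_fun_succ, sum_fun_zero]
  rfl

theorem sum_fun_six {M : Type*} [AddCommMonoid M] (f : V → V → V → V → V → V → M) :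
    ∑ x : Fin 6 → V, f (x 0) (x 1) (x 2) (x 3) (x 4) (x 5)
      = ∑ x, ∑ y, ∑ z, ∑ u, ∑ v, ∑ w, f x y z u v w := by
  simp only [sum_fun_succ, sum_fun_zero]
  rfl

def P3 (a : V → V → Bool) (x y z : V) : Bool := p3 (a x y) (a y z) (a x z)

def FF (a : V → V → Bool) (x y z u v : V) : Bool :=
  P3 a x y z && ff (a x u) (a y u) (a z u) (a x v) (a y v) (a z v) (a u v)

def tau (a : V → V → Bool) (x y z u : V) : Bool :=
  P3 a x y z && isol (a x u) (a y u) (a z u)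

def Atv (a : V → V → Bool) (x y z u v : V) : Att := att (a x v) (a y v) (a z v) (a u v)

def Sg (a : V → V → Bool) (x y z u : V) : ℤ := ∑ v, gg (Atv a x y z u v)

def Bd (a : V → V → Bool) (x y z u : V) : ℤ :=
  ∑ v, ∑ w, ind (!okp (Atv a x y z u v) (Atv a x y z u w) (a v w))

theorem qA_eq (a : V → V → Bool) (x y z u v w : V) : qA a x y z u v w =
    288 * ind (P3 a x y z) - 1152 * (ind (P3 a x y z) * ind (P3 a u v w))
     - 1728 * ind (FF a x y z u v)
     - ind (tau a x y z u) * (288 * (gg (Atv a x y z u v) * gg (Atv a x y z u w))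
       + ind (!okp (Atv a x y z u v) (Atv a x y z u w) (a v w))) := by
  unfold qA q1 FF tau P3 Atv tt tt0
  cases p3 (a x y) (a y z) (a x z)
  · simp [ind]
  · cases isol (a x u) (a y u) (a z u)
    · simp [ind]
    · simp [ind]

theorem qB_sum_nonneg (a : V → V → Bool) (x y : V) : 0 ≤ ∑ z, ∑ u, ∑ v, ∑ w, qB a x y z u v w := by
  unfold qB
  cases a x y
  · simp
  · simp only [cond_true, q2, Finset.sum_add_distrib, ← Finset.mul_sum, ← Finset.sum_mul]
    have := mul_self_nonneg (∑ c, ∑ d, phi1 (a x c) (a y c) (a x d) (a y d) (a c d))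
    have := mul_self_nonneg (∑ c, ∑ d, phi2 (a x c) (a y c) (a x d) (a y d) (a c d))
    linarith

theorem flag_ineq (a : V → V → Bool) (ha : ∀ i j, a i j = a j i) (hr : ∀ i, a i i = false) :
    1728 * (Fintype.card V : ℤ) * (∑ x, ∑ y, ∑ z, ∑ u, ∑ v, ind (FF a x y z u v))
    + ∑ x, ∑ y, ∑ z, ∑ u, ind (tau a x y z u) * (288 * Sg a x y z u ^ 2 + Bd a x y z u)
    ≤ 18 * (Fintype.card V : ℤ) ^ 6 + 144000 * (Fintype.card V : ℤ) ^ 5 := by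
  have h0 := sum_qq a ha hr
  unfold qq at h0
  rw [Finset.sum_sub_distrib, sum_fun_six (qA a), sum_fun_six (qB a)] at h0
  have hB : 0 ≤ ∑ x, ∑ y, ∑ z, ∑ u, ∑ v, ∑ w, qB a x y z u v w :=
    Finset.sum_nonneg fun x _ => Finset.sum_nonneg fun y _ => qB_sum_nonneg a x y
  set N : ℤ := (Fintype.card V : ℤ) with hN
  set P : ℤ := ∑ x, ∑ y, ∑ z, ind (P3 a x y z) with hP
  have hA : ∑ x, ∑ y, ∑ z, ∑ u, ∑ v, ∑ w, qA a x y z u v w =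
      288 * (N ^ 3 * P) - 1152 * (P * P)
      - 1728 * (N * (∑ x, ∑ y, ∑ z, ∑ u, ∑ v, ind (FF a x y z u v)))
      - ∑ x, ∑ y, ∑ z, ∑ u, ind (tau a x y z u) * (288 * Sg a x y z u ^ 2 + Bd a x y z u) := by
    simp only [qA_eq, Finset.sum_sub_distrib]
    congr 1
    · congr 1
      · congr 1
        · simp only [Finset.sum_const, card_univ, nsmul_eq_mul, hP, Finset.mul_sum]
          refine Finset.sum_congr rfl fun x _ => Finset.sum_congr rfl fun y _ =>
            Finset.sum_congr rfl fun z _ => ?_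
          ring
        · simp only [← Finset.mul_sum, ← Finset.sum_mul]
          rfl
      · simp only [Finset.sum_const, card_univ, nsmul_eq_mul, Finset.mul_sum]
        refine Finset.sum_congr rfl fun x _ => Finset.sum_congr rfl fun y _ =>
            Finset.sum_congr rfl fun z _ => Finset.sum_congr rfl fun u _ =>
            Finset.sum_congr rfl fun v _ => ?_
        ring
    · refine Finset.sum_congr rfl fun x _ => Finset.sum_congr rfl fun y _ =>
            Finset.sum_congr rfl fun z _ => Finset.sum_congr rfl fun u _ => ?_
      simp only [← Finset.mul_sum, Finset.sum_add_distrib, ← Finset.sum_mul]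
      rw [sq]
      rfl
  rw [hA] at h0
  nlinarith [sq_nonneg (N ^ 3 - 8 * P)]

end flag
end

section
/-- colours: (component, side) -/
abbrev Col := Fin 2 × Fin 2

def cadj (p q : Col) : Bool := decide (p.1 = q.1) && decide (p.2 ≠ q.2)

/-- adjacency of the 4-cycle plus a vertex, as a Boolean function -/
def fadj (i j : Fin 5) : Bool :=
  !(i == 4) && (!(j == 4) && (decide (i.val % 2 ≠ j.val % 2)))

section defs
variable {V : Type*} [Fintype V]

def blow (c : V → Col) : SimpleGraph V where
  Adj u v := cadj (c u) (c v) = true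
  symm := ⟨by
    intro u v
    simp only [cadj, Bool.and_eq_true, decide_eq_true_eq]
    rintro ⟨h1, h2⟩
    exact ⟨h1.symm, h2.symm⟩⟩
  loopless := ⟨by
    intro u
    simp [cadj]⟩

/-- labelled induced copies -/
noncomputable def XX (G : SimpleGraph V) : Finset (Fin 5 → V) :=
  univ.filter (fun x => Function.Injective x ∧ ∀ i j, G.Adj (x i) (x j) ↔ fadj i j = true)

/-- `u v` is a wrong pair -/
def Wr (G : SimpleGraph V) (c : V → Col) (u v : V) : Prop :=
  ¬ (G.Adj u v ↔ cadj (c u) (c v) = true)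

noncomputable def wr (G : SimpleGraph V) (c : V → Col) : ℕ :=
  (univ.filter (fun p : V × V => Wr G c p.1 p.2)).card

noncomputable def wd (G : SimpleGraph V) (c : V → Col) (u : V) : ℕ :=
  (univ.filter (fun v : V => Wr G c u v)).card

noncomputable def adjB (G : SimpleGraph V) (u v : V) : Bool := decide (G.Adj u v)

theorem adjB_symm (G : SimpleGraph V) (u v : V) : adjB G u v = adjB G v u := by
  simp only [adjB, G.adj_comm]

theorem adjB_irrefl (G : SimpleGraph V) (u : V) : adjB G u u = false := by
  simp [adjB]

theorem XX_FF (G : SimpleGraph V) (x : Fin 5 → V) (hx : x ∈ XX G) :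
    FF (adjB G) (x 0) (x 1) (x 2) (x 3) (x 4) = true := by
  simp only [XX, mem_filter, mem_univ, true_and] at hx
  have h : ∀ i j, adjB G (x i) (x j) = fadj i j := by
    intro i j
    have := hx.2 i j
    simp only [adjB]
    cases hf : fadj i j <;> simp [hf] at this ⊢ <;> exact this
  simp only [FF, P3, h]
  decide

theorem XX_tau (G : SimpleGraph V) (x : Fin 5 → V) (hx : x ∈ XX G) :
    tau (adjB G) (x 0) (x 1) (x 2) (x 4) = true := by
  simp only [XX, mem_filter, mem_univ, true_and] at hx
  have h : ∀ i j, adjB G (x i) (x j) = fadj i j := by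
    intro i j
    have := hx.2 i j
    simp only [adjB]
    cases hf : fadj i j <;> simp [hf] at this ⊢ <;> exact this
  simp only [tau, P3, h]
  decide

theorem card_le_sum_ind (s : Finset (Fin 5 → V)) (f : V → V → V → V → V → Bool)
    (h : ∀ x ∈ s, f (x 0) (x 1) (x 2) (x 3) (x 4) = true) :
    (s.card : ℤ) ≤ ∑ x, ∑ y, ∑ z, ∑ u, ∑ v, ind (f x y z u v) := by
  rw [← sum_fun_five (fun x y z u v => ind (f x y z u v))]
  have h1 : (s.card : ℤ) = ∑ x ∈ s, ind (f (x 0) (x 1) (x 2) (x 3) (x 4)) := by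
    rw [Finset.card_eq_sum_ones]
    push_cast
    refine Finset.sum_congr rfl fun x hx => ?_
    rw [h x hx]
    rfl
  rw [h1]
  exact Finset.sum_le_sum_of_subset_of_nonneg (subset_univ s) fun _ _ _ => ind_nonneg _

def attCol (k : Att) : Col := match k with
  | .c0 => (0, 0)
  | .c1 => (0, 1)
  | .c2 => (1, 0)
  | .c3 => (1, 1)
  | .junk => (0, 0)

def isc2 (k : Att) : Bool := match k with
  | .c2 => true
  | _ => false

def isc3 (k : Att) : Bool := match k with
  | .c3 => true
  | _ => false

theorem okp_cases (k l : Att) (e : Bool) (h : okp k l e = true) :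
    (e = cadj (attCol k) (attCol l)) ∨ (isc3 k = true ∧ isc3 l = true ∧ e = true) := by
  cases k <;> cases l <;> cases e <;> simp_all [okp, cadj, attCol, isc3]

theorem gg_eq (k : Att) : gg k = ind (isc3 k) - ind (isc2 k) := by
  cases k <;> rfl

theorem okp_32 (k l : Att) (e : Bool) (h3 : isc3 k = true) :
    ind (isc2 l) - ind (!okp k l e) ≤ ind (isc2 l && e) := by
  cases k <;> cases l <;> cases e <;> simp_all [okp, isc3, isc2, ind]

end defs
end

section
section rootcol
variable {V : Type*} [Fintype V]

theorem gg_att (xw yw zw vw : Bool) :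
    gg (att xw yw zw vw) = ind (isol xw yw zw) * (2 * ind vw - 1) := by
  cases xw <;> cases yw <;> cases zw <;> cases vw <;> rfl

theorem isc_att (xw yw zw vw : Bool) :
    ind (isc3 (att xw yw zw vw)) + ind (isc2 (att xw yw zw vw)) = ind (isol xw yw zw) := by
  cases xw <;> cases yw <;> cases zw <;> cases vw <;> rfl

theorem ind_and (p q : Bool) : ind (p && q) = ind p * ind q := by
  cases p <;> cases q <;> rfl

def E33 (a : V → V → Bool) (x y z u : V) : ℤ :=
  ∑ v, ind (isc3 (Atv a x y z u v)) * ∑ w, ind (isc3 (Atv a x y z u w)) * ind (a v w)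

theorem E33_le (a : V → V → Bool) (x y z u : V) :
    2 * E33 a x y z u ≤ (∑ v, ind (isol (a x v) (a y v) (a z v)) * |Sg a x y z v|)
      + (Fintype.card V : ℤ) * |Sg a x y z u| + 2 * Bd a x y z u := by
  have hSg (v : V) : Sg a x y z v
      = 2 * (∑ w, ind (isol (a x w) (a y w) (a z w)) * ind (a v w))
        - ∑ w, ind (isol (a x w) (a y w) (a z w)) := by
    simp only [Sg, Atv, gg_att]
    rw [Finset.mul_sum, ← Finset.sum_sub_distrib]
    exact Finset.sum_congr rfl fun w _ => by ring
  have hR1 : Sg a x y z u = ∑ w, ind (isc3 (Atv a x y z u w)) - ∑ w, ind (isc2 (Atv a x y z u w)) := by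
    simp only [Sg, gg_eq, Finset.sum_sub_distrib]
  have hR2 : ∑ w, ind (isol (a x w) (a y w) (a z w))
      = ∑ w, ind (isc3 (Atv a x y z u w)) + ∑ w, ind (isc2 (Atv a x y z u w)) := by
    rw [← Finset.sum_add_distrib]
    exact Finset.sum_congr rfl fun w _ => (isc_att _ _ _ _).symm
  have key (v : V) : 2 * (ind (isc3 (Atv a x y z u v)) *
        ∑ w, ind (isc3 (Atv a x y z u w)) * ind (a v w))
      ≤ ind (isol (a x v) (a y v) (a z v)) * |Sg a x y z v| + |Sg a x y z u|
        + 2 * ∑ w, ind (!okp (Atv a x y z u v) (Atv a x y z u w) (a v w)) := by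
    have hb : 0 ≤ ∑ w, ind (!okp (Atv a x y z u v) (Atv a x y z u w) (a v w)) :=
      Finset.sum_nonneg fun _ _ => ind_nonneg _
    have hi := ind_nonneg (isol (a x v) (a y v) (a z v))
    cases h3 : isc3 (Atv a x y z u v)
    · simp only [ind, cond_false, zero_mul, mul_zero]
      have := mul_nonneg hi (abs_nonneg (Sg a x y z v))
      have := abs_nonneg (Sg a x y z u)
      simp only [ind] at *
      linarith
    · have hiso : ind (isol (a x v) (a y v) (a z v)) = 1 := by
        have e := isc_att (a x v) (a y v) (a z v) (a u v)
        have e2 : ind (isc3 (att (a x v) (a y v) (a z v) (a u v))) = 1 := by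
          have : isc3 (att (a x v) (a y v) (a z v) (a u v)) = true := h3
          rw [this]; rfl
        have := ind_nonneg (isc2 (att (a x v) (a y v) (a z v) (a u v)))
        have := ind_le_one (isol (a x v) (a y v) (a z v))
        linarith
      rw [hiso]
      have e1 : ∑ w, ind (isol (a x w) (a y w) (a z w)) * ind (a v w)
          = ∑ w, ind (isc3 (Atv a x y z u w)) * ind (a v w)
            + ∑ w, ind (isc2 (Atv a x y z u w)) * ind (a v w) := by
        rw [← Finset.sum_add_distrib]
        refine Finset.sum_congr rfl fun w _ => ?_
        rw [← isc_att (a x w) (a y w) (a z w) (a u w), add_mul]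
        rfl
      have e2 : ∑ w, ind (isc2 (Atv a x y z u w))
          - ∑ w, ind (!okp (Atv a x y z u v) (Atv a x y z u w) (a v w))
          ≤ ∑ w, ind (isc2 (Atv a x y z u w)) * ind (a v w) := by
        rw [← Finset.sum_sub_distrib]
        refine Finset.sum_le_sum fun w _ => ?_
        rw [← ind_and]
        exact okp_32 _ _ _ h3
      have e3 := hSg v
      have e4 := le_abs_self (Sg a x y z v)
      have e5 := le_abs_self (Sg a x y z u)
      have e6 : ind true = 1 := rfl
      rw [e6]
      linarith
  have := Finset.sum_le_sum fun v (_ : v ∈ (univ : Finset V)) => key v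
  simp only [Finset.sum_add_distrib, ← Finset.mul_sum, Finset.sum_const, card_univ,
    nsmul_eq_mul] at this
  exact this

theorem wr_root (G : SimpleGraph V) (x y z u : V) :
    (wr G (fun v => attCol (Atv (adjB G) x y z u v)) : ℤ)
      ≤ Bd (adjB G) x y z u + E33 (adjB G) x y z u := by
  have h1 : (wr G (fun v => attCol (Atv (adjB G) x y z u v)) : ℤ)
      = ∑ v, ∑ w, (if Wr G (fun v => attCol (Atv (adjB G) x y z u v)) v w then (1 : ℤ) else 0) := by
    rw [← Fintype.sum_prod_type', wr, Finset.card_filter]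
    push_cast
    rfl
  rw [h1, Bd, E33, ← Finset.sum_add_distrib]
  refine Finset.sum_le_sum fun v _ => ?_
  rw [Finset.mul_sum, ← Finset.sum_add_distrib]
  refine Finset.sum_le_sum fun w _ => ?_
  have p1 := ind_nonneg (!okp (Atv (adjB G) x y z u v) (Atv (adjB G) x y z u w) (adjB G v w))
  have p2 : 0 ≤ ind (isc3 (Atv (adjB G) x y z u v)) *
      (ind (isc3 (Atv (adjB G) x y z u w)) * ind (adjB G v w)) :=
    mul_nonneg (ind_nonneg _) (mul_nonneg (ind_nonneg _) (ind_nonneg _))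
  split_ifs with hw
  · cases ho : okp (Atv (adjB G) x y z u v) (Atv (adjB G) x y z u w) (adjB G v w)
    · have : ind (!false) = 1 := rfl
      rw [this]
      linarith
    · rcases okp_cases _ _ _ ho with h | ⟨h2, h3, h4⟩
      · exfalso
        apply hw
        rw [← h]
        simp [adjB]
      · rw [h2, h3, h4]
        simp [ind]
  · linarith

end rootcol
end

section
section avg
variable {V : Type*} [Fintype V]

theorem Bd_nonneg (a : V → V → Bool) (x y z u : V) : 0 ≤ Bd a x y z u :=
  Finset.sum_nonneg fun _ _ => Finset.sum_nonneg fun _ _ => ind_nonneg _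

def Qt (a : V → V → Bool) (x y z : V) : ℤ :=
  ∑ u, ind (tau a x y z u) * (288 * Sg a x y z u ^ 2)

def TT (a : V → V → Bool) : ℤ := ∑ x, ∑ y, ∑ z, ∑ u, ind (tau a x y z u)

def Stot (a : V → V → Bool) : ℤ :=
  ∑ x, ∑ y, ∑ z, ∑ u, ind (tau a x y z u) * (288 * Sg a x y z u ^ 2 + Bd a x y z u)

theorem Qt_nonneg (a : V → V → Bool) (x y z : V) : 0 ≤ Qt a x y z :=
  Finset.sum_nonneg fun _ _ => mul_nonneg (ind_nonneg _) (by positivity)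

theorem pick_root (a : V → V → Bool) (hT : 0 < TT a) : ∃ x y z u, tau a x y z u = true ∧
    TT a * ((Fintype.card V : ℤ) * (288 * Sg a x y z u ^ 2 + Bd a x y z u) + Qt a x y z)
      ≤ 2 * (Fintype.card V : ℤ) * Stot a := by
  by_contra hcon
  push Not at hcon
  set N : ℤ := (Fintype.card V : ℤ) with hN
  have hN0 : 0 ≤ N := by positivity
  have h1 : ∑ x, ∑ y, ∑ z, ∑ u, ind (tau a x y z u) * (2 * N * Stot a + 1)
      ≤ ∑ x, ∑ y, ∑ z, ∑ u, ind (tau a x y z u) * (TT a *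
        (N * (288 * Sg a x y z u ^ 2 + Bd a x y z u) + Qt a x y z)) := by
    refine Finset.sum_le_sum fun x _ => Finset.sum_le_sum fun y _ => Finset.sum_le_sum fun z _ =>
      Finset.sum_le_sum fun u _ => ?_
    cases h : tau a x y z u
    · simp [ind]
    · have := hcon x y z u h
      have e : ind true = 1 := rfl
      rw [e]
      linarith
  have h2 : ∑ x, ∑ y, ∑ z, ∑ u, ind (tau a x y z u) * (2 * N * Stot a + 1)
      = TT a * (2 * N * Stot a + 1) := by
    simp only [← Finset.sum_mul]
    rfl
  have h3 : ∑ x, ∑ y, ∑ z, ∑ u, ind (tau a x y z u) * (TT a *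
        (N * (288 * Sg a x y z u ^ 2 + Bd a x y z u) + Qt a x y z))
      = TT a * (N * Stot a) + TT a * ∑ x, ∑ y, ∑ z, ∑ u, ind (tau a x y z u) * Qt a x y z := by
    simp only [Stot, Finset.mul_sum, ← Finset.sum_add_distrib]
    refine Finset.sum_congr rfl fun x _ => Finset.sum_congr rfl fun y _ =>
      Finset.sum_congr rfl fun z _ => Finset.sum_congr rfl fun u _ => ?_
    ring
  have h4 : ∑ x, ∑ y, ∑ z, ∑ u, ind (tau a x y z u) * Qt a x y z ≤ N * Stot a := by
    have h5 : ∑ x, ∑ y, ∑ z, ∑ u, ind (tau a x y z u) * Qt a x y z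
        ≤ ∑ x, ∑ y, ∑ z, ∑ u : V, Qt a x y z := by
      refine Finset.sum_le_sum fun x _ => Finset.sum_le_sum fun y _ => Finset.sum_le_sum fun z _ =>
        Finset.sum_le_sum fun u _ => ?_
      exact mul_le_of_le_one_left (Qt_nonneg _ _ _ _) (ind_le_one _)
    have h6 : ∑ x, ∑ y, ∑ z, ∑ u : V, Qt a x y z = N * ∑ x, ∑ y, ∑ z, Qt a x y z := by
      simp only [Finset.sum_const, card_univ, nsmul_eq_mul, Finset.mul_sum, hN]
    have h7 : ∑ x, ∑ y, ∑ z, Qt a x y z ≤ Stot a := by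
      refine Finset.sum_le_sum fun x _ => Finset.sum_le_sum fun y _ => Finset.sum_le_sum fun z _ =>
        Finset.sum_le_sum fun u _ => ?_
      refine mul_le_mul_of_nonneg_left ?_ (ind_nonneg _)
      have := Bd_nonneg a x y z u
      linarith
    rw [h6] at h5
    exact h5.trans (mul_le_mul_of_nonneg_left h7 hN0)
  rw [h2, h3] at h1
  have h8 := mul_le_mul_of_nonneg_left h4 hT.le
  nlinarith

theorem XX_le_TT (G : SimpleGraph V) : ((XX G).card : ℤ) ≤ (Fintype.card V : ℤ) * TT (adjB G) := by
  refine (card_le_sum_ind (XX G) (fun x y z _ v => tau (adjB G) x y z v)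
    (fun x hx => XX_tau G x hx)).trans (le_of_eq ?_)
  simp only [TT, Finset.mul_sum]
  refine Finset.sum_congr rfl fun x _ => Finset.sum_congr rfl fun y _ =>
      Finset.sum_congr rfl fun z _ => ?_
  rw [Finset.sum_const, card_univ, nsmul_eq_mul, Finset.mul_sum]

theorem XX_flag (G : SimpleGraph V) :
    1728 * (Fintype.card V : ℤ) * (XX G).card + Stot (adjB G)
    ≤ 18 * (Fintype.card V : ℤ) ^ 6 + 144000 * (Fintype.card V : ℤ) ^ 5 := by
  have h1 := flag_ineq (adjB G) (adjB_symm G) (adjB_irrefl G)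
  have h2 := card_le_sum_ind (XX G) (FF (adjB G)) (XX_FF G)
  have h3 := mul_le_mul_of_nonneg_left h2
    (show 0 ≤ 1728 * (Fintype.card V : ℤ) by positivity)
  unfold Stot
  linarith

theorem abs_le_quad (s t : ℝ) (ht : 0 < t) : |s| ≤ s ^ 2 / (2 * t) + t / 2 := by
  have : 0 ≤ (|s| - t) ^ 2 := sq_nonneg _
  rw [sub_sq, sq_abs] at this
  have h2 : |s| = (2 * |s| * t) / (2 * t) := by field_simp
  have h3 : t / 2 = t ^ 2 / (2 * t) := by field_simp
  rw [h2, h3, ← add_div]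
  gcongr
  linarith

/-- quantitative core: a good root gives a good colouring -/
theorem good_root (G : SimpleGraph V) (l : ℝ) (hl : 0 < l) (hl1 : l ≤ 1) (x y z u : V)
    (hp : P3 (adjB G) x y z = true)
    (hV : 0 < Fintype.card V)
    (h : ((Fintype.card V : ℤ) * (288 * Sg (adjB G) x y z u ^ 2 + Bd (adjB G) x y z u)
      + Qt (adjB G) x y z : ℤ) ≤ l ^ 2 * (Fintype.card V : ℝ) ^ 3) :
    ∃ c, (wr G c : ℝ) ≤ 3 * l * (Fintype.card V : ℝ) ^ 2 := by
  refine ⟨fun v => attCol (Atv (adjB G) x y z u v), ?_⟩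
  have h1 := wr_root G x y z u
  have h2 := E33_le (adjB G) x y z u
  have h3 : 0 ≤ (Bd (adjB G) x y z u : ℝ) := by exact_mod_cast Bd_nonneg (adjB G) x y z u
  have h4 : 0 ≤ (Qt (adjB G) x y z : ℝ) := by exact_mod_cast Qt_nonneg (adjB G) x y z
  set N : ℝ := (Fintype.card V : ℝ) with hN
  have hN0 : 0 < N := Nat.cast_pos.mpr hV
  set B : ℝ := (Bd (adjB G) x y z u : ℝ) with hB
  set S : ℝ := (Sg (adjB G) x y z u : ℝ) with hS
  have hQ : (Qt (adjB G) x y z : ℝ) = ∑ v, (ind (isol (adjB G x v) (adjB G y v) (adjB G z v)) : ℝ)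
      * (288 * (Sg (adjB G) x y z v : ℝ) ^ 2) := by
    simp only [Qt, tau, hp, Bool.true_and]
    push_cast
    rfl
  have h5 : (∑ v, (ind (isol (adjB G x v) (adjB G y v) (adjB G z v)) : ℝ)
      * |(Sg (adjB G) x y z v : ℝ)|) ≤ Qt (adjB G) x y z / (2 * (l * N)) + N * (l * N / 2) := by
    have : Qt (adjB G) x y z / (2 * (l * N)) + N * (l * N / 2)
        = ∑ v, ((ind (isol (adjB G x v) (adjB G y v) (adjB G z v)) : ℝ)
      * (288 * (Sg (adjB G) x y z v : ℝ) ^ 2) / (2 * (l * N)) + (l * N / 2)) := by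
      rw [Finset.sum_add_distrib, ← Finset.sum_div, hQ]
      simp [hN]
    rw [this]
    refine Finset.sum_le_sum fun v _ => ?_
    have hlN : 0 < l * N := by positivity
    cases isol (adjB G x v) (adjB G y v) (adjB G z v)
    · simp only [ind, cond_false, Int.cast_zero, zero_mul, zero_div, zero_add]
      positivity
    · simp only [ind, cond_true, Int.cast_one, one_mul]
      refine (abs_le_quad _ (l * N) hlN).trans ?_
      gcongr
      nlinarith [sq_nonneg (Sg (adjB G) x y z v : ℝ)]
  push_cast at h
  have h6 : N * B ≤ l ^ 2 * N ^ 3 := by nlinarith [sq_nonneg S, mul_nonneg hN0.le (sq_nonneg S)]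
  have h7 : N * S ^ 2 ≤ l ^ 2 * N ^ 3 := by nlinarith [sq_nonneg S, mul_nonneg hN0.le (sq_nonneg S), mul_nonneg hN0.le h3]
  have h8 : (Qt (adjB G) x y z : ℝ) ≤ l ^ 2 * N ^ 3 := by
    nlinarith [sq_nonneg S, mul_nonneg hN0.le (sq_nonneg S), mul_nonneg hN0.le h3]
  have h9 : B ≤ l ^ 2 * N ^ 2 := by
    refine le_of_mul_le_mul_left ?_ hN0
    calc N * B ≤ l ^ 2 * N ^ 3 := h6
      _ = N * (l ^ 2 * N ^ 2) := by ring
  have h10 : |S| ≤ l * N := by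
    refine abs_le_of_sq_le_sq ?_ (by positivity)
    refine le_of_mul_le_mul_left ?_ hN0
    calc N * S ^ 2 ≤ l ^ 2 * N ^ 3 := h7
      _ = N * (l * N) ^ 2 := by ring
  have h11 : (Qt (adjB G) x y z : ℝ) / (2 * (l * N)) ≤ l * N ^ 2 / 2 := by
    rw [div_le_iff₀ (by positivity)]
    calc (Qt (adjB G) x y z : ℝ) ≤ l ^ 2 * N ^ 3 := h8
      _ = _ := by ring
  have h1' : (wr G (fun v => attCol (Atv (adjB G) x y z u v)) : ℝ) ≤ B + E33 (adjB G) x y z u := by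
    have h := (Int.cast_le (R := ℝ)).mpr h1
    push_cast at h
    exact h
  have h2' : 2 * (E33 (adjB G) x y z u : ℝ) ≤
      (∑ v, (ind (isol (adjB G x v) (adjB G y v) (adjB G z v)) : ℝ)
      * |(Sg (adjB G) x y z v : ℝ)|) + N * |S| + 2 * B := by
    have : ((2 * E33 (adjB G) x y z u : ℤ) : ℝ) ≤ _ := Int.cast_le.mpr h2
    push_cast at this
    exact this
  have h12 : N * |S| ≤ l * N ^ 2 := by
    calc N * |S| ≤ N * (l * N) := by gcongr
      _ = _ := by ring
  have h13 : l ^ 2 * N ^ 2 ≤ l * N ^ 2 := by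
    have : l ^ 2 ≤ l := by nlinarith
    gcongr
  refine h1'.trans ?_
  nlinarith

theorem stab (ε : ℝ) (hε : 0 < ε) : ∃ δ > 0, ∃ n0 : ℕ, ∀ n ≥ n0, ∀ G : SimpleGraph (Fin n),
    (1 / 96 - δ) * (n : ℝ) ^ 5 ≤ (XX G).card → ∃ c, (wr G c : ℝ) ≤ ε * (n : ℝ) ^ 2 := by
  set l : ℝ := min (ε / 3) 1 with hl
  have hl0 : 0 < l := by positivity
  have hl1 : l ≤ 1 := min_le_right _ _
  have hl2 : l ≤ ε / 3 := min_le_left _ _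
  set δ : ℝ := l ^ 2 / 400000 with hδ
  have hδ0 : 0 < δ := by positivity
  refine ⟨δ, hδ0, ⌈144000 / (272 * δ)⌉₊ + 1, ?_⟩
  intro n hn G hL
  have hn1 : (144000 / (272 * δ)) ≤ (n : ℝ) := by
    refine (Nat.le_ceil _).trans ?_
    exact_mod_cast (Nat.le_succ _).trans hn
  have hn0 : 0 < n := by omega
  set N : ℝ := (n : ℝ) with hN
  have hN0 : 0 < N := Nat.cast_pos.mpr hn0
  have hn2 : 144000 ≤ 272 * δ * N := by
    rw [div_le_iff₀ (by positivity)] at hn1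
    linarith
  have hflag : 1728 * N * (XX G).card + (Stot (adjB G) : ℝ) ≤ 18 * N ^ 6 + 144000 * N ^ 5 := by
    have := XX_flag G
    rw [Fintype.card_fin] at this
    have h := (Int.cast_le (R := ℝ)).mpr this
    push_cast at h
    exact h
  have hTT : ((XX G).card : ℝ) ≤ N * TT (adjB G) := by
    have := XX_le_TT G
    rw [Fintype.card_fin] at this
    have h := (Int.cast_le (R := ℝ)).mpr this
    push_cast at h
    exact h
  have hS : (Stot (adjB G) : ℝ) ≤ 2000 * δ * N ^ 6 := by
    have e1 : 144000 * N ^ 5 ≤ 272 * δ * N * N ^ 5 := by gcongr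
    have e2 : N * ((1 / 96 - δ) * N ^ 5) ≤ N * (XX G).card := by gcongr
    nlinarith
  have hδ1 : δ ≤ 1 / 2400 := by
    rw [hδ]; nlinarith
  have hT : N ^ 4 / 100 ≤ TT (adjB G) := by
    have e1 : N ^ 5 / 100 ≤ (1 / 96 - δ) * N ^ 5 := by
      have : (1 : ℝ) / 100 ≤ 1 / 96 - δ := by linarith
      have := mul_le_mul_of_nonneg_right this (by positivity : 0 ≤ N ^ 5)
      linarith
    have e2 : N * (N ^ 4 / 100) ≤ N * TT (adjB G) := by
      calc N * (N ^ 4 / 100) = N ^ 5 / 100 := by ring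
        _ ≤ _ := by linarith
    exact le_of_mul_le_mul_left e2 hN0
  have hT0 : 0 < TT (adjB G) := by
    have : (0 : ℝ) < TT (adjB G) := lt_of_lt_of_le (by positivity) hT
    exact_mod_cast this
  obtain ⟨x, y, z, u, ht, hc⟩ := pick_root (adjB G) hT0
  rw [Fintype.card_fin] at hc
  have hp : P3 (adjB G) x y z = true := by
    simp only [tau, Bool.and_eq_true] at ht
    exact ht.1
  obtain ⟨c, hcc⟩ := good_root G l hl0 hl1 x y z u hp (by simpa using hn0) (by
    rw [Fintype.card_fin]
    set K : ℤ := ((n : ℤ) * (288 * Sg (adjB G) x y z u ^ 2 + Bd (adjB G) x y z u)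
      + Qt (adjB G) x y z : ℤ) with hK
    have hK0 : 0 ≤ K := by
      have := Bd_nonneg (adjB G) x y z u
      have := Qt_nonneg (adjB G) x y z
      positivity
    have hK0' : (0 : ℝ) ≤ K := by exact_mod_cast hK0
    have hc' : (TT (adjB G) : ℝ) * K ≤ 2 * N * Stot (adjB G) := by
      have h := (Int.cast_le (R := ℝ)).mpr hc
      push_cast at h
      exact h
    have e1 : N ^ 4 / 100 * K ≤ 2 * N * (2000 * δ * N ^ 6) := by
      calc N ^ 4 / 100 * K ≤ TT (adjB G) * K := by gcongr
        _ ≤ 2 * N * Stot (adjB G) := hc'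
        _ ≤ _ := by gcongr
    have e2 : N ^ 4 / 100 * K ≤ N ^ 4 / 100 * (l ^ 2 * N ^ 3) := by
      refine e1.trans (le_of_eq ?_)
      rw [hδ]; ring
    exact le_of_mul_le_mul_left e2 (by positivity))
  refine ⟨c, hcc.trans ?_⟩
  rw [Fintype.card_fin]
  have : 3 * l ≤ ε := by linarith
  gcongr

end avg
end

section
section counting
variable {V : Type*} [Fintype V]

theorem sum_insert {M : Type*} [AddCommMonoid M] (k : ℕ) (l : Fin (k + 1))
    (f : (Fin (k + 1) → V) → M) :
    ∑ x, f x = ∑ y : Fin k → V, ∑ b : V, f (Fin.insertNth l b y) := by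
  rw [Finset.sum_comm, ← Fintype.sum_prod_type']
  exact (Equiv.sum_comp (Fin.insertNthEquiv (fun _ : Fin (k + 1) => V) l) f).symm

theorem count_insert_le (k : ℕ) (l : Fin (k + 1)) (P : (Fin k → V) → Prop)
    (S : V → (Fin k → V) → Prop) (m : ℕ)
    (hS : ∀ y, P y → (univ.filter (fun b => S b y)).card ≤ m) :
    (univ.filter (fun x : Fin (k + 1) → V =>
      P (fun i => x (l.succAbove i)) ∧ S (x l) (fun i => x (l.succAbove i)))).card
      ≤ m * (univ.filter P).card := by
  rw [Finset.card_filter, sum_insert k l, Finset.card_filter, Finset.mul_sum]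
  refine Finset.sum_le_sum fun y _ => ?_
  simp only [Fin.insertNth_apply_same, Fin.insertNth_apply_succAbove]
  by_cases hP : P y
  · have := hS y hP
    rw [Finset.card_filter] at this
    simpa [hP] using this
  · simp [hP]

theorem count_pair (k : ℕ) (i j : Fin (k + 2)) (hij : i ≠ j) (R : V → V → Prop) :
    (univ.filter (fun x : Fin (k + 2) → V => R (x i) (x j))).card
      = Fintype.card V ^ k * (univ.filter (fun p : V × V => R p.1 p.2)).card := by
  obtain ⟨j', rfl⟩ := Fin.exists_succAbove_eq hij.symm
  rw [Finset.card_filter, sum_insert (k + 1) i]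
  simp only [Fin.insertNth_apply_same, Fin.insertNth_apply_succAbove]
  rw [sum_insert k j']
  simp only [Fin.insertNth_apply_same]
  rw [Finset.sum_const, card_univ, Fintype.card_fun, Fintype.card_fin, smul_eq_mul,
    Finset.card_filter, Fintype.sum_prod_type, Finset.sum_comm]

/-- `x l = u` and the pair `(i, j)` is in `R` -/
theorem count_fix_pair (l i j : Fin 5) (hi : i ≠ l) (hj : j ≠ l) (hij : i ≠ j) (u : V)
    (R : V → V → Prop) :
    (univ.filter (fun x : Fin 5 → V => x l = u ∧ R (x i) (x j))).card
      ≤ Fintype.card V ^ 2 * (univ.filter (fun p : V × V => R p.1 p.2)).card := by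
  obtain ⟨i', rfl⟩ := Fin.exists_succAbove_eq hi
  obtain ⟨j', rfl⟩ := Fin.exists_succAbove_eq hj
  have h := count_insert_le 4 l (fun y : Fin 4 → V => R (y i') (y j')) (fun b _ => b = u) 1
    (by
      intro y _
      refine Finset.card_le_one.mpr fun b1 hb1 b2 hb2 => ?_
      rw [(mem_filter.mp hb1).2, (mem_filter.mp hb2).2])
  rw [count_pair 2 i' j' (by rintro rfl; exact hij rfl) R, one_mul] at h
  refine le_trans (le_of_eq ?_) h
  congr 1
  ext x
  simp [and_comm]

/-- two wrong pairs, the second one using a new index `l` -/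
theorem count_two_pairs (l i j k : Fin 5) (hi : i ≠ l) (hj : j ≠ l) (hk : k ≠ l) (hij : i ≠ j)
    (R : V → V → Prop) (m : ℕ) (hm : ∀ b, (univ.filter (fun a => R b a)).card ≤ m) :
    (univ.filter (fun x : Fin 5 → V => R (x i) (x j) ∧ R (x k) (x l))).card
      ≤ m * (Fintype.card V ^ 2 * (univ.filter (fun p : V × V => R p.1 p.2)).card) := by
  obtain ⟨i', rfl⟩ := Fin.exists_succAbove_eq hi
  obtain ⟨j', rfl⟩ := Fin.exists_succAbove_eq hj
  obtain ⟨k', rfl⟩ := Fin.exists_succAbove_eq hk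
  have h := count_insert_le 4 l (fun y : Fin 4 → V => R (y i') (y j')) (fun b y => R (y k') b) m
    (by intro y _; exact hm _)
  rwa [count_pair 2 i' j' (by rintro rfl; exact hij rfl) R] at h

theorem count_two_fix (i j : Fin 5) (hij : i ≠ j) (u v : V) :
    (univ.filter (fun x : Fin 5 → V => x i = u ∧ x j = v)).card ≤ Fintype.card V ^ 3 := by
  have h := count_pair 3 i j hij (fun a b : V => a = u ∧ b = v)
  have h2 : (univ.filter (fun p : V × V => p.1 = u ∧ p.2 = v)).card ≤ 1 := by
    refine Finset.card_le_one.mpr fun b1 hb1 b2 hb2 => ?_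
    have e1 := (mem_filter.mp hb1).2
    have e2 := (mem_filter.mp hb2).2
    exact Prod.ext (e1.1.trans e2.1.symm) (e1.2.trans e2.2.symm)
  have h3 : (univ.filter (fun x : Fin 5 → V => x i = u ∧ x j = v)).card = Fintype.card V ^ 3 *
      (univ.filter (fun p : V × V => p.1 = u ∧ p.2 = v)).card := by
    convert h
  rw [h3]
  exact (Nat.mul_le_mul_left _ h2).trans (by simp)

noncomputable def part {C : Type*} (c : V → C) (q : C) : Finset V := univ.filter (fun v => c v = q)

theorem colour_count {C : Type*} [Fintype C] (k : ℕ) (c : V → C) (Q : (Fin k → C) → Prop) :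
    (univ.filter (fun x : Fin k → V => Q (fun i => c (x i)))).card
      = ∑ t ∈ univ.filter Q, ∏ i, (part c (t i)).card := by
  rw [Finset.card_eq_sum_card_fiberwise (f := fun (x : Fin k → V) i => c (x i))
    (t := univ.filter Q) (by intro x hx; simpa using hx)]
  refine Finset.sum_congr rfl fun t ht => ?_
  rw [← Fintype.card_piFinset]
  congr 1
  ext x
  simp only [mem_filter, mem_univ, true_and, Fintype.mem_piFinset, part] at ht ⊢
  constructor
  · rintro ⟨_, h⟩ i
    exact congrFun h i
  · intro h
    have : (fun i => c (x i)) = t := funext h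
    rw [this]
    exact ⟨ht, rfl⟩

theorem sum_part {C : Type*} [Fintype C] (c : V → C) : ∑ q, (part c q).card = Fintype.card V := by
  rw [← Finset.card_univ]
  exact (Finset.card_eq_sum_card_fiberwise (fun _ _ => by simp)).symm

theorem exists_parts {C : Type*} [Fintype C] (N : C → ℕ) (h : ∑ q, N q = Fintype.card V) :
    ∃ c : V → C, ∀ q, (part c q).card = N q := by
  have e : Fintype.card V = Fintype.card (Σ q, Fin (N q)) := by
    rw [Fintype.card_sigma, ← h]
    simp
  let φ := Fintype.equivOfCardEq e
  refine ⟨fun v => (φ v).1, fun q => ?_⟩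
  rw [← Fintype.card_fin (N q), ← Finset.card_univ]
  symm
  refine Finset.card_bij (fun b _ => φ.symm ⟨q, b⟩) ?_ ?_ ?_
  · intro b _
    simp [part]
  · intro b _ b' _ hb
    have := φ.symm.injective hb
    simpa using this
  · intro v hv
    simp only [part, mem_filter, mem_univ, true_and] at hv
    subst hv
    exact ⟨(φ v).2, mem_univ _, by simp⟩

end counting
end

section
def mate (p : Col) : Col := (p.1, p.2 + 1)
def oth (p : Col) (k : Fin 2) : Col := (p.1 + 1, k)
def pat (p : Col) (k : Fin 2) : Fin 5 → Col := ![p, mate p, p, mate p, oth p k]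

theorem cadj_mate : ∀ p q : Col, cadj p q = true → q = mate p := by decide
theorem mate_mate : ∀ p : Col, mate (mate p) = p := by decide
theorem cadj_oth : ∀ p q : Col, cadj p q = false → cadj (mate p) q = false →
    q = oth p q.2 := by decide
theorem pat_ok : ∀ p k, ∀ i j, cadj (pat p k i) (pat p k j) = fadj i j := by decide

theorem vp_iff (t : Fin 5 → Col) : (∀ i j, cadj (t i) (t j) = fadj i j) ↔
    ∃ p k, t = pat p k := by
  constructor
  · intro h
    refine ⟨t 0, (t 4).2, ?_⟩
    have h1 : t 1 = mate (t 0) := cadj_mate _ _ (h 0 1)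
    have h2 : t 2 = t 0 := by
      rw [cadj_mate _ _ (h 1 2), h1, mate_mate]
    have h3 : t 3 = mate (t 0) := by
      rw [cadj_mate _ _ (h 2 3), h2]
    have h4 : t 4 = oth (t 0) (t 4).2 := cadj_oth _ _ (h 0 4) (by rw [← h1]; exact h 1 4)
    funext i
    fin_cases i
    · rfl
    · exact h1
    · exact h2
    · exact h3
    · exact h4
  · rintro ⟨p, k, rfl⟩
    exact pat_ok p k

set_option linter.unusedSectionVars false

section bounds
variable {V : Type*} [Fintype V]

/-- number of labelled (not necessarily injective) copies in a blowup -/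
noncomputable def PN (N : Col → ℕ) : ℕ := ∑ p, ∑ k, N p ^ 2 * N (mate p) ^ 2 * N (oth p k)

theorem blow_count (c : V → Col) :
    (univ.filter (fun x : Fin 5 → V => ∀ i j, cadj (c (x i)) (c (x j)) = fadj i j)).card
      = PN (fun q => (part c q).card) := by
  have h := colour_count 5 c (fun t => ∀ i j, cadj (t i) (t j) = fadj i j)
  have e : (univ.filter (fun t : Fin 5 → Col => ∀ i j, cadj (t i) (t j) = fadj i j))
      = (univ : Finset (Col × Fin 2)).image (fun q => pat q.1 q.2) := by
    ext t
    simp only [mem_filter, mem_univ, true_and, mem_image, vp_iff]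
    constructor
    · rintro ⟨p, k, rfl⟩
      exact ⟨(p, k), rfl⟩
    · rintro ⟨q, rfl⟩
      exact ⟨q.1, q.2, rfl⟩
  have hinj : Function.Injective (fun q : Col × Fin 2 => pat q.1 q.2) := by
    rintro ⟨p, k⟩ ⟨p', k'⟩ hq
    have h0 : p = p' := congrFun hq 0
    have h4 : oth p k = oth p' k' := congrFun hq 4
    have h5 : k = k' := congrArg Prod.snd h4
    rw [h0, h5]
  have h' : (univ.filter (fun x : Fin 5 → V =>
      ∀ i j, cadj (c (x i)) (c (x j)) = fadj i j)).card
      = ∑ t ∈ (univ : Finset (Col × Fin 2)).image (fun q => pat q.1 q.2),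
        ∏ i, (part c (t i)).card := by
    rw [← e]
    convert h
  rw [h', Finset.sum_image (fun _ _ _ _ h => hinj h), Fintype.sum_prod_type]
  unfold PN
  refine Finset.sum_congr rfl fun p _ => Finset.sum_congr rfl fun k _ => ?_
  rw [Fin.prod_univ_five]
  simp only [pat, Matrix.cons_val]
  ring

theorem blow_adj (c : V → Col) (u v : V) : (blow c).Adj u v ↔ cadj (c u) (c v) = true := Iff.rfl

theorem XX_blow_ge (c : V → Col) :
    PN (fun q => (part c q).card) ≤ (XX (blow c)).card + 25 * Fintype.card V ^ 4 := by
  rw [← blow_count]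
  have h := card_not_inj_le (V := V) 4
  have h2 : (univ.filter (fun x : Fin 5 → V => ∀ i j, cadj (c (x i)) (c (x j)) = fadj i j)) ⊆
      XX (blow c) ∪ univ.filter (fun x => ¬ Function.Injective x) := by
    intro x hx
    simp only [mem_filter, mem_univ, true_and, mem_union, XX] at hx ⊢
    by_cases hi : Function.Injective x
    · left
      refine ⟨hi, fun i j => ?_⟩
      rw [blow_adj, hx i j]
    · right
      exact hi
  refine (card_le_card h2).trans ((card_union_le _ _).trans ?_)
  have : (4 + 1) ^ 2 = 25 := by norm_num
  rw [this] at h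
  exact Nat.add_le_add_left h _

theorem Wr_ne (G : SimpleGraph V) (c : V → Col) (u v : V) (h : Wr G c u v) : u ≠ v := by
  rintro rfl
  apply h
  simp [cadj]

theorem Wr_symm (G : SimpleGraph V) (c : V → Col) (u v : V) (h : Wr G c u v) : Wr G c v u := by
  intro h2
  apply h
  rw [G.adj_comm, h2]
  have := (blow c).adj_comm u v
  simp only [blow_adj] at this
  exact this.symm

theorem wrong_union (G : SimpleGraph V) (c : V → Col) :
    (univ.filter (fun x : Fin 5 → V => ∃ i j, Wr G c (x i) (x j))).card
      ≤ 25 * (Fintype.card V ^ 3 * wr G c) := by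
  have h1 : (univ.filter (fun x : Fin 5 → V => ∃ i j, Wr G c (x i) (x j))) ⊆
      (univ : Finset (Fin 5 × Fin 5)).biUnion
        (fun p => univ.filter (fun x => p.1 ≠ p.2 ∧ Wr G c (x p.1) (x p.2))) := by
    intro x hx
    simp only [mem_filter, mem_univ, true_and] at hx
    obtain ⟨i, j, hij⟩ := hx
    simp only [mem_biUnion, mem_univ, true_and, mem_filter]
    refine ⟨(i, j), ?_, hij⟩
    intro he
    exact Wr_ne G c _ _ hij (congrArg x he)
  refine (card_le_card h1).trans (card_biUnion_le.trans ?_)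
  have h2 : ∀ p ∈ (univ : Finset (Fin 5 × Fin 5)),
      (univ.filter (fun x : Fin 5 → V => p.1 ≠ p.2 ∧ Wr G c (x p.1) (x p.2))).card
        ≤ Fintype.card V ^ 3 * wr G c := by
    intro p _
    by_cases hp : p.1 = p.2
    · simp [hp]
    · have := count_pair 3 p.1 p.2 hp (Wr G c)
      unfold wr
      rw [← this]
      exact card_le_card (fun x hx => by
        simp only [mem_filter, mem_univ, true_and] at hx ⊢
        exact hx.2)
  refine (Finset.sum_le_sum h2).trans ?_
  simp

theorem wrong_union_fix (G : SimpleGraph V) (c : V → Col) (l : Fin 5) (u : V) :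
    (univ.filter (fun x : Fin 5 → V => x l = u ∧ ∃ i j, i ≠ l ∧ j ≠ l ∧
      Wr G c (x i) (x j))).card ≤ 25 * (Fintype.card V ^ 2 * wr G c) := by
  have h1 : (univ.filter (fun x : Fin 5 → V => x l = u ∧ ∃ i j, i ≠ l ∧ j ≠ l ∧
        Wr G c (x i) (x j))) ⊆
      (univ : Finset (Fin 5 × Fin 5)).biUnion
        (fun p => univ.filter (fun x => p.1 ≠ l ∧ p.2 ≠ l ∧ p.1 ≠ p.2 ∧ x l = u ∧
          Wr G c (x p.1) (x p.2))) := by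
    intro x hx
    simp only [mem_filter, mem_univ, true_and] at hx
    obtain ⟨hl, i, j, hi, hj, hij⟩ := hx
    simp only [mem_biUnion, mem_univ, true_and, mem_filter]
    refine ⟨(i, j), hi, hj, ?_, hl, hij⟩
    intro he
    exact Wr_ne G c _ _ hij (congrArg x he)
  refine (card_le_card h1).trans (card_biUnion_le.trans ?_)
  have h2 : ∀ p ∈ (univ : Finset (Fin 5 × Fin 5)),
      (univ.filter (fun x : Fin 5 → V => p.1 ≠ l ∧ p.2 ≠ l ∧ p.1 ≠ p.2 ∧ x l = u ∧
          Wr G c (x p.1) (x p.2))).card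
        ≤ Fintype.card V ^ 2 * wr G c := by
    intro p _
    by_cases hp : p.1 ≠ l ∧ p.2 ≠ l ∧ p.1 ≠ p.2
    · have := count_fix_pair l p.1 p.2 hp.1 hp.2.1 hp.2.2 u (Wr G c)
      refine le_trans (card_le_card (fun x hx => ?_)) this
      simp only [mem_filter, mem_univ, true_and] at hx ⊢
      exact hx.2.2.2
    · rw [Finset.card_eq_zero.mpr]
      · exact Nat.zero_le _
      · rw [Finset.filter_eq_empty_iff]
        intro x _ hx
        exact hp ⟨hx.1, hx.2.1, hx.2.2.1⟩
  refine (Finset.sum_le_sum h2).trans ?_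
  simp

theorem XX_le (G : SimpleGraph V) (c : V → Col) :
    (XX G).card ≤ PN (fun q => (part c q).card) + 25 * (Fintype.card V ^ 3 * wr G c) := by
  rw [← blow_count]
  have h2 : XX G ⊆
      (univ.filter (fun x : Fin 5 → V => ∀ i j, cadj (c (x i)) (c (x j)) = fadj i j)) ∪
      (univ.filter (fun x : Fin 5 → V => ∃ i j, Wr G c (x i) (x j))) := by
    intro x hx
    simp only [mem_filter, mem_univ, true_and, mem_union, XX] at hx ⊢
    by_contra hcon
    push Not at hcon
    obtain ⟨⟨i, j, hij⟩, h⟩ := hcon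
    apply hij
    have h1 := h i j
    simp only [Wr, not_not] at h1
    rw [hx.2 i j] at h1
    exact (Bool.eq_iff_iff.mpr h1).symm
  exact (card_le_card h2).trans ((card_union_le _ _).trans
    (Nat.add_le_add_left (wrong_union G c) _))

end bounds
end

section
theorem fadj_aut (k : Fin 5) (hk : k ≠ 4) : ∃ σ : Equiv.Perm (Fin 5), σ 0 = k ∧
    ∀ i j, fadj (σ i) (σ j) = fadj i j := by
  have h : k = 0 ∨ k = 1 ∨ k = 2 ∨ k = 3 := by
    revert k; decide
  rcases h with rfl | rfl | rfl | rfl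
  · exact ⟨1, rfl, fun _ _ => rfl⟩
  · exact ⟨Equiv.swap 0 1 * Equiv.swap 2 3, by decide, by decide⟩
  · exact ⟨Equiv.swap 0 2, by decide, by decide⟩
  · exact ⟨Equiv.swap 0 3 * Equiv.swap 1 2, by decide, by decide⟩

section degs
variable {V : Type*} [Fintype V]

noncomputable def YY (G : SimpleGraph V) (c : V → Col) (u : V) (q : Col) : Finset V :=
  univ.filter (fun v => c v = q ∧ G.Adj u v)

noncomputable def ZZ (G : SimpleGraph V) (c : V → Col) (u : V) (q : Col) : Finset V :=
  univ.filter (fun v => c v = q ∧ ¬ G.Adj u v)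

noncomputable def LU (G : SimpleGraph V) (u : V) : ℕ := ((XX G).filter (fun x => ∃ k, x k = u)).card

noncomputable def NK (G : SimpleGraph V) (k : Fin 5) (u : V) : ℕ :=
  ((XX G).filter (fun x => x k = u)).card

theorem NK_le (G : SimpleGraph V) (k : Fin 5) (hk : k ≠ 4) (u : V) : NK G k u ≤ NK G 0 u := by
  obtain ⟨σ, h0, hσ⟩ := fadj_aut k hk
  refine Finset.card_le_card_of_injOn (fun x i => x (σ i)) ?_ ?_
  · intro x hx
    simp only [XX, coe_filter, mem_filter, mem_univ, true_and, Set.mem_ofPred_eq] at hx ⊢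
    refine ⟨⟨hx.1.1.comp σ.injective, fun i j => ?_⟩, ?_⟩
    · rw [hx.1.2, hσ]
    · rw [h0, hx.2]
  · intro x _ y _ hxy
    funext i
    have := congrFun hxy (σ.symm i)
    simpa using this

theorem LU_le (G : SimpleGraph V) (u : V) : LU G u ≤ 4 * NK G 0 u + NK G 4 u := by
  have h1 : (XX G).filter (fun x => ∃ k, x k = u) ⊆
      (univ : Finset (Fin 5)).biUnion (fun k => (XX G).filter (fun x => x k = u)) := by
    intro x hx
    simp only [mem_filter, mem_biUnion, mem_univ, true_and] at hx ⊢
    obtain ⟨h, k, hk⟩ := hx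
    exact ⟨k, h, hk⟩
  have h2 := (card_le_card h1).trans card_biUnion_le
  rw [Fin.sum_univ_five] at h2
  have e1 := NK_le G 1 (by decide) u
  have e2 := NK_le G 2 (by decide) u
  have e3 := NK_le G 3 (by decide) u
  unfold LU
  unfold NK at *
  omega

theorem sum_LU (G : SimpleGraph V) : ∑ u, LU G u = 5 * (XX G).card := by
  unfold LU
  simp only [Finset.card_filter]
  rw [Finset.sum_comm]
  have : ∀ x ∈ XX G, (∑ u : V, if ∃ k, x k = u then 1 else 0) = 5 := by
    intro x hx
    rw [← Finset.card_filter]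
    have hi : Function.Injective x := (mem_filter.mp hx).2.1
    have : univ.filter (fun u => ∃ k, x k = u) = univ.image x := by
      ext u
      simp
    rw [this, Finset.card_image_of_injective _ hi]
    simp
  rw [Finset.sum_congr rfl this, Finset.sum_const, smul_eq_mul, mul_comm]

theorem not_wr (G : SimpleGraph V) (c : V → Col) (x : Fin 5 → V) (hx : x ∈ XX G) (i j : Fin 5)
    (h : ¬ Wr G c (x i) (x j)) : cadj (c (x i)) (c (x j)) = fadj i j := by
  simp only [XX, mem_filter, mem_univ, true_and] at hx
  simp only [Wr, not_not] at h
  rw [hx.2 i j] at h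
  exact (Bool.eq_iff_iff.mpr h).symm

theorem N4_le (G : SimpleGraph V) (c : V → Col) (u : V) :
    NK G 4 u ≤ ∑ p, (ZZ G c u p).card ^ 2 * (ZZ G c u (mate p)).card ^ 2
      + 25 * (Fintype.card V ^ 2 * wr G c) := by
  have h2 : (XX G).filter (fun x => x 4 = u) ⊆
      (univ : Finset Col).biUnion (fun p => Fintype.piFinset
        ![ZZ G c u p, ZZ G c u (mate p), ZZ G c u p, ZZ G c u (mate p), {u}]) ∪
      (univ.filter (fun x : Fin 5 → V => x 4 = u ∧ ∃ i j, i ≠ 4 ∧ j ≠ 4 ∧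
      Wr G c (x i) (x j))) := by
    intro x hx
    rw [mem_filter] at hx
    obtain ⟨hx, h4⟩ := hx
    rw [mem_union]
    by_cases hw : ∃ i j, i ≠ 4 ∧ j ≠ 4 ∧ Wr G c (x i) (x j)
    · right
      simp only [mem_filter, mem_univ, true_and]
      exact ⟨h4, hw⟩
    · left
      push Not at hw
      have h (i j : Fin 5) (hi : i ≠ 4) (hj : j ≠ 4) := not_wr G c x hx i j (hw i j hi hj)
      have h1 : c (x 1) = mate (c (x 0)) := cadj_mate _ _ (h 0 1 (by decide) (by decide))
      have h2 : c (x 2) = c (x 0) := by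
        rw [cadj_mate _ _ (h 1 2 (by decide) (by decide)), h1, mate_mate]
      have h3 : c (x 3) = mate (c (x 0)) := by
        rw [cadj_mate _ _ (h 2 3 (by decide) (by decide)), h2]
      have ha (i : Fin 5) : ¬ G.Adj u (x i) := by
        simp only [XX, mem_filter, mem_univ, true_and] at hx
        rw [← h4, hx.2 4 i]
        revert i; decide
      rw [mem_biUnion]
      refine ⟨c (x 0), mem_univ _, ?_⟩
      rw [Fintype.mem_piFinset]
      intro i
      fin_cases i
      · simpa [ZZ] using ha 0
      · simpa [ZZ, h1] using ha 1
      · simpa [ZZ, h2] using ha 2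
      · simpa [ZZ, h3] using ha 3
      · simpa using h4
  refine (card_le_card h2).trans ((card_union_le _ _).trans
    (Nat.add_le_add ?_ (wrong_union_fix G c 4 u)))
  refine card_biUnion_le.trans (le_of_eq ?_)
  refine Finset.sum_congr rfl fun p _ => ?_
  rw [Fintype.card_piFinset, Fin.prod_univ_five]
  simp only [Matrix.cons_val, card_singleton]
  ring

theorem N0_le (G : SimpleGraph V) (c : V → Col) (u : V) :
    NK G 0 u ≤ ∑ p, ∑ k, (YY G c u (mate p)).card ^ 2 * (ZZ G c u p).card
        * (ZZ G c u (oth p k)).card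
      + 25 * (Fintype.card V ^ 2 * wr G c) := by
  have h2 : (XX G).filter (fun x => x 0 = u) ⊆
      (univ : Finset (Col × Fin 2)).biUnion (fun q => Fintype.piFinset
        ![{u}, YY G c u (mate q.1), ZZ G c u q.1, YY G c u (mate q.1), ZZ G c u (oth q.1 q.2)]) ∪
      (univ.filter (fun x : Fin 5 → V => x 0 = u ∧ ∃ i j, i ≠ 0 ∧ j ≠ 0 ∧
      Wr G c (x i) (x j))) := by
    intro x hx
    rw [mem_filter] at hx
    obtain ⟨hx, h4⟩ := hx
    rw [mem_union]
    by_cases hw : ∃ i j, i ≠ 0 ∧ j ≠ 0 ∧ Wr G c (x i) (x j)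
    · right
      simp only [mem_filter, mem_univ, true_and]
      exact ⟨h4, hw⟩
    · left
      push Not at hw
      have h (i j : Fin 5) (hi : i ≠ 0) (hj : j ≠ 0) := not_wr G c x hx i j (hw i j hi hj)
      have h1 : c (x 1) = mate (c (x 2)) := cadj_mate _ _ (h 2 1 (by decide) (by decide))
      have h3 : c (x 3) = mate (c (x 2)) := cadj_mate _ _ (h 2 3 (by decide) (by decide))
      have h4' : c (x 4) = oth (c (x 2)) (c (x 4)).2 :=
        cadj_oth _ _ (h 2 4 (by decide) (by decide))
        (by rw [← h1]; exact h 1 4 (by decide) (by decide))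
      have ha (i : Fin 5) : G.Adj u (x i) ↔ fadj 0 i = true := by
        simp only [XX, mem_filter, mem_univ, true_and] at hx
        rw [← h4, hx.2 0 i]
      have a1 : G.Adj u (x 1) := (ha 1).mpr (by decide)
      have a3 : G.Adj u (x 3) := (ha 3).mpr (by decide)
      have a2 : ¬ G.Adj u (x 2) := fun h => absurd ((ha 2).mp h) (by decide)
      have a4 : ¬ G.Adj u (x 4) := fun h => absurd ((ha 4).mp h) (by decide)
      rw [mem_biUnion]
      refine ⟨(c (x 2), (c (x 4)).2), mem_univ _, ?_⟩
      rw [Fintype.mem_piFinset]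
      intro i
      fin_cases i
      · simpa using h4
      · exact mem_filter.mpr ⟨mem_univ _, h1, a1⟩
      · exact mem_filter.mpr ⟨mem_univ _, rfl, a2⟩
      · exact mem_filter.mpr ⟨mem_univ _, h3, a3⟩
      · exact mem_filter.mpr ⟨mem_univ _, h4', a4⟩
  refine (card_le_card h2).trans ((card_union_le _ _).trans
    (Nat.add_le_add ?_ (wrong_union_fix G c 0 u)))
  refine card_biUnion_le.trans (le_of_eq ?_)
  rw [Fintype.sum_prod_type]
  refine Finset.sum_congr rfl fun p _ => Finset.sum_congr rfl fun k _ => ?_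
  rw [Fintype.card_piFinset, Fin.prod_univ_five]
  simp only [Matrix.cons_val, card_singleton]
  ring

theorem YZ_card (G : SimpleGraph V) (c : V → Col) (u : V) (q : Col) :
    (YY G c u q).card + (ZZ G c u q).card = (part c q).card := by
  have := Finset.card_filter_add_card_filter_not (s := part c q) (fun v => G.Adj u v)
  rw [← this]
  simp only [part, YY, ZZ, Finset.filter_filter]
  congr

end degs
end

section
def PNr (v : Col → ℝ) : ℝ := ∑ p, ∑ k, v p ^ 2 * v (mate p) ^ 2 * v (oth p k)

def Fr (v y : Col → ℝ) : ℝ := ∑ p, (v p - y p) ^ 2 * (v (mate p) - y (mate p)) ^ 2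
  + 4 * ∑ p, ∑ k, y (mate p) ^ 2 * (v p - y p) * (v (oth p k) - y (oth p k))

def wrongR (v y : Col → ℝ) (i : Col) : ℝ := ∑ j, if cadj i j = true then v j - y j else y j

theorem PNr_eq (v : Col → ℝ) : PNr v = 2 * (v (0,0) ^ 2 * v (0,1) ^ 2 * (v (1,0) + v (1,1))
    + v (1,0) ^ 2 * v (1,1) ^ 2 * (v (0,0) + v (0,1))) := by
  simp only [PNr, Fintype.sum_prod_type, Fin.sum_univ_two, mate, oth]
  norm_num [Fin.ext_iff]
  simp only [show (1 : Fin 2) + 1 = 0 from rfl]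
  ring

theorem Fr_eq (v y : Col → ℝ) (z1 z2 z3 z4 : ℝ) (h1 : z1 = v (0,0) - y (0,0))
    (h2 : z2 = v (0,1) - y (0,1)) (h3 : z3 = v (1,0) - y (1,0)) (h4 : z4 = v (1,1) - y (1,1)) :
    Fr v y = 2 * (z1 ^ 2 * z2 ^ 2 + z3 ^ 2 * z4 ^ 2) +
      4 * ((y (0,1) ^ 2 * z1 + y (0,0) ^ 2 * z2) * (z3 + z4) +
       (y (1,1) ^ 2 * z3 + y (1,0) ^ 2 * z4) * (z1 + z2)) := by
  simp only [Fr, Fintype.sum_prod_type, Fin.sum_univ_two, mate, oth]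
  subst h1 h2 h3 h4
  norm_num [Fin.ext_iff]
  simp only [show (1 : Fin 2) + 1 = 0 from rfl]
  ring

theorem P_bound (a b c d : ℝ) (ha : 0 ≤ a) (hb : 0 ≤ b) (hc : 0 ≤ c) (hd : 0 ≤ d)
    (hs : a + b + c + d = 1) (h : 1 / 96 ≤ 2 * (a ^ 2 * b ^ 2 * (c + d) + c ^ 2 * d ^ 2 * (a + b))) :
    a = b ∧ c = d ∧ a + c = 1 / 2 ∧ a * c = 1 / 24 := by
  obtain ⟨s, hs1⟩ : ∃ s, s = a + b := ⟨_, rfl⟩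
  obtain ⟨t, ht1⟩ : ∃ t, t = c + d := ⟨_, rfl⟩
  have hst : s + t = 1 := by linarith
  have hs0 : 0 ≤ s := by linarith
  have ht0 : 0 ≤ t := by linarith
  rw [← hs1, ← ht1] at h
  have e1 : s ^ 4 / 16 - a ^ 2 * b ^ 2 = (a - b) ^ 2 / 4 * (s ^ 2 / 4 + a * b) := by
    subst hs1; ring
  have e2 : t ^ 4 / 16 - c ^ 2 * d ^ 2 = (c - d) ^ 2 / 4 * (t ^ 2 / 4 + c * d) := by
    subst ht1; ring
  have n1 : 0 ≤ (a - b) ^ 2 / 4 * (s ^ 2 / 4 + a * b) * t := by positivity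
  have n2 : 0 ≤ (c - d) ^ 2 / 4 * (t ^ 2 / 4 + c * d) * s := by positivity
  have e3 : s ^ 4 / 16 * t + t ^ 4 / 16 * s = 1 / 192 - 3 / 16 * (s * t - 1 / 6) ^ 2 := by
    have : t = 1 - s := by linarith
    subst this; ring
  have e4 : a ^ 2 * b ^ 2 * t + c ^ 2 * d ^ 2 * s = 1 / 192 - 3 / 16 * (s * t - 1 / 6) ^ 2
     - (a - b) ^ 2 / 4 * (s ^ 2 / 4 + a * b) * t - (c - d) ^ 2 / 4 * (t ^ 2 / 4 + c * d) * s := by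
    rw [← e3]; linear_combination (-t) * e1 + (-s) * e2
  have n3 := sq_nonneg (s * t - 1 / 6)
  have z3 : (s * t - 1 / 6) ^ 2 = 0 := by linarith
  have z3' : s * t = 1 / 6 := by have := pow_eq_zero_iff (two_ne_zero) |>.mp z3; linarith
  have z1 : (a - b) ^ 2 / 4 * (s ^ 2 / 4 + a * b) * t = 0 := by linarith
  have z2 : (c - d) ^ 2 / 4 * (t ^ 2 / 4 + c * d) * s = 0 := by linarith
  have hs2 : 0 < s := by
    rcases hs0.lt_or_eq with h | h
    · exact h
    · rw [← h] at z3'; norm_num at z3'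
  have ht2 : 0 < t := by
    rcases ht0.lt_or_eq with h | h
    · exact h
    · rw [← h] at z3'; norm_num at z3'
  have q1 : (a - b) ^ 2 = 0 := by
    have : 0 < (s ^ 2 / 4 + a * b) := by positivity
    have := mul_pos this ht2
    rw [mul_assoc] at z1
    rcases mul_eq_zero.mp z1 with h | h
    · linarith
    · linarith
  have q2 : (c - d) ^ 2 = 0 := by
    have : 0 < (t ^ 2 / 4 + c * d) := by positivity
    have := mul_pos this hs2
    rw [mul_assoc] at z2
    rcases mul_eq_zero.mp z2 with h | h
    · linarith
    · linarith
  have r1 : a = b := by have := pow_eq_zero_iff (two_ne_zero) |>.mp q1; linarith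
  have r2 : c = d := by have := pow_eq_zero_iff (two_ne_zero) |>.mp q2; linarith
  refine ⟨r1, r2, by linarith, ?_⟩
  subst r1 r2
  subst hs1 ht1
  linarith

theorem hk_bound (h k : ℝ) (h1 : h + k = 1 / 2) (h2 : h * k = 1 / 24) : 1 / 10 < h := by
  have : k = 1 / 2 - h := by linarith
  subst this
  by_contra hc
  push Not at hc
  nlinarith

/-- exact analysis of the degree polynomial in the ideal configuration -/
theorem deg_exact (h k a b c d : ℝ) (h1 : h + k = 1 / 2) (h2 : h * k = 1 / 24)
    (ha : 0 ≤ a) (ha1 : a ≤ 1) (hb : 0 ≤ b) (hb1 : b ≤ 1)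
    (hc : 0 ≤ c) (hc1 : c ≤ 1) (hd : 0 ≤ d) (hd1 : d ≤ 1)
    (hf : 5 / 96 ≤ 2 * (h ^ 4 * ((1 - a) * (1 - b)) ^ 2 + k ^ 4 * ((1 - c) * (1 - d)) ^ 2) +
      4 * (h ^ 3 * k * (b ^ 2 * (1 - a) + a ^ 2 * (1 - b)) * ((1 - c) + (1 - d))
        + k ^ 3 * h * (d ^ 2 * (1 - c) + c ^ 2 * (1 - d)) * ((1 - a) + (1 - b)))) :
    1 ≤ (1 - a) * (1 - b) * (c * (1 - d) + d * (1 - c))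
      + (a * (1 - b) + b * (1 - a)) * ((1 - c) * (1 - d)) := by
  have hh := hk_bound h k h1 h2
  have hk := hk_bound k h (by linarith) (by linarith)
  obtain ⟨w0, hw0⟩ : ∃ w, w = (1 - a) * (1 - b) := ⟨_, rfl⟩
  obtain ⟨w1, hw1⟩ : ∃ w, w = a * (1 - b) + b * (1 - a) := ⟨_, rfl⟩
  obtain ⟨w2, hw2⟩ : ∃ w, w = a * b := ⟨_, rfl⟩
  obtain ⟨v0, hv0⟩ : ∃ w, w = (1 - c) * (1 - d) := ⟨_, rfl⟩
  obtain ⟨v1, hv1⟩ : ∃ w, w = c * (1 - d) + d * (1 - c) := ⟨_, rfl⟩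
  obtain ⟨v2, hv2⟩ : ∃ w, w = c * d := ⟨_, rfl⟩
  have ha' : 0 ≤ 1 - a := by linarith
  have hb' : 0 ≤ 1 - b := by linarith
  have hc' : 0 ≤ 1 - c := by linarith
  have hd' : 0 ≤ 1 - d := by linarith
  have pw0 : 0 ≤ w0 := by rw [hw0]; positivity
  have pw1 : 0 ≤ w1 := by rw [hw1]; positivity
  have pw2 : 0 ≤ w2 := by rw [hw2]; positivity
  have pv0 : 0 ≤ v0 := by rw [hv0]; positivity
  have pv1 : 0 ≤ v1 := by rw [hv1]; positivity
  have pv2 : 0 ≤ v2 := by rw [hv2]; positivity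
  have sw : w0 + w1 + w2 = 1 := by subst hw0 hw1 hw2; ring
  have sv : v0 + v1 + v2 = 1 := by subst hv0 hv1 hv2; ring
  have b1 : w0 ^ 2 ≤ w0 := pow_le_of_le_one pw0 (by linarith) two_ne_zero
  have b2 : v0 ^ 2 ≤ v0 := pow_le_of_le_one pv0 (by linarith) two_ne_zero
  have b3 : b ^ 2 * (1 - a) + a ^ 2 * (1 - b) ≤ w1 := by
    rw [hw1]
    linarith [mul_nonneg (mul_nonneg hb hb') ha', mul_nonneg (mul_nonneg ha ha') hb']
  have b4 : d ^ 2 * (1 - c) + c ^ 2 * (1 - d) ≤ v1 := by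
    rw [hv1]
    linarith [mul_nonneg (mul_nonneg hd hd') hc', mul_nonneg (mul_nonneg hc hc') hd']
  have c1 : (1 - c) + (1 - d) = 2 * v0 + v1 := by subst hv0 hv1; ring
  have c2 : (1 - a) + (1 - b) = 2 * w0 + w1 := by subst hw0 hw1; ring
  rw [← hw0, ← hv0, c1, c2] at hf
  rw [← hw0, ← hv1, ← hw1, ← hv0]
  have hA : 0 ≤ h ^ 4 := by positivity
  have hB : 0 ≤ k ^ 4 := by positivity
  have hC : 0 ≤ h ^ 3 * k := by positivity
  have hD : 0 ≤ k ^ 3 * h := by positivity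
  have f1 : 5 / 96 ≤ 2 * (h ^ 4 * w0 + k ^ 4 * v0) + 4 * (h ^ 3 * k * w1 * (2 * v0 + v1)
      + k ^ 3 * h * v1 * (2 * w0 + w1)) := by
    refine hf.trans ?_
    gcongr
  -- values of the coefficients
  have hk' : k = 1 / 2 - h := by linarith
  have hq : h ^ 2 = h / 2 - 1 / 24 := by subst hk'; linarith
  have kA : h ^ 4 = h / 12 - 5 / 576 + h ^ 4 - (h / 12 - 5 / 576) := by ring
  have h3 : h ^ 3 = 5 / 24 * h - 1 / 48 := by
    have : h ^ 3 = h * h ^ 2 := by ring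
    rw [this, hq]; linear_combination (1/2) * hq
  have h4 : h ^ 4 = h / 12 - 5 / 576 := by
    have : h ^ 4 = h * h ^ 3 := by ring
    rw [this, h3]; linear_combination (5/24) * hq
  have kq : k ^ 2 = k / 2 - 1 / 24 := by
    have : h = 1 / 2 - k := by linarith
    subst this; linarith
  have k3 : k ^ 3 = 5 / 24 * k - 1 / 48 := by
    have : k ^ 3 = k * k ^ 2 := by ring
    rw [this, kq]; linear_combination (1/2) * kq
  have k4 : k ^ 4 = k / 12 - 5 / 576 := by
    have : k ^ 4 = k * k ^ 3 := by ring
    rw [this, k3]; linear_combination (5/24) * kq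
  have eC : h ^ 3 * k = h / 48 - 1 / 576 := by
    have : h ^ 3 * k = h ^ 2 * (h * k) := by ring
    rw [this, h2, hq]; ring
  have eD : k ^ 3 * h = k / 48 - 1 / 576 := by
    have : k ^ 3 * h = k ^ 2 * (h * k) := by ring
    rw [this, h2, kq]; ring
  rw [h4, k4, eC, eD, hk'] at f1
  rw [hk'] at hk
  have g2 : w2 = 1 - w0 - w1 := by linarith
  have g3 : v2 = 1 - v0 - v1 := by linarith
  have m00 := mul_nonneg pw0 pv0
  have m01 := mul_nonneg pw0 pv1
  have m02 := mul_nonneg pw0 pv2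
  have m10 := mul_nonneg pw1 pv0
  have m11 := mul_nonneg pw1 pv1
  have m12 := mul_nonneg pw1 pv2
  have m20 := mul_nonneg pw2 pv0
  have m21 := mul_nonneg pw2 pv1
  have m22 := mul_nonneg pw2 pv2
  have l02 := mul_le_mul_of_nonneg_right hk.le m02
  have l20 := mul_le_mul_of_nonneg_right hh.le m20
  have u02 := mul_le_mul_of_nonneg_right hh.le m02
  have u20 := mul_le_mul_of_nonneg_right hk.le m20
  have tot : w0 * v0 + w0 * v1 + w0 * v2 + w1 * v0 + w1 * v1 + w1 * v2 + w2 * v0 + w2 * v1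
    + w2 * v2 = 1 := by rw [g2, g3]; ring
  have x0 : w0 = w0 * v0 + w0 * v1 + w0 * v2 := by rw [g3]; ring
  have y0 : v0 = w0 * v0 + w1 * v0 + w2 * v0 := by rw [g2]; ring
  have xh0 : h * w0 = h * (w0 * v0) + h * (w0 * v1) + h * (w0 * v2) := by rw [g3]; ring
  have yh0 : h * v0 = h * (w0 * v0) + h * (w1 * v0) + h * (w2 * v0) := by rw [g2]; ring
  linarith
end

section
theorem canon_half (a b c d : ℝ) 
    (ha : 0 ≤ a) (ha1 : a ≤ 1) (hb : 0 ≤ b) (hb1 : b ≤ 1)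
    (hc : 0 ≤ c) (hc1 : c ≤ 1) (hd : 0 ≤ d) (hd1 : d ≤ 1)
    (h0 : (1 - a) * (1 - b) = 0) (hv : (1 - c) * (1 - d) = 1)
    (h : 1 ≤ (1 - a) * (1 - b) * (c * (1 - d) + d * (1 - c))
      + (a * (1 - b) + b * (1 - a)) * ((1 - c) * (1 - d))) :
    c = 0 ∧ d = 0 ∧ ((a = 0 ∧ b = 1) ∨ (a = 1 ∧ b = 0)) := by
  rw [h0, hv] at h
  have e : c + d - c * d = 0 := by linarith
  have hcd : c * d ≤ d := mul_le_of_le_one_left hd hc1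
  have hcd' : c * d ≤ c := mul_le_of_le_one_right hc hd1
  refine ⟨by linarith, by linarith, ?_⟩
  rcases mul_eq_zero.mp h0 with h1 | h1
  · right
    have : a = 1 := by linarith
    subst this
    exact ⟨rfl, by linarith⟩
  · left
    have : b = 1 := by linarith
    subst this
    exact ⟨by linarith, rfl⟩

theorem canon (a b c d : ℝ) 
    (ha : 0 ≤ a) (ha1 : a ≤ 1) (hb : 0 ≤ b) (hb1 : b ≤ 1)
    (hc : 0 ≤ c) (hc1 : c ≤ 1) (hd : 0 ≤ d) (hd1 : d ≤ 1)
    (h : 1 ≤ (1 - a) * (1 - b) * (c * (1 - d) + d * (1 - c))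
      + (a * (1 - b) + b * (1 - a)) * ((1 - c) * (1 - d))) :
    (c = 0 ∧ d = 0 ∧ ((a = 0 ∧ b = 1) ∨ (a = 1 ∧ b = 0))) ∨
    (a = 0 ∧ b = 0 ∧ ((c = 0 ∧ d = 1) ∨ (c = 1 ∧ d = 0))) := by
  have ha' : 0 ≤ 1 - a := by linarith
  have hb' : 0 ≤ 1 - b := by linarith
  have hc' : 0 ≤ 1 - c := by linarith
  have hd' : 0 ≤ 1 - d := by linarith
  obtain ⟨w, hw⟩ : ∃ w, w = (1 - a) * (1 - b) := ⟨_, rfl⟩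
  obtain ⟨v, hv⟩ : ∃ w, w = (1 - c) * (1 - d) := ⟨_, rfl⟩
  have w0 : 0 ≤ w := by rw [hw]; positivity
  have v0 : 0 ≤ v := by rw [hv]; positivity
  have ab := mul_nonneg ha hb
  have cd := mul_nonneg hc hd
  have e1 : a * (1 - b) + b * (1 - a) = 1 - w - a * b := by rw [hw]; ring
  have e2 : c * (1 - d) + d * (1 - c) = 1 - v - c * d := by rw [hv]; ring
  have w1 : w ≤ 1 := by
    have : 0 ≤ a * (1 - b) + b * (1 - a) := by positivity
    linarith
  have v1 : v ≤ 1 := by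
    have : 0 ≤ c * (1 - d) + d * (1 - c) := by positivity
    linarith
  have h' := h
  rw [e1, e2, ← hw, ← hv] at h'
  have k1 : 0 ≤ w * v := by positivity
  have k2 : 0 ≤ (1 - w) * (1 - v) := mul_nonneg (by linarith) (by linarith)
  have k3 := mul_nonneg w0 cd
  have k4 := mul_nonneg v0 ab
  have z1 : w * v = 0 := by linarith
  have z2 : (1 - w) * (1 - v) = 0 := by linarith
  rcases mul_eq_zero.mp z1 with h1 | h1
  · left
    rw [h1] at z2
    exact canon_half a b c d ha ha1 hb hb1 hc hc1 hd hd1 (by linarith) (by linarith) h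
  · right
    rw [h1] at z2
    exact canon_half c d a b hc hc1 hd hd1 ha ha1 hb hb1 (by linarith) (by linarith) (by linarith)

theorem col_cases (P : Col → Prop) (h1 : P (0,0)) (h2 : P (0,1)) (h3 : P (1,0)) (h4 : P (1,1)) :
    ∀ i, P i := by
  rintro ⟨i, j⟩
  fin_cases i <;> fin_cases j <;> assumption

theorem wrongR_eq (v y : Col → ℝ) :
    wrongR v y (0,0) = y (0,0) + (v (0,1) - y (0,1)) + y (1,0) + y (1,1) ∧
    wrongR v y (0,1) = (v (0,0) - y (0,0)) + y (0,1) + y (1,0) + y (1,1) ∧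
    wrongR v y (1,0) = y (0,0) + y (0,1) + y (1,0) + (v (1,1) - y (1,1)) ∧
    wrongR v y (1,1) = y (0,0) + y (0,1) + (v (1,0) - y (1,0)) + y (1,1) := by
  refine ⟨?_, ?_, ?_, ?_⟩ <;>
  · simp only [wrongR, Fintype.sum_prod_type, Fin.sum_univ_two, cadj]
    norm_num
    try ring

theorem exactD (v y : Col → ℝ) (h0 : ∀ i, 0 ≤ y i) (h1 : ∀ i, y i ≤ v i) (hs : ∑ i, v i = 1)
    (hP : 1 / 96 ≤ PNr v) (hF : 5 / 96 ≤ Fr v y) :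
    (∃ i, wrongR v y i ≤ 0) ∧ ∀ i, 1 / 10 < v i := by
  have hv : ∀ i, 0 ≤ v i := fun i => (h0 i).trans (h1 i)
  rw [PNr_eq] at hP
  simp only [Fintype.sum_prod_type, Fin.sum_univ_two] at hs
  obtain ⟨e1, e2, e3, e4⟩ := P_bound _ _ _ _ (hv _) (hv _) (hv _) (hv _) (by linarith) hP
  have l1 := hk_bound _ _ e3 e4
  have l2 := hk_bound (v (1,0)) (v (0,0)) (by linarith) (by linarith)
  refine ⟨?_, col_cases _ l1 (e1 ▸ l1) l2 (e2 ▸ l2)⟩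
  rw [Fr_eq v y _ _ _ _ rfl rfl rfl rfl] at hF
  have a1 := h1 (0,0)
  have a2 := h1 (0,1)
  have a3 := h1 (1,0)
  have a4 := h1 (1,1)
  have b1 := h0 (0,0)
  have b2 := h0 (0,1)
  have b3 := h0 (1,0)
  have b4 := h0 (1,1)
  obtain ⟨q1, q2, q3, q4⟩ := wrongR_eq v y
  rw [← e1] at a2 hF q1
  rw [← e2] at a4 hF q3
  generalize v (0,0) = h at *
  generalize v (1,0) = k at *
  have hh : h ≠ 0 := by intro hc; rw [hc] at l1; norm_num at l1
  have kk : k ≠ 0 := by intro hc; rw [hc] at l2; norm_num at l2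
  have hp : 0 < h := by linarith
  have kp : 0 < k := by linarith
  obtain ⟨a, ha⟩ : ∃ a, y (0,0) = h * a := ⟨y (0,0) / h, by field_simp⟩
  obtain ⟨b, hb⟩ : ∃ a, y (0,1) = h * a := ⟨y (0,1) / h, by field_simp⟩
  obtain ⟨c, hc⟩ : ∃ a, y (1,0) = k * a := ⟨y (1,0) / k, by field_simp⟩
  obtain ⟨d, hd⟩ : ∃ a, y (1,1) = k * a := ⟨y (1,1) / k, by field_simp⟩
  rw [ha, hb, hc, hd] at hF
  rw [ha] at a1 b1
  rw [hb] at a2 b2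
  rw [hc] at a3 b3
  rw [hd] at a4 b4
  have A0 : ∀ {h x : ℝ}, 0 < h → 0 ≤ h * x → 0 ≤ x := fun hp h => (mul_nonneg_iff_of_pos_left hp).mp h
  have A1 : ∀ {h x : ℝ}, 0 < h → h * x ≤ h → x ≤ 1 := fun {h x} hp hx => by
    rw [← mul_le_mul_iff_right₀ hp]; linarith
  have := deg_exact h k a b c d e3 e4 (A0 hp b1) (A1 hp a1) (A0 hp b2) (A1 hp a2)
    (A0 kp b3) (A1 kp a3) (A0 kp b4) (A1 kp a4) (by
      refine hF.trans (le_of_eq ?_)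
      ring)
  have := canon a b c d (A0 hp b1) (A1 hp a1) (A0 hp b2) (A1 hp a2)
    (A0 kp b3) (A1 kp a3) (A0 kp b4) (A1 kp a4) this
  rw [ha, hb, hc, hd] at q1 q2 q3 q4
  rcases this with ⟨rfl, rfl, (⟨rfl, rfl⟩ | ⟨rfl, rfl⟩)⟩ | ⟨rfl, rfl, (⟨rfl, rfl⟩ | ⟨rfl, rfl⟩)⟩
  · exact ⟨(0,0), by rw [q1]; linarith⟩
  · exact ⟨(0,1), by rw [q2]; linarith⟩
  · exact ⟨(1,0), by rw [q3]; linarith⟩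
  · exact ⟨(1,1), by rw [q4]; linarith⟩

theorem cont_PNr : Continuous PNr := by
  unfold PNr
  fun_prop

theorem lemmaD (η : ℝ) (hη : 0 < η) : ∃ δ > 0, ∀ v y : Col → ℝ, (∀ i, 0 ≤ y i) → (∀ i, y i ≤ v i) →
    ∑ i, v i = 1 → 1 / 96 - δ < PNr v → 5 / 96 - δ < Fr v y →
    (∃ i, wrongR v y i < η) ∧ ∀ i, 1 / 10 < v i := by
  obtain ⟨S, hS⟩ : ∃ S : Set ((Col → ℝ) × (Col → ℝ)), S = {p | (∀ i, 0 ≤ p.2 i) ∧ (∀ i, p.2 i ≤ p.1 i) ∧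
    ∑ i, p.1 i = 1 ∧ ((∀ i, η ≤ wrongR p.1 p.2 i) ∨ ∃ i, p.1 i ≤ 1 / 10)} := ⟨_, rfl⟩
  have cw : ∀ i, Continuous (fun p : (Col → ℝ) × (Col → ℝ) => wrongR p.1 p.2 i) := by
    intro i
    unfold wrongR
    refine continuous_finsetSum _ fun j _ => ?_
    split_ifs <;> fun_prop
  have cF : Continuous (fun p : (Col → ℝ) × (Col → ℝ) => Fr p.1 p.2) := by
    unfold Fr
    fun_prop
  have cP : Continuous (fun p : (Col → ℝ) × (Col → ℝ) => PNr p.1) := cont_PNr.comp continuous_fst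
  have hcl : IsClosed S := by
    rw [hS]
    have e : {p : (Col → ℝ) × (Col → ℝ) | (∀ i, 0 ≤ p.2 i) ∧ (∀ i, p.2 i ≤ p.1 i) ∧
      ∑ i, p.1 i = 1 ∧ ((∀ i, η ≤ wrongR p.1 p.2 i) ∨ ∃ i, p.1 i ≤ 1 / 10)} =
      (⋂ i, {p | 0 ≤ p.2 i}) ∩ ((⋂ i, {p | p.2 i ≤ p.1 i}) ∩ ({p | ∑ i, p.1 i = 1} ∩
      ((⋂ i, {p | η ≤ wrongR p.1 p.2 i}) ∪ (⋃ i, {p | p.1 i ≤ 1 / 10})))) := by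
      ext p
      simp
    rw [e]
    refine (isClosed_iInter fun i => ?_).inter ((isClosed_iInter fun i => ?_).inter
      (IsClosed.inter ?_ ((isClosed_iInter fun i => ?_).union (isClosed_iUnion_of_finite fun i => ?_))))
    · exact isClosed_le (by fun_prop) (by fun_prop)
    · exact isClosed_le (by fun_prop) (by fun_prop)
    · exact isClosed_eq (by fun_prop) (by fun_prop)
    · exact isClosed_le (by fun_prop) (cw i)
    · exact isClosed_le (by fun_prop) (by fun_prop)
  have hcp : IsCompact S := by
    refine IsCompact.of_isClosed_subset (isCompact_Icc (a := ((0, 0) : (Col → ℝ) × (Col → ℝ)))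
      (b := (1, 1))) hcl ?_
    intro p hp
    rw [hS] at hp
    obtain ⟨g0, g1, g2, -⟩ := hp
    have gv : ∀ i, p.1 i ≤ 1 := by
      intro i
      rw [← g2]
      exact Finset.single_le_sum (f := p.1) (fun j _ => (g0 j).trans (g1 j)) (mem_univ i)
    refine ⟨⟨fun i => (g0 i).trans (g1 i), fun i => g0 i⟩, ⟨fun i => gv i, fun i => (g1 i).trans (gv i)⟩⟩
  rcases S.eq_empty_or_nonempty with he | hne
  · refine ⟨1, one_pos, fun v y g0 g1 g2 _ _ => ?_⟩
    have : (v, y) ∉ S := by rw [he]; simp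
    rw [hS] at this
    simp only [Set.mem_ofPred_eq, not_and, not_or, not_forall, not_exists, not_le] at this
    exact this g0 g1 g2
  · obtain ⟨p, hp, hmin⟩ := hcp.exists_isMinOn hne
      (f := fun p => max (1 / 96 - PNr p.1) (5 / 96 - Fr p.1 p.2)) (by fun_prop)
    refine ⟨max (1 / 96 - PNr p.1) (5 / 96 - Fr p.1 p.2), ?_, fun v y g0 g1 g2 k1 k2 => ?_⟩
    · by_contra hc
      simp only [gt_iff_lt, lt_max_iff, not_or, not_lt] at hc
      rw [hS] at hp
      obtain ⟨g0, g1, g2, g3⟩ := hp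
      obtain ⟨⟨i, hi⟩, hv⟩ := exactD p.1 p.2 g0 g1 g2 (by linarith) (by linarith)
      rcases g3 with h | ⟨j, h⟩
      · exact absurd (h i) (by linarith)
      · exact absurd (hv j) (by linarith)
    · by_contra hc
      have : (v, y) ∈ S := by
        rw [hS]
        refine ⟨g0, g1, g2, ?_⟩
        by_contra h
        simp only [not_or, not_forall, not_exists, not_le] at h
        exact hc h
      have := isMinOn_iff.mp hmin _ this
      simp only at this
      have h3 : max (1 / 96 - PNr v) (5 / 96 - Fr v y) < max (1 / 96 - PNr p.1) (5 / 96 - Fr p.1 p.2) := by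
        apply max_lt <;> linarith
      linarith
end

section
open Finset Filter
open scoped Classical

theorem PN_real (N : Col → ℕ) (n : ℕ) (hn : 0 < n) :
    (PN N : ℝ) = PNr (fun q => (N q : ℝ) / n) * (n : ℝ) ^ 5 := by
  have h : (n : ℝ) ≠ 0 := by positivity
  simp only [PN, PNr, Nat.cast_sum, Nat.cast_mul, Nat.cast_pow, Finset.sum_mul]
  refine Finset.sum_congr rfl fun p _ => Finset.sum_congr rfl fun k _ => ?_
  field_simp

theorem lower_bound (δ : ℝ) (hδ : 0 < δ) : ∃ n0 : ℕ, ∀ n ≥ n0, ∃ c : Fin n → Col,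
    (1 / 96 - δ) * (n : ℝ) ^ 5 ≤ ((XX (blow c)).card : ℝ) := by
  obtain ⟨h, hh⟩ : ∃ h : ℝ, h = (3 - Real.sqrt 3) / 12 := ⟨_, rfl⟩
  obtain ⟨k, hk⟩ : ∃ k : ℝ, k = (3 + Real.sqrt 3) / 12 := ⟨_, rfl⟩
  have s3 : Real.sqrt 3 ^ 2 = 3 := Real.sq_sqrt (by norm_num)
  have s0 : 0 ≤ Real.sqrt 3 := Real.sqrt_nonneg 3
  have s2 : Real.sqrt 3 ≤ 2 := by nlinarith
  have h0 : 0 ≤ h := by rw [hh]; linarith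
  have k0 : 0 ≤ k := by rw [hk]; linarith
  have hs : h + k = 1 / 2 := by rw [hh, hk]; ring
  have hp : h * k = 1 / 24 := by rw [hh, hk]; linear_combination (-1/144) * s3
  let N : ℕ → Col → ℕ := fun n q => if q = (0,0) then ⌊h * n⌋₊ else if q = (0,1) then ⌊h * n⌋₊
    else if q = (1,0) then ⌊k * n⌋₊ else n - (2 * ⌊h * n⌋₊ + ⌊k * n⌋₊)
  have hle : ∀ n : ℕ, 2 * ⌊h * n⌋₊ + ⌊k * n⌋₊ ≤ n := by
    intro n
    have a1 := Nat.floor_le (show 0 ≤ h * n by positivity)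
    have a2 := Nat.floor_le (show 0 ≤ k * n by positivity)
    have : (2 * ⌊h * n⌋₊ + ⌊k * n⌋₊ : ℝ) ≤ n := by
      have : (h + (h + k)) * n ≤ 1 * n := by
        have : h ≤ 1 / 2 := by linarith
        gcongr
        linarith
      linarith
    have h' := (Nat.cast_le (α := ℝ)).mp (show ((2 * ⌊h * n⌋₊ + ⌊k * n⌋₊ : ℕ) : ℝ) ≤ (n : ℕ) by
      push_cast; exact this)
    exact h'
  have hsum : ∀ n, ∑ q, N n q = n := by
    intro n
    simp only [N, Fintype.sum_prod_type, Fin.sum_univ_two]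
    norm_num
    have := hle n
    omega
  have t1 : Tendsto (fun n : ℕ => (⌊h * n⌋₊ : ℝ) / n) atTop (nhds h) :=
    (tendsto_nat_floor_mul_div_atTop h0).comp tendsto_natCast_atTop_atTop
  have t2 : Tendsto (fun n : ℕ => (⌊k * n⌋₊ : ℝ) / n) atTop (nhds k) :=
    (tendsto_nat_floor_mul_div_atTop k0).comp tendsto_natCast_atTop_atTop
  have t3 : Tendsto (fun n : ℕ => ((n - (2 * ⌊h * n⌋₊ + ⌊k * n⌋₊) : ℕ) : ℝ) / n) atTop (nhds k) := by
    have : Tendsto (fun n : ℕ => 1 - (2 * ((⌊h * n⌋₊ : ℝ) / n) + (⌊k * n⌋₊ : ℝ) / n)) atTop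
      (nhds (1 - (2 * h + k))) := tendsto_const_nhds.sub ((t1.const_mul 2).add t2)
    rw [show 1 - (2 * h + k) = k by linarith] at this
    refine this.congr' ?_
    filter_upwards [eventually_gt_atTop 0] with n hn
    have hn' : (n : ℝ) ≠ 0 := by positivity
    rw [Nat.cast_sub (hle n)]
    push_cast
    field_simp
  have tN : Tendsto (fun n : ℕ => (fun q => (N n q : ℝ) / n)) atTop
      (nhds (fun q : Col => if q = (0,0) then h else if q = (0,1) then h else k)) := by
    rw [tendsto_pi_nhds]
    refine col_cases _ ?_ ?_ ?_ ?_
    · simpa [N] using t1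
    · simpa [N] using t1
    · simpa [N] using t2
    · simpa [N] using t3
  have tP := (cont_PNr.tendsto _).comp tN
  have val : PNr (fun q : Col => if q = (0,0) then h else if q = (0,1) then h else k) = 1 / 96 := by
    rw [PNr_eq]
    norm_num
    have e1 : h ^ 2 * h ^ 2 * (k + k) + k ^ 2 * k ^ 2 * (h + h) =
      2 * (h * k) * ((h + k) ^ 3 - 3 * (h * k) * (h + k)) := by ring
    rw [e1, hs, hp]
    norm_num
  rw [val] at tP
  have ev := tP.eventually (lt_mem_nhds (show (1 / 96 - δ / 2 : ℝ) < 1 / 96 by linarith))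
  obtain ⟨n1, hn1⟩ := eventually_atTop.mp ev
  obtain ⟨n2, hn2⟩ := exists_nat_ge (50 / δ)
  refine ⟨max 1 (max n1 n2), fun n hn => ?_⟩
  have p0 : 0 < n := by have := le_max_left 1 (max n1 n2); omega
  have p1 : n1 ≤ n := (le_max_left _ _).trans ((le_max_right _ _).trans hn)
  have p2 : n2 ≤ n := (le_max_right _ _).trans ((le_max_right _ _).trans hn)
  obtain ⟨c, hc⟩ := exists_parts (V := Fin n) (N n) (by rw [hsum, Fintype.card_fin])
  refine ⟨c, ?_⟩
  have g := XX_blow_ge c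
  simp only [hc] at g
  have g' : (PN (N n) : ℝ) ≤ (XX (blow c)).card + 25 * (n : ℝ) ^ 4 := by
    have := (Nat.cast_le (α := ℝ)).mpr g
    push_cast [Fintype.card_fin] at this
    exact this
  rw [PN_real _ n p0] at g'
  have q := hn1 n p1
  simp only [Function.comp] at q
  have np : (0 : ℝ) < n := Nat.cast_pos.mpr p0
  have q2 : 25 * (n : ℝ) ^ 4 ≤ δ / 2 * (n : ℝ) ^ 5 := by
    have : 50 / δ ≤ n := hn2.trans (Nat.cast_le.mpr p2)
    rw [div_le_iff₀ hδ] at this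
    have := mul_le_mul_of_nonneg_right this (show 0 ≤ (n : ℝ) ^ 4 / 2 by positivity)
    nlinarith
  have q3 := mul_le_mul_of_nonneg_right q.le (show 0 ≤ (n : ℝ) ^ 5 by positivity)
  nlinarith
end

section
section clone
variable {V : Type*} [Fintype V]

/-- distance (in ordered pairs) to the nearest blowup -/
noncomputable def dd (G : SimpleGraph V) : ℕ := ⨅ c : V → Col, wr G c

theorem dd_le (G : SimpleGraph V) (c : V → Col) : dd G ≤ wr G c := ciInf_le (OrderBot.bddBelow _) c

theorem dd_exists (G : SimpleGraph V) : ∃ c : V → Col, dd G = wr G c := by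
  have := Nat.sInf_mem (s := Set.range (fun c : V → Col => wr G c)) ⟨_, ⟨fun _ => (0, 0), rfl⟩⟩
  obtain ⟨c, hc⟩ := this
  exact ⟨c, hc.symm⟩

noncomputable def clone (G : SimpleGraph V) (u v : V) : SimpleGraph V :=
  G.comap (Function.update id u v)

theorem clone_wr (G : SimpleGraph V) (u v : V) (c : V → Col) :
    wr G c ≤ wr (clone G u v) c + 2 * Fintype.card V := by
  have h : univ.filter (fun p : V × V => Wr G c p.1 p.2) ⊆
      univ.filter (fun p : V × V => Wr (clone G u v) c p.1 p.2) ∪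
      (({u} : Finset V) ×ˢ univ ∪ univ ×ˢ ({u} : Finset V)) := by
    rintro ⟨a, b⟩ hp
    simp only [mem_filter, mem_univ, true_and, mem_union, mem_product, mem_singleton, and_true] at hp ⊢
    by_cases ha : a = u
    · right; left; exact ha
    by_cases hb : b = u
    · right; right; exact hb
    left
    unfold Wr clone at *
    simpa [Function.update_of_ne ha, Function.update_of_ne hb] using hp
  refine (card_le_card h).trans ((card_union_le _ _).trans (Nat.add_le_add_left
    ((card_union_le _ _).trans ?_) _))
  rw [card_product, card_product, card_singleton, card_univ]
  omega

theorem clone_dd (G : SimpleGraph V) (u v : V) : dd G ≤ dd (clone G u v) + 2 * Fintype.card V := by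
  obtain ⟨c, hc⟩ := dd_exists (clone G u v)
  rw [hc]
  exact (dd_le G c).trans (clone_wr G u v c)

theorem clone_XX (G : SimpleGraph V) (u v : V) (huv : u ≠ v) :
    (XX G).card + LU G v ≤ (XX (clone G u v)).card + LU G u + 25 * Fintype.card V ^ 3 := by
  have hA : ((XX G).filter (fun x => ¬ ∃ k, x k = u)).card + LU G u = (XX G).card := by
    unfold LU
    rw [add_comm]
    exact Finset.card_filter_add_card_filter_not _
  have hB : LU G v ≤ ((XX G).filter (fun x => (∃ k, x k = v) ∧ ¬ ∃ k, x k = u)).card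
      + 25 * Fintype.card V ^ 3 := by
    have h : (XX G).filter (fun x => ∃ k, x k = v) ⊆
        ((XX G).filter (fun x => (∃ k, x k = v) ∧ ¬ ∃ k, x k = u)) ∪
        (univ : Finset (Fin 5 × Fin 5)).biUnion (fun p => if p.1 = p.2 then ∅ else
          univ.filter (fun x : Fin 5 → V => x p.1 = u ∧ x p.2 = v)) := by
      intro x hx
      simp only [mem_filter, mem_union, mem_biUnion, mem_univ, true_and] at hx ⊢
      by_cases hu : ∃ k, x k = u
      · right
        obtain ⟨i, hi⟩ := hu
        obtain ⟨-, j, hj⟩ := hx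
        refine ⟨(i, j), ?_⟩
        have : i ≠ j := by
          rintro rfl
          exact huv (hi.symm.trans hj)
        simp [this, hi, hj]
      · left
        exact ⟨hx.1, hx.2, hu⟩
    refine (card_le_card h).trans ((card_union_le _ _).trans (Nat.add_le_add_left ?_ _))
    refine (card_biUnion_le_card_mul _ _ (Fintype.card V ^ 3) ?_).trans ?_
    · rintro ⟨i, j⟩ _
      split_ifs with hij
      · simp
      · exact count_two_fix i j hij u v
    · simp
  have hU : ((XX G).filter (fun x => ¬ ∃ k, x k = u)).card +
      ((XX G).filter (fun x => (∃ k, x k = v) ∧ ¬ ∃ k, x k = u)).card ≤ (XX (clone G u v)).card := by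
    have hinj : Function.Injective (fun (x : Fin 5 → V) (i : Fin 5) => Equiv.swap u v (x i)) := by
      intro x y hxy
      funext i
      have := congrFun hxy i
      exact (Equiv.swap u v).injective this
    rw [← card_image_of_injective ((XX G).filter (fun x => (∃ k, x k = v) ∧ ¬ ∃ k, x k = u)) hinj,
      ← card_union_of_disjoint]
    · apply card_le_card
      intro x hx
      rw [mem_union] at hx
      rcases hx with hx | hx
      · simp only [XX, mem_filter, mem_univ, true_and, not_exists] at hx ⊢
        refine ⟨hx.1.1, fun i j => ?_⟩
        rw [← hx.1.2 i j]
        simp [clone, Function.update_of_ne (hx.2 i), Function.update_of_ne (hx.2 j)]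
      · rw [mem_image] at hx
        obtain ⟨y, hy, rfl⟩ := hx
        simp only [XX, mem_filter, mem_univ, true_and, not_exists] at hy ⊢
        refine ⟨(Equiv.swap u v).injective.comp hy.1.1, fun i j => ?_⟩
        have key : ∀ i, Function.update id u v (Equiv.swap u v (y i)) = y i := by
          intro i
          by_cases hv : y i = v
          · rw [hv, Equiv.swap_apply_right, Function.update_self]
          · rw [Equiv.swap_apply_of_ne_of_ne (hy.2.2 i) hv, Function.update_of_ne (hy.2.2 i)]
            rfl
        rw [← hy.1.2 i j]
        simp only [clone, SimpleGraph.comap_adj, key]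
    · rw [Finset.disjoint_left]
      intro x hx hx2
      rw [mem_image] at hx2
      obtain ⟨y, hy, rfl⟩ := hx2
      obtain ⟨k, hk⟩ := (mem_filter.mp hy).2.1
      refine (mem_filter.mp hx).2 ⟨k, ?_⟩
      simp only [hk, Equiv.swap_apply_right]
  omega

theorem max_deg (G : SimpleGraph V) (κ : ℝ) (hκ : 0 ≤ κ)
    (hmax : ∀ G' : SimpleGraph V, ((XX G').card : ℝ) + κ * (Fintype.card V : ℝ) ^ 3 * (dd G' : ℝ) ≤
      ((XX G).card : ℝ) + κ * (Fintype.card V : ℝ) ^ 3 * (dd G : ℝ)) (u : V) :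
    5 * ((XX G).card : ℝ) ≤ (Fintype.card V : ℝ) * (LU G u + 25 * (Fintype.card V : ℝ) ^ 3
      + 2 * κ * (Fintype.card V : ℝ) ^ 4) := by
  have h : ∀ v, (LU G v : ℝ) ≤ LU G u + 25 * (Fintype.card V : ℝ) ^ 3
      + 2 * κ * (Fintype.card V : ℝ) ^ 4 := by
    intro v
    by_cases huv : u = v
    · subst huv
      have : 0 ≤ 25 * (Fintype.card V : ℝ) ^ 3
      + 2 * κ * (Fintype.card V : ℝ) ^ 4 := by positivity
      linarith
    · have h1 := (Nat.cast_le (α := ℝ)).mpr (clone_XX G u v huv)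
      have h2 := (Nat.cast_le (α := ℝ)).mpr (clone_dd G u v)
      push_cast at h1 h2
      have h3 := hmax (clone G u v)
      have h4 := mul_le_mul_of_nonneg_left h2
        (show 0 ≤ κ * (Fintype.card V : ℝ) ^ 3 by positivity)
      nlinarith
  have hs := (congrArg (Nat.cast (R := ℝ)) (sum_LU G))
  push_cast at hs
  rw [← hs]
  refine (Finset.sum_le_sum fun v _ => h v).trans (le_of_eq ?_)
  rw [Finset.sum_const, card_univ, nsmul_eq_mul]

end clone
end

section
theorem path3 : ∀ a b c d : Col, cadj a b = true → cadj b c = true → cadj c d = true →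
    cadj a d = true := by decide
theorem path2 : ∀ a b c : Col, cadj a b = true → cadj b c = true → cadj a c = false := by decide
theorem path2n : ∀ a b c d : Col, cadj a b = true → cadj b c = true → cadj c d = false →
    cadj a d = false := by decide
theorem cadj_comm : ∀ a b : Col, cadj a b = cadj b a := by decide
theorem fadj_comm : ∀ a b, fadj a b = fadj b a := by decide
theorem fhelp1 : ∀ i j : Fin 5, fadj i j = true → ∃ k l : Fin 5, k ≠ i ∧ k ≠ j ∧ l ≠ i ∧ l ≠ j ∧ k ≠ l ∧
    fadj i k = true ∧ fadj k l = true ∧ fadj l j = true := by decide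
theorem fhelp2 : ∀ i j : Fin 5, i ≠ j → fadj i j = false →
    (∃ k : Fin 5, k ≠ i ∧ k ≠ j ∧ fadj i k = true ∧ fadj k j = true) ∨
    (∃ k l : Fin 5, k ≠ i ∧ k ≠ j ∧ l ≠ i ∧ l ≠ j ∧ k ≠ l ∧
    fadj i k = true ∧ fadj k l = true ∧ fadj l j = false) ∨
    (∃ k l : Fin 5, k ≠ i ∧ k ≠ j ∧ l ≠ i ∧ l ≠ j ∧ k ≠ l ∧
    fadj j k = true ∧ fadj k l = true ∧ fadj l i = false) := by decide

theorem no_single (t : Fin 5 → Col) (i j : Fin 5) (hij : i ≠ j)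
    (h : ∀ k l, k ≠ l → l ≠ i → l ≠ j → cadj (t k) (t l) = fadj k l) :
    cadj (t i) (t j) = fadj i j := by
  have h' : ∀ k l, k ≠ l → l ≠ i → l ≠ j → cadj (t l) (t k) = fadj l k := by
    intro k l a b c
    rw [cadj_comm, fadj_comm]
    exact h k l a b c
  cases hf : fadj i j
  · rcases fhelp2 i j hij hf with ⟨k, a1, a2, f1, f2⟩ | ⟨k, l, a1, a2, b1, b2, kl, f1, f2, f3⟩ |
      ⟨k, l, a1, a2, b1, b2, kl, f1, f2, f3⟩
    · exact path2 _ (t k) _ ((h i k a1.symm a1 a2).trans f1) ((h' j k a2.symm a1 a2).trans f2)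
    · exact path2n _ (t k) (t l) _ ((h i k a1.symm a1 a2).trans f1) ((h k l kl b1 b2).trans f2)
        ((h' j l b2.symm b1 b2).trans f3)
    · rw [cadj_comm]
      exact path2n _ (t k) (t l) _ ((h j k a2.symm a1 a2).trans f1) ((h k l kl b1 b2).trans f2)
        ((h' i l b1.symm b1 b2).trans f3)
  · obtain ⟨k, l, a1, a2, b1, b2, kl, f1, f2, f3⟩ := fhelp1 i j hf
    exact path3 _ (t k) (t l) _ ((h i k a1.symm a1 a2).trans f1) ((h k l kl b1 b2).trans f2)
        ((h' j l b2.symm b1 b2).trans f3)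

theorem cadj_self : ∀ a : Col, cadj a a = false := by decide
theorem fadj_self : ∀ a, fadj a a = false := by decide

def bit (k : Fin 5) : Bool := ![false, false, true, true, false] k

theorem bit_ne (t : Fin 5 → Col) (ht : ∀ i j, cadj (t i) (t j) = fadj i j) (k l : Fin 5) (hkl : k ≠ l)
    (h : t k = t l) : bit k ≠ bit l := by
  have key : ∀ k l : Fin 5, k ≠ l → bit k = bit l → ∃ m, fadj k m ≠ fadj l m := by decide
  intro hb
  obtain ⟨m, hm⟩ := key k l hkl hb
  apply hm
  rw [← ht, ← ht, h]

theorem pat_exists (p q : Col) : ∃ t : Fin 5 → Col, (∀ i j, cadj (t i) (t j) = fadj i j) ∧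
    ∃ j : Fin 5, j ≠ 0 ∧ t 0 = p ∧ t j = q := by
  have key : ∀ p q : Col, ∃ k : Fin 2, ∃ j : Fin 5, j ≠ 0 ∧ pat p k 0 = p ∧ pat p k j = q := by decide
  obtain ⟨k, h⟩ := key p q
  exact ⟨pat p k, pat_ok p k, h⟩

section lemE
variable {V : Type*} [Fintype V]

theorem mism_wr (G : SimpleGraph V) (c : V → Col) (x : Fin 5 → V) (hx : x ∈ XX G) (i j : Fin 5)
    (h : cadj (c (x i)) (c (x j)) ≠ fadj i j) : Wr G c (x i) (x j) := by
  by_contra hc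
  exact h (not_wr G c x hx i j hc)

theorem lose_le (G : SimpleGraph V) (c : V → Col) (m : ℕ) (hm : ∀ u, wd G c u ≤ m) :
    (XX G \ XX (blow c)).card ≤ 625 * (m * (Fintype.card V ^ 2 * wr G c)) := by
  have h : XX G \ XX (blow c) ⊆ (univ : Finset (Fin 5 × Fin 5 × Fin 5 × Fin 5)).biUnion (fun p =>
      if p.1 ≠ p.2.2.2 ∧ p.2.1 ≠ p.2.2.2 ∧ p.2.2.1 ≠ p.2.2.2 ∧ p.1 ≠ p.2.1 then
      univ.filter (fun x : Fin 5 → V => Wr G c (x p.1) (x p.2.1) ∧ Wr G c (x p.2.2.1) (x p.2.2.2))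
      else ∅) := by
    intro x hx
    rw [mem_sdiff] at hx
    obtain ⟨hx, hn⟩ := hx
    have hx' := hx
    simp only [XX, mem_filter, mem_univ, true_and] at hx' hn
    have : ∃ i j, cadj (c (x i)) (c (x j)) ≠ fadj i j := by
      by_contra hc
      push Not at hc
      exact hn ⟨hx'.1, fun i j => by rw [blow_adj, hc i j]⟩
    obtain ⟨i, j, hij⟩ := this
    have ne : i ≠ j := by
      rintro rfl
      exact hij (by rw [cadj_self, fadj_self])
    have : ∃ k l, k ≠ l ∧ l ≠ i ∧ l ≠ j ∧ cadj (c (x k)) (c (x l)) ≠ fadj k l := by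
      by_contra hc
      push Not at hc
      exact hij (no_single (fun i => c (x i)) i j ne hc)
    obtain ⟨k, l, kl, li, lj, hkl⟩ := this
    rw [mem_biUnion]
    refine ⟨(i, j, k, l), mem_univ _, ?_⟩
    rw [if_pos ⟨li.symm, lj.symm, kl, ne⟩]
    simp only [mem_filter, mem_univ, true_and]
    exact ⟨mism_wr G c x hx i j hij, mism_wr G c x hx k l hkl⟩
  refine (card_le_card h).trans ((card_biUnion_le_card_mul _ _ (m * (Fintype.card V ^ 2 * wr G c)) ?_).trans ?_)
  · rintro ⟨i, j, k, l⟩ _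
    split_ifs with hc
    · obtain ⟨h1, h2, h3, h4⟩ := hc
      refine (card_le_card ?_).trans (count_two_pairs l i j k h1 h2 h3 h4 (Wr G c) m ?_)
      · intro x hx
        simpa using hx
      · exact hm
    · simp
  · simp [card_univ, Fintype.card_prod]

theorem gain_one (G : SimpleGraph V) (c : V → Col) (m : ℕ) (hm : ∀ q, 2 * m + 2 ≤ (part c q).card)
    (u v : V) (huv : Wr G c u v) :
    m ^ 3 ≤ ((XX (blow c) \ XX G).filter (fun x => x 0 = u ∧ ∃ j, x j = v)).card := by
  have hne := Wr_ne G c u v huv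
  obtain ⟨t, ht, j, hj0, t0, tj⟩ := pat_exists (c u) (c v)
  have hD : ∀ q, ∃ D : Bool → Finset V, (∀ b, D b ⊆ part c q \ {u, v}) ∧ (∀ b, m ≤ (D b).card) ∧
      Disjoint (D false) (D true) := by
    intro q
    have h1 : 2 * m ≤ (part c q \ {u, v}).card := by
      have := le_card_sdiff ({u, v} : Finset V) (part c q)
      have h2 : ({u, v} : Finset V).card ≤ 2 := card_le_two
      have := hm q
      omega
    obtain ⟨D0, hs, hc⟩ := exists_subset_card_eq (show m ≤ (part c q \ {u, v}).card by omega)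
    refine ⟨fun b => if b then (part c q \ {u, v}) \ D0 else D0, ?_, ?_, ?_⟩
    · intro b
      cases b
      · simpa using hs
      · simp
    · intro b
      cases b
      · simp [hc]
      · simp only [if_true]
        rw [card_sdiff_of_subset hs]
        omega
    · simpa using disjoint_sdiff
  choose D hD1 hD2 hD3 using hD
  let E : Fin 5 → Finset V := fun k => if k = 0 then {u} else if k = j then {v} else D (t k) (bit k)
  have hE : m ^ 3 ≤ (Fintype.piFinset E).card := by
    rw [Fintype.card_piFinset]
    have h1 : ∏ k : Fin 5, (if k = 0 then 1 else if k = j then 1 else m) ≤ ∏ k, (E k).card := by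
      refine Finset.prod_le_prod' fun k _ => ?_
      simp only [E]
      split_ifs
      · simp
      · simp
      · exact hD2 _ _
    refine le_trans (le_of_eq ?_) h1
    have hj : j = 1 ∨ j = 2 ∨ j = 3 ∨ j = 4 := by
      have : ∀ j : Fin 5, j ≠ 0 → j = 1 ∨ j = 2 ∨ j = 3 ∨ j = 4 := by decide
      exact this j hj0
    rw [Fin.prod_univ_five]
    rcases hj with rfl | rfl | rfl | rfl <;> norm_num [Fin.ext_iff] <;> ring
  refine hE.trans (card_le_card ?_)
  intro x hx
  rw [Fintype.mem_piFinset] at hx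
  have x0 : x 0 = u := by simpa [E] using hx 0
  have xj : x j = v := by simpa [E, hj0] using hx j
  have xk : ∀ k, k ≠ 0 → k ≠ j → x k ∈ D (t k) (bit k) := by
    intro k h1 h2
    simpa [E, h1, h2] using hx k
  have xk' : ∀ k, k ≠ 0 → k ≠ j → c (x k) = t k ∧ x k ≠ u ∧ x k ≠ v := by
    intro k h1 h2
    have := hD1 _ _ (xk k h1 h2)
    simp only [part, mem_sdiff, mem_filter, mem_univ, true_and, mem_insert, mem_singleton, not_or] at this
    exact this
  have hc : ∀ k, c (x k) = t k := by
    intro k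
    by_cases h1 : k = 0
    · rw [h1, x0, t0]
    by_cases h2 : k = j
    · rw [h2, xj, tj]
    exact (xk' k h1 h2).1
  have hinj : Function.Injective x := by
    intro k l hkl
    by_contra hne2
    have hb := bit_ne t ht k l hne2 (by rw [← hc, ← hc, hkl])
    by_cases k0 : k = 0
    · subst k0
      by_cases lj : l = j
      · subst lj
        exact hne (x0.symm.trans (hkl.trans xj))
      · exact (xk' l (Ne.symm hne2) lj).2.1 (hkl.symm.trans x0)
    by_cases kj : k = j
    · subst kj
      by_cases l0 : l = 0
      · subst l0
        exact hne (x0.symm.trans (hkl.symm.trans xj))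
      · exact (xk' l l0 (Ne.symm hne2)).2.2 (hkl.symm.trans xj)
    by_cases l0 : l = 0
    · subst l0
      exact (xk' k k0 kj).2.1 (hkl.trans x0)
    by_cases lj : l = j
    · subst lj
      exact (xk' k k0 kj).2.2 (hkl.trans xj)
    have a1 := xk k k0 kj
    have a2 := xk l l0 lj
    have e : t k = t l := by rw [← hc, ← hc, hkl]
    rw [hkl, e] at a1
    have dj := Finset.disjoint_left.mp (hD3 (t l))
    cases h1 : bit k <;> cases h2 : bit l <;> rw [h1] at a1 hb <;> rw [h2] at a2 hb
    · exact hb rfl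
    · exact dj a1 a2
    · exact dj a2 a1
    · exact hb rfl
  rw [mem_filter, mem_sdiff]
  refine ⟨⟨?_, ?_⟩, x0, j, xj⟩
  · simp only [XX, mem_filter, mem_univ, true_and]
    refine ⟨hinj, fun i j => ?_⟩
    rw [blow_adj, hc, hc, ht]
  · simp only [XX, mem_filter, mem_univ, true_and]
    rintro ⟨-, h⟩
    have := h 0 j
    rw [x0, xj] at this
    apply huv
    rw [this, ← ht, t0, tj]

theorem gain_ge (G : SimpleGraph V) (c : V → Col) (m : ℕ) (hm : ∀ q, 2 * m + 2 ≤ (part c q).card) :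
    wr G c * m ^ 3 ≤ 5 * (XX (blow c) \ XX G).card := by
  have h1 : wr G c * m ^ 3 ≤ ∑ p ∈ univ.filter (fun p : V × V => Wr G c p.1 p.2),
      ((XX (blow c) \ XX G).filter (fun x => x 0 = p.1 ∧ ∃ j, x j = p.2)).card := by
    unfold wr
    rw [← smul_eq_mul]
    refine Finset.card_nsmul_le_sum _ _ _ fun p hp => ?_
    exact gain_one G c m hm p.1 p.2 (mem_filter.mp hp).2
  refine h1.trans ?_
  have h2 : ∑ p ∈ univ.filter (fun p : V × V => Wr G c p.1 p.2),
      ((XX (blow c) \ XX G).filter (fun x => x 0 = p.1 ∧ ∃ j, x j = p.2)).card ≤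
      ∑ p : V × V, ((XX (blow c) \ XX G).filter (fun x => x 0 = p.1 ∧ ∃ j, x j = p.2)).card :=
    Finset.sum_le_sum_of_subset (subset_univ _)
  refine h2.trans ?_
  simp only [Finset.card_filter]
  rw [Finset.sum_comm, mul_comm, ← smul_eq_mul]
  refine Finset.sum_le_card_nsmul _ _ _ fun x _ => ?_
  rw [← Finset.card_filter]
  have h3 : univ.filter (fun p : V × V => x 0 = p.1 ∧ ∃ j, x j = p.2) ⊆
      (univ : Finset (Fin 5)).image (fun j => (x 0, x j)) := by
    rintro ⟨a, b⟩ hp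
    simp only [mem_filter, mem_univ, true_and] at hp
    obtain ⟨rfl, j, rfl⟩ := hp
    exact mem_image_of_mem _ (mem_univ j)
  exact (card_le_card h3).trans (card_image_le.trans (by simp))

theorem net_change (G : SimpleGraph V) (c : V → Col) (m k : ℕ) (hk : ∀ u, wd G c u ≤ k)
    (hm : ∀ q, 2 * m + 2 ≤ (part c q).card) :
    5 * (XX G).card + wr G c * m ^ 3 ≤ 5 * (XX (blow c)).card +
      3125 * (k * (Fintype.card V ^ 2 * wr G c)) := by
  have l := lose_le G c k hk
  have g := gain_ge G c m hm
  have i1 := Finset.card_sdiff_add_card_inter (XX G) (XX (blow c))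
  have i2 := Finset.card_sdiff_add_card_inter (XX (blow c)) (XX G)
  rw [Finset.inter_comm] at i2
  omega

theorem lemmaE : ∃ η > (0 : ℝ), ∃ κ > (0 : ℝ), ∃ n1 : ℕ, ∀ n ≥ n1, ∀ (G : SimpleGraph (Fin n)) (c : Fin n → Col),
    (∀ q, (n : ℝ) / 10 ≤ (part c q).card) → (∀ u, (wd G c u : ℝ) ≤ η * n) →
    ((XX G).card : ℝ) + κ * (n : ℝ) ^ 3 * wr G c ≤ (XX (blow c)).card := by
  refine ⟨1 / 3200000000, by norm_num, 1 / 5120000, by norm_num, 80, fun n hn G c hp hw => ?_⟩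
  have hn' : (80 : ℝ) ≤ n := by exact_mod_cast hn
  have g := net_change G c (n / 40) ⌊(1 / 3200000000 : ℝ) * n⌋₊ (fun u => Nat.le_floor (hw u)) (fun q => by
    have h1 := hp q
    have : (n : ℝ) ≤ ((10 * (part c q).card : ℕ) : ℝ) := by push_cast; linarith
    have := Nat.cast_le.mp this
    omega)
  have fl := Nat.floor_le (show 0 ≤ (1 / 3200000000 : ℝ) * n by positivity)
  have m1 : (n : ℝ) / 80 ≤ ((n / 40 : ℕ) : ℝ) := by
    have : n ≤ 80 * (n / 40) := by omega
    have : (n : ℝ) ≤ ((80 * (n / 40) : ℕ) : ℝ) := Nat.cast_le.mpr this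
    push_cast at this ⊢
    linarith
  have g' := (Nat.cast_le (α := ℝ)).mpr g
  simp only [Nat.cast_mul, Nat.cast_pow, Nat.cast_add, Fintype.card_fin, Nat.cast_ofNat] at g'
  have w0 : (0 : ℝ) ≤ wr G c := Nat.cast_nonneg _
  have m3 : ((n : ℝ) / 80) ^ 3 ≤ ((n / 40 : ℕ) : ℝ) ^ 3 := by gcongr
  have b1 := mul_le_mul_of_nonneg_left m3 w0
  have b2 := mul_le_mul_of_nonneg_right fl (show 0 ≤ (n : ℝ) ^ 2 * wr G c by positivity)
  nlinarith

end lemE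
end

section
section mainst
variable {V : Type*} [Fintype V]

theorem wr_split (G : SimpleGraph V) (c : V → Col) (u : V) :
    wr G c = (univ.filter (fun p : V × V => Wr G c p.1 p.2 ∧ p.1 ≠ u ∧ p.2 ≠ u)).card + 2 * wd G c u := by
  have e : univ.filter (fun p : V × V => Wr G c p.1 p.2) =
      univ.filter (fun p : V × V => Wr G c p.1 p.2 ∧ p.1 ≠ u ∧ p.2 ≠ u) ∪
      ((univ.filter (fun v => Wr G c u v)).image (fun v => (u, v)) ∪
       (univ.filter (fun v => Wr G c u v)).image (fun v => (v, u))) := by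
    ext ⟨a, b⟩
    simp only [mem_filter, mem_univ, true_and, mem_union, mem_image, Prod.mk.injEq]
    constructor
    · intro h
      by_cases ha : a = u
      · right; left
        exact ⟨b, ha ▸ h, ha.symm, rfl⟩
      by_cases hb : b = u
      · right; right
        exact ⟨a, Wr_symm _ _ _ _ (hb ▸ h), rfl, hb.symm⟩
      exact Or.inl ⟨h, ha, hb⟩
    · rintro (h | ⟨x, h, rfl, rfl⟩ | ⟨x, h, rfl, rfl⟩)
      · exact h.1
      · exact h
      · exact Wr_symm _ _ _ _ h
  unfold wr
  rw [e, card_union_of_disjoint, card_union_of_disjoint, card_image_of_injective, card_image_of_injective]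
  · unfold wd
    omega
  · intro x y h; exact (Prod.mk.inj h).1
  · intro x y h; exact (Prod.mk.inj h).2
  · rw [Finset.disjoint_left]
    intro p h1 h2
    obtain ⟨x, hx, rfl⟩ := mem_image.mp h1
    obtain ⟨y, hy, hxy⟩ := mem_image.mp h2
    have := (Prod.mk.inj hxy).1
    rw [mem_filter] at hy
    exact Wr_ne _ _ _ _ hy.2 this.symm
  · rw [Finset.disjoint_left]
    intro p h1 h2
    rw [mem_filter] at h1
    rw [mem_union] at h2
    rcases h2 with h2 | h2
    · obtain ⟨x, hx, rfl⟩ := mem_image.mp h2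
      exact h1.2.2.1 rfl
    · obtain ⟨x, hx, rfl⟩ := mem_image.mp h2
      exact h1.2.2.2 rfl

theorem wd_opt (G : SimpleGraph V) (c : V → Col) (hc : dd G = wr G c) (u : V) (i : Col) :
    wd G c u ≤ ∑ j, if cadj i j = true then (ZZ G c u j).card else (YY G c u j).card := by
  have h1 := dd_le G (Function.update c u i)
  rw [hc, wr_split G c u, wr_split G (Function.update c u i) u] at h1
  have e : univ.filter (fun p : V × V => Wr G (Function.update c u i) p.1 p.2 ∧ p.1 ≠ u ∧ p.2 ≠ u) =
      univ.filter (fun p : V × V => Wr G c p.1 p.2 ∧ p.1 ≠ u ∧ p.2 ≠ u) := by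
    refine Finset.filter_congr fun p _ => ?_
    refine and_congr_left fun hp => ?_
    simp only [Wr, Function.update_of_ne hp.1, Function.update_of_ne hp.2]
  rw [e] at h1
  have h2 : wd G c u ≤ wd G (Function.update c u i) u := by omega
  refine h2.trans ?_
  have h3 : univ.filter (fun v => Wr G (Function.update c u i) u v) ⊆
      (univ : Finset Col).biUnion (fun j => if cadj i j = true then ZZ G c u j else YY G c u j) := by
    intro v hv
    have hv := (mem_filter.mp hv).2
    have hne := Wr_ne _ _ _ _ hv
    rw [mem_biUnion]
    refine ⟨c v, mem_univ _, ?_⟩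
    simp only [Wr, Function.update_self, Function.update_of_ne hne.symm] at hv
    split_ifs with h
    · simp only [h, iff_true] at hv
      simp [ZZ, hv]
    · simp only [h] at hv
      simp only [YY, mem_filter, mem_univ, true_and]
      by_contra hcon
      exact hv ⟨fun h => absurd h hcon, fun h => by simp at h⟩
  refine (card_le_card h3).trans (card_biUnion_le.trans (le_of_eq ?_))
  refine Finset.sum_congr rfl fun j _ => ?_
  split_ifs <;> rfl

theorem dd_blow (c : V → Col) : dd (blow c) = 0 := by
  have h := dd_le (blow c) c
  have : wr (blow c) c = 0 := by
    unfold wr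
    rw [card_eq_zero, Finset.filter_eq_empty_iff]
    intro p _
    simp only [Wr, blow_adj, not_not]
  omega

theorem wr_le (G : SimpleGraph V) (c : V → Col) : wr G c ≤ Fintype.card V ^ 2 := by
  unfold wr
  refine (card_le_univ _).trans ?_
  rw [Fintype.card_prod, sq]

end mainst

theorem Fr_real {n : ℕ} (hn : 0 < n) (G : SimpleGraph (Fin n)) (c : Fin n → Col) (u : Fin n) :
    (LU G u : ℝ) ≤ Fr (fun q => ((part c q).card : ℝ) / n) (fun q => ((YY G c u q).card : ℝ) / n) * (n : ℝ) ^ 4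
      + 125 * ((n : ℝ) ^ 2 * wr G c) := by
  have hz : ∀ q, ((part c q).card : ℝ) / n - ((YY G c u q).card : ℝ) / n = ((ZZ G c u q).card : ℝ) / n := by
    intro q
    rw [← YZ_card G c u q]
    push_cast
    ring
  have np : (n : ℝ) ≠ 0 := by positivity
  have h1 := (Nat.cast_le (α := ℝ)).mpr (LU_le G u)
  have h2 := (Nat.cast_le (α := ℝ)).mpr (N4_le G c u)
  have h3 := (Nat.cast_le (α := ℝ)).mpr (N0_le G c u)
  simp only [Nat.cast_add, Nat.cast_mul, Nat.cast_pow, Nat.cast_ofNat, Nat.cast_sum, Fintype.card_fin] at h1 h2 h3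
  have e : Fr (fun q => ((part c q).card : ℝ) / n) (fun q => ((YY G c u q).card : ℝ) / n) * (n : ℝ) ^ 4 =
      ∑ p, ((ZZ G c u p).card : ℝ) ^ 2 * ((ZZ G c u (mate p)).card : ℝ) ^ 2 +
      4 * ∑ p, ∑ k, ((YY G c u (mate p)).card : ℝ) ^ 2 * ((ZZ G c u p).card : ℝ)
        * ((ZZ G c u (oth p k)).card : ℝ) := by
    unfold Fr
    simp only [hz]
    rw [add_mul, mul_assoc 4, Finset.sum_mul, Finset.sum_mul]
    congr 1
    · refine Finset.sum_congr rfl fun p _ => ?_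
      field_simp
    · congr 1
      refine Finset.sum_congr rfl fun p _ => ?_
      rw [Finset.sum_mul]
      refine Finset.sum_congr rfl fun k _ => ?_
      field_simp
  rw [e]
  linarith

theorem main_stab : ∃ κ > (0 : ℝ), ∃ n0 : ℕ, ∀ n ≥ n0, ∃ G : SimpleGraph (Fin n),
    ∀ G' : SimpleGraph (Fin n), ((XX G').card : ℝ) + κ * (n : ℝ) ^ 3 * dd G' ≤ (XX G).card := by
  obtain ⟨η, hη, κ0, hκ0, n1, hE⟩ := lemmaE
  obtain ⟨δ, hδ, hD⟩ := lemmaD η hη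
  obtain ⟨δ1, hδ1, n2, hS⟩ := stab (δ / 1000) (by positivity)
  obtain ⟨δ', hδ', d1, d2⟩ : ∃ δ' > (0 : ℝ), δ' ≤ δ / 100 ∧ δ' ≤ δ1 / 2 :=
    ⟨min (δ / 100) (δ1 / 2), by positivity, min_le_left _ _, min_le_right _ _⟩
  obtain ⟨κ, hκ, k1, k2, k3⟩ : ∃ κ > (0 : ℝ), κ ≤ δ / 100 ∧ κ ≤ δ1 / 2 ∧ κ ≤ κ0 / 2 :=
    ⟨min (δ / 100) (min (δ1 / 2) (κ0 / 2)), by positivity, min_le_left _ _,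
      (min_le_right _ _).trans (min_le_left _ _), (min_le_right _ _).trans (min_le_right _ _)⟩
  obtain ⟨n3, hL⟩ := lower_bound δ' hδ'
  obtain ⟨n4, h4⟩ := exists_nat_ge (2500 / δ)
  refine ⟨κ, hκ, n1 + n2 + n3 + n4 + 1, fun n hn => ?_⟩
  obtain ⟨G, hG⟩ := Finite.exists_max (fun G : SimpleGraph (Fin n) =>
    ((XX G).card : ℝ) + κ * (n : ℝ) ^ 3 * dd G)
  obtain ⟨c, hc⟩ := dd_exists G
  have n0 : 0 < n := by omega
  have np : (0 : ℝ) < n := Nat.cast_pos.mpr n0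
  have n5 : (0 : ℝ) < (n : ℝ) ^ 5 := by positivity
  have n44 : (0 : ℝ) < (n : ℝ) ^ 4 := by positivity
  have n3p : (0 : ℝ) < (n : ℝ) ^ 3 := by positivity
  obtain ⟨c0, hc0⟩ := hL n (by omega)
  have g1 := hG (blow c0)
  simp only [dd_blow, Nat.cast_zero, mul_zero, add_zero] at g1
  have w2 : (wr G c : ℝ) ≤ (n : ℝ) ^ 2 := by
    have := (Nat.cast_le (α := ℝ)).mpr (wr_le G c)
    simpa using this
  have X1 : (1 / 96 - δ' - κ) * (n : ℝ) ^ 5 ≤ (XX G).card := by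
    rw [hc] at g1
    have := mul_le_mul_of_nonneg_left w2 (show 0 ≤ κ * (n : ℝ) ^ 3 by positivity)
    have e : κ * (n : ℝ) ^ 3 * (n : ℝ) ^ 2 = κ * (n : ℝ) ^ 5 := by ring
    linarith
  have w3 : (wr G c : ℝ) ≤ δ / 1000 * (n : ℝ) ^ 2 := by
    obtain ⟨c', hc'⟩ := hS n (by omega) G (le_trans (by
      apply mul_le_mul_of_nonneg_right _ n5.le
      linarith) X1)
    have := (Nat.cast_le (α := ℝ)).mpr (dd_le G c')
    rw [hc] at this
    linarith
  have hP : 1 / 96 - δ < PNr (fun q => ((part c q).card : ℝ) / n) := by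
    have h := (Nat.cast_le (α := ℝ)).mpr (XX_le G c)
    rw [Nat.cast_add, PN_real _ n n0] at h
    simp only [Nat.cast_mul, Nat.cast_pow, Nat.cast_ofNat, Fintype.card_fin] at h
    have := mul_le_mul_of_nonneg_left w3 n3p.le
    have e : (n : ℝ) ^ 3 * (δ / 1000 * (n : ℝ) ^ 2) = δ / 1000 * (n : ℝ) ^ 5 := by ring
    have h' : (1 / 96 - δ' - κ - 25 * (δ / 1000)) * (n : ℝ) ^ 5 ≤
        PNr (fun q => ((part c q).card : ℝ) / n) * (n : ℝ) ^ 5 := by linarith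
    have := le_of_mul_le_mul_right h' n5
    linarith
  have hsum : ∑ q, ((part c q).card : ℝ) / n = 1 := by
    rw [← Finset.sum_div, ← Nat.cast_sum, sum_part, Fintype.card_fin]
    field_simp
  have hdeg : ∀ u, (∃ i, wrongR (fun q => ((part c q).card : ℝ) / n) (fun q => ((YY G c u q).card : ℝ) / n) i < η)
      ∧ ∀ q, 1 / 10 < ((part c q).card : ℝ) / n := by
    intro u
    refine hD _ _ (fun q => by positivity) (fun q => ?_) hsum hP ?_
    · rw [← YZ_card G c u q]
      push_cast
      gcongr
      simp
    · have h := max_deg G κ hκ.le (by simpa using hG) u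
      rw [Fintype.card_fin] at h
      have h2 := Fr_real n0 G c u
      have h3 := mul_le_mul_of_nonneg_left w3 (show 0 ≤ (n : ℝ) ^ 2 by positivity)
      have h5 : 25 * (n : ℝ) ^ 3 ≤ δ / 100 * (n : ℝ) ^ 4 := by
        have : 2500 / δ ≤ n := h4.trans (Nat.cast_le.mpr (by omega))
        rw [div_le_iff₀ hδ] at this
        have := mul_le_mul_of_nonneg_right this (show 0 ≤ (n : ℝ) ^ 3 / 100 by positivity)
        linarith
      have h6 : 5 * ((1 / 96 - δ' - κ) * (n : ℝ) ^ 4) ≤ LU G u + 25 * (n : ℝ) ^ 3 + 2 * κ * (n : ℝ) ^ 4 := by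
        refine le_of_mul_le_mul_left ?_ np
        refine le_trans ?_ h
        linarith
      have h7 : (5 / 96 - 5 * δ' - 7 * κ - δ / 100 - 125 * (δ / 1000)) * (n : ℝ) ^ 4 ≤
        Fr (fun q => ((part c q).card : ℝ) / n) (fun q => ((YY G c u q).card : ℝ) / n) * (n : ℝ) ^ 4 := by
        linarith
      have := le_of_mul_le_mul_right h7 n44
      linarith
  have hwd : ∀ u, (wd G c u : ℝ) ≤ η * n := by
    intro u
    obtain ⟨⟨i, hi⟩, -⟩ := hdeg u
    have h := (Nat.cast_le (α := ℝ)).mpr (wd_opt G c hc u i)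
    have e : wrongR (fun q => ((part c q).card : ℝ) / n) (fun q => ((YY G c u q).card : ℝ) / n) i * n =
        ((∑ j, if cadj i j = true then (ZZ G c u j).card else (YY G c u j).card : ℕ) : ℝ) := by
      unfold wrongR
      rw [Finset.sum_mul, Nat.cast_sum]
      refine Finset.sum_congr rfl fun j _ => ?_
      simp only
      rw [← YZ_card G c u j]
      split_ifs
      · push_cast; field_simp; ring
      · field_simp
    rw [← e] at h
    exact h.trans (mul_le_mul_of_nonneg_right hi.le np.le)
  have hfin := hE n (by omega) G c (fun q => by
    have := (hdeg ⟨0, n0⟩).2 q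
    rw [lt_div_iff₀ np] at this
    linarith) hwd
  have g2 := hG (blow c)
  simp only [dd_blow, Nat.cast_zero, mul_zero, add_zero] at g2
  rw [hc] at g2
  have hz : (κ0 - κ) * (n : ℝ) ^ 3 * wr G c ≤ 0 := by linarith
  have w0 : (wr G c : ℝ) = 0 := by
    have h1 : 0 < (κ0 - κ) * (n : ℝ) ^ 3 := mul_pos (by linarith) n3p
    have h2 : (0 : ℝ) ≤ wr G c := Nat.cast_nonneg _
    by_contra hne
    have h3 : (0 : ℝ) < wr G c := lt_of_le_of_ne h2 (Ne.symm hne)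
    have := mul_pos h1 h3
    linarith
  refine ⟨G, fun G' => ?_⟩
  have := hG G'
  rw [hc, w0, mul_zero, add_zero] at this
  exact this
end

theorem aut_card : (univ.filter (fun σ : Equiv.Perm (Fin 5) => ∀ i j, fadj (σ i) (σ j) = fadj i j)).card = 8 := by
  have h : (@Finset.filter (Equiv.Perm (Fin 5)) (fun σ => ∀ i j, fadj (σ i) (σ j) = fadj i j)
    (fun _ => inferInstance) Finset.univ).card = 8 := by decide +kernel
  rw [← h]

theorem F_adj (i j : Fin 5) : fourCyclePlusVertex.Adj i j ↔ fadj i j = true := by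
  simp only [fourCyclePlusVertex, SimpleGraph.fromRel_adj]
  revert i j
  decide

theorem fiber_card {n : ℕ} (G : SimpleGraph (Fin n)) (S : Finset (Fin n)) :
    ((XX G).filter (fun x => univ.image x = S)).card =
      if Nonempty (fourCyclePlusVertex ≃g (G.induce (S : Set (Fin n)))) then 8 else 0 := by
  split_ifs with h
  · obtain ⟨e⟩ := h
    obtain ⟨x0, hx0⟩ : ∃ x0 : Fin 5 → Fin n, x0 = fun i => (e i).1 := ⟨_, rfl⟩
    have inj0 : Function.Injective x0 := by
      intro i j hij
      rw [hx0] at hij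
      exact e.injective (Subtype.ext hij)
    have adj0 : ∀ i j, G.Adj (x0 i) (x0 j) ↔ fadj i j = true := by
      intro i j
      rw [← F_adj, ← e.map_adj_iff, hx0]
      simp
    have im0 : univ.image x0 = S := by
      ext v
      simp only [mem_image, mem_univ, true_and]
      constructor
      · rintro ⟨i, rfl⟩
        rw [hx0]
        exact (e i).2
      · intro hv
        obtain ⟨i, hi⟩ := e.surjective ⟨v, hv⟩
        exact ⟨i, by rw [hx0]; simp [hi]⟩
    rw [← aut_card]
    symm
    refine Finset.card_bij (fun σ _ => fun i => x0 (σ i)) ?_ ?_ ?_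
    · intro σ hσ
      have hσ := (mem_filter.mp hσ).2
      simp only [XX, mem_filter, mem_univ, true_and]
      refine ⟨⟨inj0.comp σ.injective, fun i j => by rw [adj0, hσ]⟩, ?_⟩
      rw [← im0]
      ext v
      simp only [mem_image, mem_univ, true_and]
      constructor
      · rintro ⟨i, rfl⟩
        exact ⟨σ i, rfl⟩
      · rintro ⟨i, rfl⟩
        exact ⟨σ.symm i, by simp⟩
    · intro σ _ τ _ h
      ext i
      exact congrArg Fin.val (inj0 (congrFun h i))
    · intro x hx
      simp only [XX, mem_filter, mem_univ, true_and] at hx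
      obtain ⟨⟨hxi, hxa⟩, hxS⟩ := hx
      have hex : ∀ i, ∃ j, x0 j = x i := by
        intro i
        have : x i ∈ univ.image x0 := by
          rw [im0, ← hxS]
          exact mem_image_of_mem _ (mem_univ i)
        simpa using this
      choose s hs using hex
      have sinj : Function.Injective s := by
        intro i j hij
        apply hxi
        rw [← hs, ← hs, hij]
      refine ⟨Equiv.ofBijective s (Finite.injective_iff_bijective.mp sinj), ?_, ?_⟩
      · simp only [mem_filter, mem_univ, true_and, Equiv.ofBijective_apply]
        intro i j
        apply Bool.eq_iff_iff.mpr
        rw [← adj0, hs, hs, hxa]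
      · funext i
        simp [hs]
  · rw [card_eq_zero, Finset.filter_eq_empty_iff]
    intro x hx hxS
    apply h
    simp only [XX, mem_filter, mem_univ, true_and] at hx
    have hmem : ∀ i, x i ∈ (S : Set (Fin n)) := by
      intro i
      rw [← hxS]
      simp
    refine ⟨⟨Equiv.ofBijective (fun i => (⟨x i, hmem i⟩ : (S : Set (Fin n)))) ⟨?_, ?_⟩, ?_⟩⟩
    · intro i j hij
      exact hx.1 (Subtype.mk.inj hij)
    · rintro ⟨v, hv⟩
      have hv' : v ∈ univ.image x := by
        rw [hxS]
        exact hv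
      obtain ⟨i, -, hi⟩ := mem_image.mp hv'
      exact ⟨i, Subtype.ext hi⟩
    · intro i j
      rw [F_adj, ← hx.2 i j]
      exact Iff.rfl

theorem XX_eq {n : ℕ} (G : SimpleGraph (Fin n)) :
    (XX G).card = 8 * numCopies fourCyclePlusVertex G := by
  have h := Finset.card_eq_sum_card_fiberwise (s := XX G) (t := powersetCard 5 univ)
    (f := fun x => univ.image x) (by
      intro x hx
      have hx : x ∈ XX G := hx
      simp only [XX, mem_filter, mem_univ, true_and] at hx
      have : univ.image x ∈ powersetCard 5 (univ : Finset (Fin n)) := by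
        rw [mem_powersetCard]
        refine ⟨subset_univ _, ?_⟩
        rw [card_image_of_injective _ hx.1]
        simp
      exact this)
  rw [h]
  unfold numCopies
  rw [Finset.card_filter, Finset.mul_sum]
  refine Finset.sum_congr rfl fun S _ => ?_
  refine Eq.trans ?_ ((fiber_card G S).trans ?_)
  · congr
  · split_ifs <;> rfl

theorem dist_le {n : ℕ} (G : SimpleGraph (Fin n)) : distToFam G isBlowup2K2 ≤ dd G := by
  obtain ⟨c, hc⟩ := dd_exists G
  rw [hc]
  have hb : isBlowup2K2 (blow c) := by
    refine ⟨c, fun u v => ?_⟩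
    rw [blow_adj]
    simp [cadj]
  have h1 : distToFam G isBlowup2K2 ≤ editDist G (blow c) :=
    ciInf_le (f := fun H : {H : SimpleGraph (Fin n) // isBlowup2K2 H} => editDist G H.1)
      (OrderBot.bddBelow _) ⟨blow c, hb⟩
  refine h1.trans ?_
  refine (ciInf_le (OrderBot.bddBelow _) (1 : Equiv.Perm (Fin n))).trans ?_
  unfold wr
  apply card_le_card
  intro p hp
  have hp := (mem_filter.mp hp).2
  rw [mem_filter]
  exact ⟨mem_univ _, hp.2⟩

theorem lamF_eq {n : ℕ} (G : SimpleGraph (Fin n)) :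
    lamF fourCyclePlusVertex G = ((XX G).card : ℝ) / (8 * (n.choose 5 : ℝ)) := by
  unfold lamF
  rw [XX_eq]
  push_cast
  rw [mul_div_mul_left _ _ (by norm_num)]

theorem lamF_le_max {n : ℕ} (G : SimpleGraph (Fin n)) :
    lamF fourCyclePlusVertex G ≤ lamFmax fourCyclePlusVertex n :=
  le_ciSup (f := fun G : SimpleGraph (Fin n) => lamF fourCyclePlusVertex G)
    (Set.finite_range _).bddAbove G

theorem XX_upper {n : ℕ} (hn : 0 < n) (G : SimpleGraph (Fin n)) :
    ((XX G).card : ℝ) ≤ (n : ℝ) ^ 5 / 96 + 84 * (n : ℝ) ^ 4 := by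
  have h := XX_flag G
  have hS : 0 ≤ Stot (adjB G) :=
    Finset.sum_nonneg fun x _ => Finset.sum_nonneg fun y _ => Finset.sum_nonneg fun z _ =>
      Finset.sum_nonneg fun u _ => mul_nonneg (ind_nonneg _)
        (add_nonneg (by positivity) (Bd_nonneg _ _ _ _ _))
  rw [Fintype.card_fin] at h
  have h' : 1728 * (n : ℤ) * (XX G).card ≤ 18 * (n : ℤ) ^ 6 + 144000 * (n : ℤ) ^ 5 := by linarith
  have h2 := (Int.cast_le (R := ℝ)).mpr h'
  push_cast at h2
  have np : (0 : ℝ) < n := Nat.cast_pos.mpr hn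
  refine le_of_mul_le_mul_left (a := 1728 * (n : ℝ)) ?_ (by positivity)
  have : (0 : ℝ) ≤ (n : ℝ) ^ 5 := by positivity
  nlinarith

theorem ratio_tendsto : Filter.Tendsto (fun n : ℕ => (n : ℝ) ^ 5 / (8 * (n.choose 5 : ℝ))) Filter.atTop
    (nhds 15) := by
  have h := isEquivalent_choose 5
  have h2 := (Asymptotics.isEquivalent_iff_tendsto_one (by
    filter_upwards [Filter.eventually_gt_atTop 0] with n hn
    have : (0 : ℝ) < n := Nat.cast_pos.mpr hn
    positivity)).mp h
  have h3 := (h2.inv₀ one_ne_zero).const_mul 15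
  rw [inv_one, mul_one] at h3
  refine h3.congr' ?_
  filter_upwards [Filter.eventually_ge_atTop 5] with n hn
  have h5 : (0 : ℝ) < n.choose 5 := Nat.cast_pos.mpr (Nat.choose_pos hn)
  have np : (0 : ℝ) < n := Nat.cast_pos.mpr (by omega)
  simp only [Pi.inv_apply, Pi.div_apply]
  rw [show (Nat.factorial 5 : ℝ) = 120 by norm_num [Nat.factorial]]
  field_simp
  norm_num

theorem lim_part : Filter.Tendsto (fun n => lamFmax fourCyclePlusVertex n) Filter.atTop (nhds (5/32)) := by
  have ha : Filter.Tendsto (fun n : ℕ => lamFmax fourCyclePlusVertex n * (8 * (n.choose 5 : ℝ)) / (n : ℝ) ^ 5)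
      Filter.atTop (nhds (1 / 96)) := by
    rw [Metric.tendsto_atTop]
    intro ε hε
    obtain ⟨n1, h1⟩ := lower_bound (ε / 2) (by positivity)
    obtain ⟨n2, h2⟩ := exists_nat_ge (168 / ε)
    refine ⟨n1 + n2 + 5, fun n hn => ?_⟩
    have n0 : 0 < n := by omega
    have np : (0 : ℝ) < n := Nat.cast_pos.mpr n0
    have h5 : (0 : ℝ) < n.choose 5 := Nat.cast_pos.mpr (Nat.choose_pos (by omega))
    have n5 : (0 : ℝ) < (n : ℝ) ^ 5 := by positivity
    rw [Real.dist_eq, abs_lt]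
    constructor
    · obtain ⟨c, hc⟩ := h1 n (by omega)
      have h6 := lamF_le_max (blow c)
      rw [lamF_eq, div_le_iff₀ (by positivity)] at h6
      have : 1 / 96 - ε / 2 ≤ lamFmax fourCyclePlusVertex n * (8 * (n.choose 5 : ℝ)) / (n : ℝ) ^ 5 := by
        rw [le_div_iff₀ n5]
        linarith
      linarith
    · have h6 : lamFmax fourCyclePlusVertex n ≤ ((n : ℝ) ^ 5 / 96 + 84 * (n : ℝ) ^ 4) / (8 * (n.choose 5 : ℝ)) := by
        refine ciSup_le fun G => ?_
        rw [lamF_eq]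
        have := XX_upper n0 G
        gcongr
      rw [le_div_iff₀ (by positivity)] at h6
      have h7 : 84 * (n : ℝ) ^ 4 ≤ ε / 2 * (n : ℝ) ^ 5 := by
        have : 168 / ε ≤ n := h2.trans (Nat.cast_le.mpr (by omega))
        rw [div_le_iff₀ hε] at this
        have := mul_le_mul_of_nonneg_right this (show 0 ≤ (n : ℝ) ^ 4 / 2 by positivity)
        linarith
      have : lamFmax fourCyclePlusVertex n * (8 * (n.choose 5 : ℝ)) / (n : ℝ) ^ 5 ≤ 1 / 96 + ε / 2 := by
        rw [div_le_iff₀ n5]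
        linarith
      linarith
  have h := ha.mul ratio_tendsto
  rw [show (1 / 96 * 15 : ℝ) = 5 / 32 by norm_num] at h
  refine h.congr' ?_
  filter_upwards [Filter.eventually_ge_atTop 5] with n hn
  have h5 : (0 : ℝ) < n.choose 5 := Nat.cast_pos.mpr (Nat.choose_pos hn)
  have np : (0 : ℝ) < n := Nat.cast_pos.mpr (by omega)
  field_simp

theorem stab_part : ∃ C : ℝ, 0 < C ∧ ∀ n : ℕ, (C ≤ n) → ∀ G : SimpleGraph (Fin n),
      (distToFam G isBlowup2K2 : ℝ) ≤
        C * (lamFmax fourCyclePlusVertex n - lamF fourCyclePlusVertex G) * n ^ 2 := by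
  obtain ⟨κ, hκ, n0, h⟩ := main_stab
  refine ⟨8 / κ + n0 + 5, by positivity, fun n hn G => ?_⟩
  have hk : 0 < 8 / κ := by positivity
  have hn0 : n0 ≤ n := by
    apply (Nat.cast_le (α := ℝ)).mp
    linarith
  have hn5 : 5 ≤ n := by
    apply (Nat.cast_le (α := ℝ)).mp
    push_cast
    have : (0 : ℝ) ≤ n0 := Nat.cast_nonneg _
    linarith
  obtain ⟨G0, hG0⟩ := h n hn0
  have np : (0 : ℝ) < n := Nat.cast_pos.mpr (by omega)
  have h5 : (0 : ℝ) < n.choose 5 := Nat.cast_pos.mpr (Nat.choose_pos hn5)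
  have h1 := hG0 G
  have e1 : ((XX G).card : ℝ) = lamF fourCyclePlusVertex G * (8 * (n.choose 5 : ℝ)) := by
    rw [lamF_eq]; field_simp
  have e2 : ((XX G0).card : ℝ) = lamF fourCyclePlusVertex G0 * (8 * (n.choose 5 : ℝ)) := by
    rw [lamF_eq]; field_simp
  obtain ⟨D, hD⟩ : ∃ D, D = lamFmax fourCyclePlusVertex n - lamF fourCyclePlusVertex G := ⟨_, rfl⟩
  have D0 : 0 ≤ D := by rw [hD]; linarith [lamF_le_max G]
  rw [← hD]
  have h2 : κ * (n : ℝ) ^ 3 * dd G ≤ D * (8 * (n : ℝ) ^ 5) := by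
    have h3 : κ * (n : ℝ) ^ 3 * dd G ≤ D * (8 * (n.choose 5 : ℝ)) := by
      rw [e1, e2] at h1
      have := mul_le_mul_of_nonneg_right (lamF_le_max G0) (show 0 ≤ 8 * (n.choose 5 : ℝ) by positivity)
      rw [hD]
      linarith
    have h4 : (n.choose 5 : ℝ) ≤ (n : ℝ) ^ 5 := by
      have := (Nat.cast_le (α := ℝ)).mpr (Nat.choose_le_pow n 5)
      simpa using this
    refine h3.trans ?_
    gcongr
  have h6 : (dd G : ℝ) ≤ 8 / κ * D * (n : ℝ) ^ 2 := by
    refine le_of_mul_le_mul_left (a := κ * (n : ℝ) ^ 3) ?_ (by positivity)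
    refine h2.trans (le_of_eq ?_)
    field_simp
  have h7 := (Nat.cast_le (α := ℝ)).mpr (dist_le G)
  have h8 : 8 / κ * D * (n : ℝ) ^ 2 ≤ (8 / κ + n0 + 5) * D * (n : ℝ) ^ 2 := by
    have : 8 / κ ≤ 8 / κ + n0 + 5 := by
      have : (0 : ℝ) ≤ n0 := Nat.cast_nonneg _
      linarith
    gcongr
  linarith

theorem inducibility_four_cycle_plus_vertex :
    Filter.Tendsto (fun n => lamFmax fourCyclePlusVertex n) Filter.atTop (nhds (5/32)) ∧
    ∃ C : ℝ, 0 < C ∧ ∀ n : ℕ, (C ≤ n) → ∀ G : SimpleGraph (Fin n),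
      (distToFam G isBlowup2K2 : ℝ) ≤
        C * (lamFmax fourCyclePlusVertex n - lamF fourCyclePlusVertex G) * n ^ 2 := by
  exact ⟨lim_part, stab_part⟩
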